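/- Let V be a Banach 𝕆-bimodule, T a power-associative bounded right para-linear operator on V, and σ(T) := σ*(T) ∪ σ_*(T). Let J ∈ 𝕊, and let f = f₀ + J •^R f₁ be right slice regular and g = g₀ + J •^L g₁ be left slice regular, with f₀, f₁, g₀, g₁ slice preserving regular on a slice-open set containing the closure of some T-admissible domain. Set f̃ := f₀ + J •^L f₁ and g̃ := g₀ + J •^R g₁. Then Re( f_*(T)_J ⊚ g*(T)_J ) = Re( (f •^R g̃)_*(T)_J ) = Re( (f̃ •^L g)*(T)_J ), where Re is the real-part projection of the 𝕆-bimodule 𝓑_RO(V). -/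

import Mathlib

noncomputable section

open scoped BigOperators

/-- Octonions, realized via the Cayley–Dickson doubling of the quaternions. -/
@[ext]
structure Oct : Type where
  a : Quaternion ℝ
  b : Quaternion ℝ

namespace Oct

instance : Zero Oct := ⟨⟨0, 0⟩⟩
instance : Add Oct := ⟨fun x y => ⟨x.a + y.a, x.b + y.b⟩⟩
instance : Neg Oct := ⟨fun x => ⟨-x.a, -x.b⟩⟩
instance : Sub Oct := ⟨fun x y => ⟨x.a - y.a, x.b - y.b⟩⟩
instance : SMul ℕ Oct := ⟨fun n x => ⟨n • x.a, n • x.b⟩⟩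
instance : SMul ℤ Oct := ⟨fun n x => ⟨n • x.a, n • x.b⟩⟩
instance : SMul ℝ Oct := ⟨fun r x => ⟨r • x.a, r • x.b⟩⟩

def toLp (x : Oct) : WithLp 2 (Quaternion ℝ × Quaternion ℝ) :=
  (WithLp.equiv 2 (Quaternion ℝ × Quaternion ℝ)).symm (x.a, x.b)

lemma toLp_injective : Function.Injective toLp := by
  rintro ⟨xa, xb⟩ ⟨ya, yb⟩ h
  have ha : xa = ya :=
    congrArg (fun z => (WithLp.equiv 2 (Quaternion ℝ × Quaternion ℝ) z).1) h
  have hb : xb = yb :=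
    congrArg (fun z => (WithLp.equiv 2 (Quaternion ℝ × Quaternion ℝ) z).2) h
  subst ha; subst hb; rfl

instance : AddCommGroup Oct :=
  toLp_injective.addCommGroup toLp rfl (fun _ _ => rfl) (fun _ => rfl) (fun _ _ => rfl)
    (fun _ _ => rfl) (fun _ _ => rfl)

def toLpHom : Oct →+ WithLp 2 (Quaternion ℝ × Quaternion ℝ) where
  toFun := toLp
  map_zero' := rfl
  map_add' _ _ := rfl

instance : Module ℝ Oct := toLp_injective.module ℝ toLpHom fun _ _ => rfl

instance : NormedAddCommGroup Oct :=
  NormedAddCommGroup.induced Oct (WithLp 2 (Quaternion ℝ × Quaternion ℝ)) toLpHom toLp_injective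

instance : NormedSpace ℝ Oct := ⟨fun r x => norm_smul_le r (toLp x)⟩

def toProdLin : Oct →ₗ[ℝ] Quaternion ℝ × Quaternion ℝ where
  toFun x := (x.a, x.b)
  map_add' _ _ := rfl
  map_smul' _ _ := rfl

lemma toProdLin_injective : Function.Injective toProdLin := by
  rintro ⟨xa, xb⟩ ⟨ya, yb⟩ h
  have ha : xa = ya := congrArg Prod.fst h
  have hb : xb = yb := congrArg Prod.snd h
  subst ha; subst hb; rfl

instance : FiniteDimensional ℝ Oct :=
  FiniteDimensional.of_injective toProdLin toProdLin_injective

instance : CompleteSpace Oct := FiniteDimensional.complete ℝ Oct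

instance : One Oct := ⟨⟨1, 0⟩⟩

instance : Mul Oct :=
  ⟨fun x y => ⟨x.a * y.a - star y.b * x.b, y.b * x.a + x.b * star y.a⟩⟩

/-- Octonionic conjugation. -/
def conj (x : Oct) : Oct := ⟨star x.a, -x.b⟩

/-- The real part of an octonion. -/
def re (x : Oct) : ℝ := x.a.re

/-- Powers of an octonion (association chosen on the left factor). -/
def opow (s : Oct) : ℕ → Oct
  | 0 => 1
  | n + 1 => s * opow s n

/-- The inverse of a nonzero octonion. -/
def oinv (s : Oct) : Oct := (‖s‖ ^ 2)⁻¹ • conj s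

/-- `invPow s n` is the octonion `s ^ (-1 - n)`. -/
def invPow (s : Oct) (n : ℕ) : Oct := opow (oinv s) (n + 1)

def eNat : ℕ → Oct
  | 0 => ⟨1, 0⟩
  | 1 => ⟨⟨0, 1, 0, 0⟩, 0⟩
  | 2 => ⟨⟨0, 0, 1, 0⟩, 0⟩
  | 3 => ⟨⟨0, 0, 0, 1⟩, 0⟩
  | 4 => ⟨0, 1⟩
  | 5 => ⟨0, ⟨0, 1, 0, 0⟩⟩
  | 6 => ⟨0, ⟨0, 0, 1, 0⟩⟩
  | 7 => ⟨0, ⟨0, 0, 0, 1⟩⟩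
  | _ => 0

/-- The standard basis `e_0 = 1, e_1, …, e_7` of the octonions. -/
def e (i : Fin 8) : Oct := eNat i.val

/-- The six-dimensional sphere `𝕊` of imaginary units of `𝕆`. -/
def unitSphere : Set Oct := {J | J * J = -1}

/-- The slice `ℂ_J = ℝ ⊕ ℝJ` of the octonions. -/
def sliceC (J : Oct) : Set Oct := {s | ∃ x y : ℝ, s = x • (1 : Oct) + y • J}

/-- The embedding of `ℂ` onto the slice `ℂ_J`, `x + y i ↦ x + y J`. -/
def toSlice (J : Oct) (z : ℂ) : Oct := z.re • (1 : Oct) + z.im • J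

end Oct

open Oct

/-- A (normed/Banach) `𝕆`-bimodule: a real normed space with continuous real-bilinear left and
right octonionic multiplications satisfying the alternativity relations
`[p,q,x] = [q,x,p] = [x,p,q] = -[q,p,x]` and the norm identities `‖px‖ = |p|‖x‖ = ‖xp‖`. -/
class OctBimodule (V : Type*) [NormedAddCommGroup V] [NormedSpace ℝ V] : Type _ where
  lm : Oct →ₗ[ℝ] V →L[ℝ] V
  rm : Oct →ₗ[ℝ] V →L[ℝ] V
  lm_one : ∀ x : V, lm 1 x = x
  rm_one : ∀ x : V, rm 1 x = x
  /-- `[p,q,x] = [q,x,p]` -/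
  assoc_cyc₁ : ∀ (p q : Oct) (x : V),
    lm (p * q) x - lm p (lm q x) = rm p (lm q x) - lm q (rm p x)
  /-- `[p,q,x] = [x,p,q]` -/
  assoc_cyc₂ : ∀ (p q : Oct) (x : V),
    lm (p * q) x - lm p (lm q x) = rm q (rm p x) - rm (p * q) x
  /-- `[p,q,x] = -[q,p,x]` -/
  assoc_alt : ∀ (p q : Oct) (x : V),
    lm (p * q) x - lm p (lm q x) = -(lm (q * p) x - lm q (lm p x))
  norm_lm : ∀ (p : Oct) (x : V), ‖lm p x‖ = ‖p‖ * ‖x‖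
  norm_rm : ∀ (p : Oct) (x : V), ‖rm p x‖ = ‖p‖ * ‖x‖

section OctMod

variable {V : Type*} [NormedAddCommGroup V] [NormedSpace ℝ V] [OctBimodule V]

/-- Left multiplication `x ↦ p x` as a bounded real-linear operator. -/
def lmo (p : Oct) : V →L[ℝ] V := OctBimodule.lm p

/-- Right multiplication `R_p : x ↦ x p` as a bounded real-linear operator. -/
def rmo (p : Oct) : V →L[ℝ] V := OctBimodule.rm p

variable (V)

/-- The real-part projection `Re x = (5/12) x - (1/12) ∑_{i=1}^7 e_i x e_i` of an
`𝕆`-bimodule. -/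
def reO : V →L[ℝ] V :=
  (5 / 12 : ℝ) • ContinuousLinearMap.id ℝ V -
    (1 / 12 : ℝ) • ∑ i : Fin 7, (rmo (e i.succ)).comp (lmo (e i.succ))

/-- The real part `Re V` of an `𝕆`-bimodule, i.e. the set of associative central elements. -/
def ReSet : Set V :=
  {m | (∀ p q : Oct, lmo (p * q) m = lmo p (lmo q m)) ∧ ∀ p : Oct, lmo p m = rmo p m}

/-- The slice `ℂ_J(V) = Re V ⊕ J · Re V` of an `𝕆`-bimodule. -/
def CJV (J : Oct) : Set V :=
  {x | ∃ u ∈ ReSet V, ∃ w ∈ ReSet V, x = u + lmo J w}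

/-- The slice projection `π_J(x) = Re x + J Re (J̄ x)`. -/
def piJ (J : Oct) : V →L[ℝ] V :=
  reO V + (lmo J).comp ((reO V).comp (lmo (Oct.conj J)))

variable {V}

/-- The second right associator `B_p(T, x) = T(x) p - T(x p)` of an operator. -/
def Bop (p : Oct) (T : V →L[ℝ] V) : V →L[ℝ] V := (rmo p).comp T - T.comp (rmo p)

/-- A bounded real-linear operator is right (octonionic) para-linear if `Re B_p(T,x) = 0`. -/
def IsRightPara (T : V →L[ℝ] V) : Prop := ∀ (p : Oct) (x : V), reO V (Bop p T x) = 0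

/-- The left octonionic scalar multiplication `(p ⊙ T)(x) = p T(x) + B_p(T,x)` on operators. -/
def odotL (p : Oct) (T : V →L[ℝ] V) : V →L[ℝ] V := (lmo p).comp T + Bop p T

/-- The right octonionic scalar multiplication `(T ⊙ p)(x) = T(p x) - B_p(T,x)` on operators. -/
def odotR (T : V →L[ℝ] V) (p : Oct) : V →L[ℝ] V := T.comp (lmo p) - Bop p T

/-- The lifting map, `(lif F)(x) = ∑_i F(x ē_i) e_i`. -/
def lifO (F : V →L[ℝ] V) : V →L[ℝ] V :=
  ∑ i : Fin 8, (rmo (e i)).comp (F.comp (rmo (Oct.conj (e i))))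

/-- The extension map, `(ext G)(∑ x_i e_i) = ∑ G(x_i) e_i`, where `x_i = Re (x ē_i)`. -/
def extO (G : V →L[ℝ] V) : V →L[ℝ] V :=
  ∑ i : Fin 8, (rmo (e i)).comp (G.comp ((reO V).comp (rmo (Oct.conj (e i)))))

/-- The left regular power `T^{n⊚} = lif (Re ∘ Tⁿ)`. -/
def rpowL (T : V →L[ℝ] V) (n : ℕ) : V →L[ℝ] V := lifO ((reO V).comp (T ^ n))

/-- The right regular power `T^{⊚n} = ext (Tⁿ|_{Re V})`. -/
def rpowR (T : V →L[ℝ] V) (n : ℕ) : V →L[ℝ] V := extO (T ^ n)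

/-- The regular composition `f ⊚ g = lif (Re ∘ f ∘ g)`. -/
def rcomp (f g : V →L[ℝ] V) : V →L[ℝ] V := lifO ((reO V).comp (f.comp g))

/-- The composition associator `[f,g,x]_⊚ = (f ⊚ g)(x) - f(g(x))`. -/
def compAssoc (f g : V →L[ℝ] V) (x : V) : V := rcomp f g x - f (g x)

/-- The right regular inverse `T^{⊚-} = ext (T⁻¹|_{Re V})` of an invertible operator. -/
def rinvR (T : V →L[ℝ] V) : V →L[ℝ] V := extO (Ring.inverse T)

/-- The left regular inverse `T^{-⊚} = lif (Re ∘ T⁻¹)` of an invertible operator. -/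
def rinvL (T : V →L[ℝ] V) : V →L[ℝ] V := lifO ((reO V).comp (Ring.inverse T))

/-- An operator is power-associative if all of its (composition) powers are right
para-linear. -/
def IsPowerAssoc (T : V →L[ℝ] V) : Prop := ∀ n : ℕ, IsRightPara (T ^ n)

/-- A bounded operator is octonionic linear if `T(xp) = T(x)p` for all `p`. -/
def IsOctLinear (T : V →L[ℝ] V) : Prop := ∀ (p : Oct) (x : V), T (rmo p x) = rmo p (T x)

/-- `S` is `ℂ_J`-extendable power associative: `Sⁿ(v s) = Sⁿ(v) s` for `v ∈ Re V`,
`s ∈ ℂ_J`, `n ≥ 1`. -/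
def CJExtPA (J : Oct) (S : V →L[ℝ] V) : Prop :=
  ∀ n : ℕ, 1 ≤ n → ∀ v ∈ ReSet V, ∀ s ∈ sliceC J, (S ^ n) (rmo s v) = rmo s ((S ^ n) v)

/-- `S` is `ℂ_J`-liftable power associative: `Re (Sⁿ(v s)) = Re (Sⁿ(v) s)` for all `v ∈ V`,
`s ∈ ℂ_J`, `n ≥ 1`. -/
def CJLiftPA (J : Oct) (S : V →L[ℝ] V) : Prop :=
  ∀ n : ℕ, 1 ≤ n → ∀ (v : V), ∀ s ∈ sliceC J,
    reO V ((S ^ n) (rmo s v)) = reO V (rmo s ((S ^ n) v))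

/-- The pull-back slice-resolvent set `ρ*_J(T)`. -/
def pbResSlice (T : V →L[ℝ] V) (J : Oct) : Set Oct :=
  {s | s ∈ sliceC J ∧ IsUnit ((rmo s : V →L[ℝ] V) - T) ∧
    CJExtPA J (Ring.inverse ((rmo s : V →L[ℝ] V) - T))}

/-- The pull-back resolvent set `ρ*(T)`. -/
def pbRes (T : V →L[ℝ] V) : Set Oct := ⋃ J ∈ unitSphere, pbResSlice T J

/-- The pull-back spectrum `σ*(T) = 𝕆 ∖ ρ*(T)`. -/
def pbSpec (T : V →L[ℝ] V) : Set Oct := Set.univ \ pbRes T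

/-- The push-forward slice-resolvent set `ρ_{*J}(T)`. -/
def pfResSlice (T : V →L[ℝ] V) (J : Oct) : Set Oct :=
  {s | s ∈ sliceC J ∧ IsUnit ((rmo s : V →L[ℝ] V) - T) ∧
    CJLiftPA J (Ring.inverse ((rmo s : V →L[ℝ] V) - T))}

/-- The push-forward resolvent set `ρ_*(T)`. -/
def pfRes (T : V →L[ℝ] V) : Set Oct := ⋃ J ∈ unitSphere, pfResSlice T J

/-- The push-forward spectrum `σ_*(T) = 𝕆 ∖ ρ_*(T)`. -/
def pfSpec (T : V →L[ℝ] V) : Set Oct := Set.univ \ pfRes T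

/-- The real-part projection of the `𝕆`-bimodule `𝓑_RO(V)` of bounded right para-linear
operators, given by `Re A = (5/12) A - (1/12) ∑_{i=1}^7 (e_i ⊙ A) ⊙ e_i`. -/
def reOpB (A : V →L[ℝ] V) : V →L[ℝ] V :=
  (5 / 12 : ℝ) • A - (1 / 12 : ℝ) • ∑ i : Fin 7, odotR (odotL (e i.succ) A) (e i.succ)

end OctMod

/-- A set `U ⊆ 𝕆` is slice-open if `U ∩ ℂ_J` is open in `ℂ_J` for every `J ∈ 𝕊`. -/
def SliceOpen (U : Set Oct) : Prop :=
  ∀ J ∈ unitSphere, IsOpen (Oct.toSlice J ⁻¹' U)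

/-- A parametrization of the boundary `∂(U ∩ ℂ_J)` by finitely many continuously
differentiable, positively oriented Jordan curves (positivity of the orientation is encoded
through the winding numbers). -/
structure SliceContour (J : Oct) (U : Set Oct) where
  n : ℕ
  γ : Fin n → ℝ → ℂ
  smooth : ∀ i, ContDiff ℝ 1 (γ i)
  closed : ∀ i, γ i 0 = γ i 1
  jordan : ∀ i, Set.InjOn (γ i) (Set.Ico (0 : ℝ) 1)
  image_eq : (⋃ i, γ i '' Set.Icc (0 : ℝ) 1) = frontier (Oct.toSlice J ⁻¹' U)
  winding_inside : ∀ z : ℂ, Oct.toSlice J z ∈ U →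
    (∑ i, ∫ t in (0 : ℝ)..1, deriv (γ i) t / (γ i t - z)) = 2 * (Real.pi : ℂ) * Complex.I
  winding_outside : ∀ z : ℂ, Oct.toSlice J z ∉ closure U →
    (∑ i, ∫ t in (0 : ℝ)..1, deriv (γ i) t / (γ i t - z)) = 0

/-- The integral `∫_{∂(U ∩ ℂ_J)} Φ(s, ds)` along a slice contour: the integrand gets the
point of the curve and its derivative (both in the coordinates of the slice). -/
def contourSum {J : Oct} {U : Set Oct} (Γ : SliceContour J U) {E : Type*}
    [NormedAddCommGroup E] [NormedSpace ℝ E] (Φ : ℂ → ℂ → E) : E :=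
  ∑ i, ∫ t in (0 : ℝ)..1, Φ (Γ.γ i t) (deriv (Γ.γ i) t)

/-- An axially symmetric slice domain (s-domain) in `𝕆`. -/
structure IsAdmissibleDomain (U : Set Oct) : Prop where
  isOpen : IsOpen U
  isConnected : IsConnected U
  real_nonempty : (U ∩ {s : Oct | ∃ r : ℝ, s = r • (1 : Oct)}).Nonempty
  axially : ∀ (z : ℂ), ∀ I ∈ unitSphere, ∀ J ∈ unitSphere,
    Oct.toSlice I z ∈ U → Oct.toSlice J z ∈ U
  slice_conn : ∀ J ∈ unitSphere, IsConnected (Oct.toSlice J ⁻¹' U)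

section Adm

variable {V : Type*} [NormedAddCommGroup V] [NormedSpace ℝ V] [OctBimodule V]

/-- A `T`-left-admissible domain: an axially symmetric s-domain containing the pull-back
spectrum `σ*(T)`.  (The regularity of its slice boundaries is witnessed by the slice
contours used in the integrals.) -/
def LeftAdmissible (T : V →L[ℝ] V) (U : Set Oct) : Prop :=
  IsAdmissibleDomain U ∧ pbSpec T ⊆ U

/-- A `T`-right-admissible domain: an axially symmetric s-domain containing the push-forward
spectrum `σ_*(T)`. -/
def RightAdmissible (T : V →L[ℝ] V) (U : Set Oct) : Prop :=
  IsAdmissibleDomain U ∧ pfSpec T ⊆ U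

end Adm

/-- The axially symmetric set `Ω_D ⊆ 𝕆` induced by a conjugation-invariant set `D ⊆ ℂ`. -/
def OmegaD (D : Set ℂ) : Set Oct := ⋃ J ∈ unitSphere, Oct.toSlice J '' D

/-- `F` is the stem of a slice preserving slice regular function on `Ω_D`: it is holomorphic
on the open conjugation-invariant set `D` and intertwines complex conjugation. -/
structure IsStem (D : Set ℂ) (F : ℂ → ℂ) : Prop where
  isOpen : IsOpen D
  conj_mem : ∀ z ∈ D, (starRingEnd ℂ) z ∈ D
  holo : DifferentiableOn ℂ F D
  conj_comm : ∀ z ∈ D, F ((starRingEnd ℂ) z) = (starRingEnd ℂ) (F z)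

section FC

variable {V : Type*} [NormedAddCommGroup V] [NormedSpace ℝ V] [OctBimodule V]

/-- The slice integral `(1/2π) ∫_{∂(U∩ℂ_J)} (R_s - T)^{⊚-} ⊙ (ds_J f(s))` defining the left
slice regular functional calculus of a slice preserving function with stem `F`. -/
def leftFC (T : V →L[ℝ] V) (J : Oct) {U : Set Oct} (Γ : SliceContour J U)
    (F : ℂ → ℂ) : V →L[ℝ] V :=
  (2 * Real.pi)⁻¹ • contourSum Γ fun z dz =>
    odotR (rinvR ((rmo (Oct.toSlice J z) : V →L[ℝ] V) - T))
      ((-(Oct.toSlice J dz) * J) * Oct.toSlice J (F z))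

/-- The slice integral `(1/2π) ∫_{∂(U∩ℂ_J)} (f(s) ds_J) ⊙ (R_s - T)^{-⊚}` defining the right
slice regular functional calculus of a slice preserving function with stem `F`. -/
def rightFC (T : V →L[ℝ] V) (J : Oct) {U : Set Oct} (Γ : SliceContour J U)
    (F : ℂ → ℂ) : V →L[ℝ] V :=
  (2 * Real.pi)⁻¹ • contourSum Γ fun z dz =>
    odotL (Oct.toSlice J (F z) * (-(Oct.toSlice J dz) * J))
      (rinvL ((rmo (Oct.toSlice J z) : V →L[ℝ] V) - T))

end FC

/-- The family of stems of the components, relative to `J = ∑ c_i e_i`, of a function of the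
form `f₀ + f₁ • J` with `f₀, f₁` slice preserving with stems `F₀, F₁`. -/
def stemFamily (c : Fin 8 → ℝ) (F₀ F₁ : ℂ → ℂ) : Fin 8 → ℂ → ℂ :=
  fun i z => if i = 0 then F₀ z else (c i : ℂ) * F₁ z

namespace Oct

/-- Left multiplication by an octonion, as a real-linear map. -/
def lmulLin (q : Oct) : Oct →ₗ[ℝ] Oct where
  toFun x := q * x
  map_add' x y := by
    refine Oct.ext ?_ ?_
    · show q.a * (x.a + y.a) - star (x.b + y.b) * q.b =
        (q.a * x.a - star x.b * q.b) + (q.a * y.a - star y.b * q.b)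
      rw [mul_add, star_add, add_mul]; abel
    · show (x.b + y.b) * q.a + q.b * star (x.a + y.a) =
        (x.b * q.a + q.b * star x.a) + (y.b * q.a + q.b * star y.a)
      rw [add_mul, star_add, mul_add]; abel
  map_smul' r x := by
    refine Oct.ext ?_ ?_
    · show q.a * (r • x.a) - star (r • x.b) * q.b = r • (q.a * x.a - star x.b * q.b)
      rw [mul_smul_comm, Quaternion.star_smul, smul_mul_assoc, smul_sub]
    · show (r • x.b) * q.a + q.b * star (r • x.a) = r • (x.b * q.a + q.b * star x.a)
      rw [smul_mul_assoc, Quaternion.star_smul, mul_smul_comm, smul_add]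

/-- Left multiplication `L_q : x ↦ q x` as a bounded real-linear operator on `𝕆`. -/
def Lq (q : Oct) : Oct →L[ℝ] Oct := (lmulLin q).toContinuousLinearMap

/-- The two-sphere `[q] = {Re q + |Im q| J : J ∈ 𝕊}` associated with an octonion `q`. -/
def qSphere (q : Oct) : Set Oct :=
  {s | ∃ J ∈ unitSphere, s = Oct.re q • (1 : Oct) + ‖q - Oct.re q • (1 : Oct)‖ • J}

end Oct

namespace Oct

@[simp] lemma zero_a_re : (0 : Oct).a.re = 0 := rfl
@[simp] lemma zero_a_imI : (0 : Oct).a.imI = 0 := rfl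
@[simp] lemma zero_a_imJ : (0 : Oct).a.imJ = 0 := rfl
@[simp] lemma zero_a_imK : (0 : Oct).a.imK = 0 := rfl
@[simp] lemma zero_b_re : (0 : Oct).b.re = 0 := rfl
@[simp] lemma zero_b_imI : (0 : Oct).b.imI = 0 := rfl
@[simp] lemma zero_b_imJ : (0 : Oct).b.imJ = 0 := rfl
@[simp] lemma zero_b_imK : (0 : Oct).b.imK = 0 := rfl
@[simp] lemma one_a_re : (1 : Oct).a.re = 1 := rfl
@[simp] lemma one_a_imI : (1 : Oct).a.imI = 0 := rfl
@[simp] lemma one_a_imJ : (1 : Oct).a.imJ = 0 := rfl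
@[simp] lemma one_a_imK : (1 : Oct).a.imK = 0 := rfl
@[simp] lemma one_b_re : (1 : Oct).b.re = 0 := rfl
@[simp] lemma one_b_imI : (1 : Oct).b.imI = 0 := rfl
@[simp] lemma one_b_imJ : (1 : Oct).b.imJ = 0 := rfl
@[simp] lemma one_b_imK : (1 : Oct).b.imK = 0 := rfl
@[simp] lemma add_a (x y : Oct) : (x + y).a = x.a + y.a := rfl
@[simp] lemma add_b (x y : Oct) : (x + y).b = x.b + y.b := rfl
@[simp] lemma sub_a (x y : Oct) : (x - y).a = x.a - y.a := rfl
@[simp] lemma sub_b (x y : Oct) : (x - y).b = x.b - y.b := rfl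
@[simp] lemma neg_a (x : Oct) : (-x).a = -x.a := rfl
@[simp] lemma neg_b (x : Oct) : (-x).b = -x.b := rfl
@[simp] lemma smul_a (r : ℝ) (x : Oct) : (r • x).a = r • x.a := rfl
@[simp] lemma smul_b (r : ℝ) (x : Oct) : (r • x).b = r • x.b := rfl
@[simp] lemma mul_a (x y : Oct) : (x * y).a = x.a * y.a - star y.b * x.b := rfl
@[simp] lemma mul_b (x y : Oct) : (x * y).b = y.b * x.a + x.b * star y.a := rfl

/-- Octonions are determined by their eight real coordinates. -/
lemma ext_coord {x y : Oct} (h0 : x.a.re = y.a.re) (h1 : x.a.imI = y.a.imI)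
    (h2 : x.a.imJ = y.a.imJ) (h3 : x.a.imK = y.a.imK) (h4 : x.b.re = y.b.re)
    (h5 : x.b.imI = y.b.imI) (h6 : x.b.imJ = y.b.imJ) (h7 : x.b.imK = y.b.imK) : x = y :=
  Oct.ext (QuaternionAlgebra.ext h0 h1 h2 h3) (QuaternionAlgebra.ext h4 h5 h6 h7)

@[simp] lemma e_a_re (i : Fin 8) : (e i).a.re = if i = 0 then 1 else 0 := by
  fin_cases i <;> simp <;> rfl
@[simp] lemma e_a_imI (i : Fin 8) : (e i).a.imI = if i = 1 then 1 else 0 := by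
  fin_cases i <;> simp <;> rfl
@[simp] lemma e_a_imJ (i : Fin 8) : (e i).a.imJ = if i = 2 then 1 else 0 := by
  fin_cases i <;> simp <;> rfl
@[simp] lemma e_a_imK (i : Fin 8) : (e i).a.imK = if i = 3 then 1 else 0 := by
  fin_cases i <;> simp <;> rfl
@[simp] lemma e_b_re (i : Fin 8) : (e i).b.re = if i = 4 then 1 else 0 := by
  fin_cases i <;> simp <;> rfl
@[simp] lemma e_b_imI (i : Fin 8) : (e i).b.imI = if i = 5 then 1 else 0 := by
  fin_cases i <;> simp <;> rfl
@[simp] lemma e_b_imJ (i : Fin 8) : (e i).b.imJ = if i = 6 then 1 else 0 := by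
  fin_cases i <;> simp <;> rfl
@[simp] lemma e_b_imK (i : Fin 8) : (e i).b.imK = if i = 7 then 1 else 0 := by
  fin_cases i <;> simp <;> rfl

lemma e_zero : e 0 = 1 := rfl

lemma mul_one' (x : Oct) : x * 1 = x := by
  apply ext_coord <;> simp

lemma one_mul' (x : Oct) : 1 * x = x := by
  apply ext_coord <;> simp

lemma mul_add' (x y z : Oct) : x * (y + z) = x * y + x * z :=
  (lmulLin x).map_add y z

lemma mul_smul' (x : Oct) (r : ℝ) (y : Oct) : x * (r • y) = r • (x * y) :=
  (lmulLin x).map_smul r y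

lemma add_mul' (x y z : Oct) : (x + y) * z = x * z + y * z := by
  apply Oct.ext <;> simp [mul_add, add_mul] <;> abel

lemma smul_mul' (r : ℝ) (x y : Oct) : (r • x) * y = r • (x * y) := by
  apply Oct.ext <;> simp [smul_sub]

lemma mul_anticomm {x y : Oct} (hx : re x = 0) (hy : re y = 0)
    (h : x.a.imI * y.a.imI + x.a.imJ * y.a.imJ + x.a.imK * y.a.imK + x.b.re * y.b.re +
      x.b.imI * y.b.imI + x.b.imJ * y.b.imJ + x.b.imK * y.b.imK = 0) :
    x * y = -(y * x) := by
  have hx' : x.a.re = 0 := hx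
  have hy' : y.a.re = 0 := hy
  apply ext_coord <;> simp [hx', hy'] <;> linarith

lemma e_anticomm (i j : Fin 8) (hi : i ≠ 0) (hj : j ≠ 0) (hij : i ≠ j) :
    e i * e j = -(e j * e i) := by
  apply mul_anticomm
  · simp [re, hi]
  · simp [re, hj]
  · simp only [e_a_imI, e_a_imJ, e_a_imK, e_b_re, e_b_imI, e_b_imJ, e_b_imK]
    fin_cases i <;> fin_cases j <;> first | exact absurd rfl hij | norm_num [Fin.ext_iff]

lemma re_add (x y : Oct) : re (x + y) = re x + re y := by simp [re]
lemma re_smul (r : ℝ) (x : Oct) : re (r • x) = r * re x := by simp [re]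
lemma re_one : re 1 = 1 := by simp [re]

lemma re_neg (x : Oct) : re (-x) = -re x := by simp [re]

lemma sum_re_mul_conj (p : Oct) : ∑ i : Fin 8, re (e i * p) • conj (e i) = p := by
  simp only [Fin.sum_univ_eight]
  apply ext_coord <;> simp [conj, re]

lemma exists_coord (p : Oct) : ∃ c : Fin 8 → ℝ, p = ∑ i, c i • e i := by
  refine ⟨![p.a.re, p.a.imI, p.a.imJ, p.a.imK, p.b.re, p.b.imI, p.b.imJ, p.b.imK], ?_⟩
  simp only [Fin.sum_univ_eight]
  apply ext_coord <;> simp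

lemma norm_sq_eq (x : Oct) : ‖x‖ ^ 2 = ‖x.a‖ ^ 2 + ‖x.b‖ ^ 2 := by
  have : ‖x‖ = ‖toLp x‖ := rfl
  rw [this, WithLp.prod_norm_sq_eq_of_L2]
  rfl

lemma norm_sq_coord (x : Oct) : ‖x‖ ^ 2 =
    x.a.re ^ 2 + x.a.imI ^ 2 + x.a.imJ ^ 2 + x.a.imK ^ 2 +
      (x.b.re ^ 2 + x.b.imI ^ 2 + x.b.imJ ^ 2 + x.b.imK ^ 2) := by
  rw [norm_sq_eq, pow_two ‖x.a‖, pow_two ‖x.b‖, ← Quaternion.normSq_eq_norm_mul_self,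
    ← Quaternion.normSq_eq_norm_mul_self, Quaternion.normSq_def', Quaternion.normSq_def']

/-- An imaginary unit has real part zero. -/
lemma re_of_mem_unitSphere {J : Oct} (hJ : J ∈ unitSphere) : re J = 0 := by
  have hJ' : J * J = -1 := hJ
  have ha := congrArg Oct.a hJ'
  have hb := congrArg Oct.b hJ'
  have h0 := congrArg QuaternionAlgebra.re ha
  have h1 := congrArg QuaternionAlgebra.imI ha
  have h2 := congrArg QuaternionAlgebra.imJ ha
  have h3 := congrArg QuaternionAlgebra.imK ha
  have h4 := congrArg QuaternionAlgebra.re hb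
  have h5 := congrArg QuaternionAlgebra.imI hb
  have h6 := congrArg QuaternionAlgebra.imJ hb
  have h7 := congrArg QuaternionAlgebra.imK hb
  simp at h0 h1 h2 h3 h4 h5 h6 h7
  by_contra hr
  have hr' : J.a.re ≠ 0 := hr
  have key : ∀ y : ℝ, 2 * J.a.re * y = 0 → y = 0 := fun y hy => by
    have := mul_ne_zero two_ne_zero hr'
    exact (mul_eq_zero.mp hy).resolve_left this
  have k1 := key J.a.imI (by linarith)
  have k2 := key J.a.imJ (by linarith)
  have k3 := key J.a.imK (by linarith)
  have k4 := h4.resolve_right hr'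
  have k5 := key J.b.imI (by linarith)
  have k6 := key J.b.imJ (by linarith)
  have k7 := key J.b.imK (by linarith)
  rw [k1, k2, k3, k4, k5, k6, k7] at h0
  nlinarith [sq_nonneg J.a.re]

lemma mul_self_of_re_eq_zero {J : Oct} (h : re J = 0) : J * J = -(‖J‖ ^ 2) • (1 : Oct) := by
  have h' : J.a.re = 0 := h
  rw [norm_sq_coord]
  apply ext_coord <;> simp [h'] <;> ring

lemma norm_of_mem_unitSphere {J : Oct} (hJ : J ∈ unitSphere) : ‖J‖ = 1 := by
  have hJ' : J * J = -1 := hJ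
  rw [mul_self_of_re_eq_zero (re_of_mem_unitSphere hJ)] at hJ'
  have := congrArg (fun x : Oct => x.a.re) hJ'
  simp at this
  rcases this with h | h
  · exact h
  · linarith [norm_nonneg J]

lemma mem_unitSphere_of {J : Oct} (h0 : re J = 0) (h1 : ‖J‖ = 1) : J ∈ unitSphere := by
  show J * J = -1
  rw [mul_self_of_re_eq_zero h0, h1]
  simp

lemma e_mul_self (i : Fin 8) (hi : i ≠ 0) : e i * e i = -1 := by
  rw [mul_self_of_re_eq_zero (by simp [re, hi]), norm_sq_coord]
  suffices h : (e i).a.re ^ 2 + (e i).a.imI ^ 2 + (e i).a.imJ ^ 2 + (e i).a.imK ^ 2 +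
      ((e i).b.re ^ 2 + (e i).b.imI ^ 2 + (e i).b.imJ ^ 2 + (e i).b.imK ^ 2) = 1 by
    rw [h]; simp
  fin_cases i <;> simp

end Oct

section Bimodule

variable {V : Type*} [NormedAddCommGroup V] [NormedSpace ℝ V] [OctBimodule V]

lemma lmo_add (p q : Oct) (x : V) : lmo (p + q) x = lmo p x + lmo q x := by simp [lmo]
lemma lmo_sub (p q : Oct) (x : V) : lmo (p - q) x = lmo p x - lmo q x := by simp [lmo]
lemma lmo_neg (p : Oct) (x : V) : lmo (-p) x = -lmo p x := by simp [lmo]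
lemma lmo_smul (r : ℝ) (p : Oct) (x : V) : lmo (r • p) x = r • lmo p x := by simp [lmo]
lemma lmo_one (x : V) : lmo 1 x = x := OctBimodule.lm_one x
lemma rmo_add (p q : Oct) (x : V) : rmo (p + q) x = rmo p x + rmo q x := by simp [rmo]
lemma rmo_sub (p q : Oct) (x : V) : rmo (p - q) x = rmo p x - rmo q x := by simp [rmo]
lemma rmo_neg (p : Oct) (x : V) : rmo (-p) x = -rmo p x := by simp [rmo]
lemma rmo_smul (r : ℝ) (p : Oct) (x : V) : rmo (r • p) x = r • rmo p x := by simp [rmo]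
lemma rmo_one (x : V) : rmo 1 x = x := OctBimodule.rm_one x
lemma rmo_sum {ι : Type*} (s : Finset ι) (p : ι → Oct) (x : V) :
    rmo (∑ i ∈ s, p i) x = ∑ i ∈ s, rmo (p i) x := by simp [rmo]

/-- The associator `[p, q, x]` of two octonions and an element of a bimodule. -/
def asc (p q : Oct) (x : V) : V := lmo (p * q) x - lmo p (lmo q x)

lemma asc_swap (p q : Oct) (x : V) : asc q p x = -asc p q x := by
  have := OctBimodule.assoc_alt q p x
  exact this

lemma asc_eq_mid (p q : Oct) (x : V) : asc p q x = rmo p (lmo q x) - lmo q (rmo p x) :=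
  OctBimodule.assoc_cyc₁ p q x

lemma asc_eq_right (p q : Oct) (x : V) : asc p q x = rmo q (rmo p x) - rmo (p * q) x :=
  OctBimodule.assoc_cyc₂ p q x

lemma asc_self (p : Oct) (x : V) : asc p p x = 0 := by
  have h := asc_swap p p x
  have h2 : (2 : ℝ) • asc p p x = 0 := by rw [two_smul]; nth_rewrite 1 [h]; simp
  exact (smul_eq_zero.mp h2).resolve_left two_ne_zero

lemma lmo_lmo_self (p : Oct) (x : V) : lmo p (lmo p x) = lmo (p * p) x :=
  (sub_eq_zero.mp (asc_self p x)).symm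

lemma rmo_rmo_self (p : Oct) (x : V) : rmo p (rmo p x) = rmo (p * p) x := by
  have := asc_eq_right p p x
  rw [asc_self] at this
  exact (sub_eq_zero.mp this.symm)

lemma asc_teichmueller_left (p q r : Oct) (x : V) :
    asc (p * q) r x - asc p (q * r) x + asc p q (lmo r x) =
      lmo p (asc q r x) + lmo ((p * q) * r - p * (q * r)) x := by
  simp only [asc, lmo_sub, map_sub]; abel

lemma asc_teichmueller_mid (p q r : Oct) (x : V) :
    asc r (p * q) x - asc r p (lmo q x) + asc p q (rmo r x) =
      rmo r (asc p q x) + lmo p (asc r q x) := by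
  rw [asc_eq_mid r (p * q), asc_eq_mid r p, asc_eq_mid r q]
  simp only [asc, map_sub]; abel

lemma asc_teichmueller_right (p q r : Oct) (x : V) :
    asc q r (rmo p x) - asc (p * q) r x + asc p (q * r) x =
      rmo ((p * q) * r - p * (q * r)) x + rmo r (asc p q x) := by
  rw [asc_eq_right q r, asc_eq_right (p * q) r, asc_eq_right p (q * r), asc_eq_right p q]
  simp only [rmo_sub, map_sub]; abel

lemma Oct.associator_cyc (p q r : Oct) :
    (q * r) * p - q * (r * p) = (p * q) * r - p * (q * r) := by
  apply ext_coord <;>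
  simp only [sub_a, sub_b, mul_a, mul_b, Quaternion.re_sub, Quaternion.imI_sub,
    Quaternion.imJ_sub, Quaternion.imK_sub, Quaternion.re_add, Quaternion.imI_add,
    Quaternion.imJ_add, Quaternion.imK_add, Quaternion.re_mul, Quaternion.imI_mul,
    Quaternion.imJ_mul, Quaternion.imK_mul, Quaternion.re_star, Quaternion.imI_star,
    Quaternion.imJ_star, Quaternion.imK_star] <;> ring

/-- The commutator with an octonionic associator is a sum of associators. -/
lemma lmo_associator_sub (p q r : Oct) (x : V) :
    lmo ((p * q) * r - p * (q * r)) x - rmo ((p * q) * r - p * (q * r)) x =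
      asc (p * q) r x + asc (q * r) p x + asc (r * p) q x := by
  have h (p q r : Oct) : lmo ((p * q) * r - p * (q * r)) x - rmo ((p * q) * r - p * (q * r)) x =
      asc (p * q) r x + (2 : ℝ) • asc (q * r) p x + asc p q (lmo r x) - asc r p (lmo q x)
        + asc p q (rmo r x) - asc q r (rmo p x) := by
    have h1 := asc_teichmueller_left p q r x
    have h2 := asc_teichmueller_mid p q r x
    have h3 := asc_teichmueller_right p q r x
    rw [asc_swap (p * q) r, asc_swap q r, map_neg] at h2
    rw [asc_swap (q * r) p] at h1 h3
    linear_combination (norm := module) - (1 : ℝ) • h1 - (1 : ℝ) • h2 + (1 : ℝ) • h3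
  have h1 := h p q r
  have h2 := h q r p
  have h3 := h r p q
  rw [Oct.associator_cyc p q r] at h2
  rw [Oct.associator_cyc q r p, Oct.associator_cyc p q r] at h3
  linear_combination (norm := module) (1 / 3 : ℝ) • h1 + (1 / 3 : ℝ) • h2 + (1 / 3 : ℝ) • h3

end Bimodule

section Clifford

/-- In a ring with anticommuting square roots of `-1`, the relation `(A₁ + A₂ + A₃ - K)² = -4`
for products `Aᵢ` of two generators forces `A₂ A₃ = K A₁`. -/
lemma clifford_line_relation {R : Type*} [Ring R] [Algebra ℝ R] {K m₁ n₁ m₂ n₂ m₃ n₃ : R}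
    (hA₁ : (m₁ * n₁) * (m₁ * n₁) = -1) (hA₂ : (m₂ * n₂) * (m₂ * n₂) = -1)
    (hA₃ : (m₃ * n₃) * (m₃ * n₃) = -1) (hK : K * K = -1) (hm : m₁ * m₁ = -1)
    (h₁₂ : Commute (m₁ * n₁) (m₂ * n₂)) (h₁₃ : Commute (m₁ * n₁) (m₃ * n₃))
    (h₂₃ : Commute (m₂ * n₂) (m₃ * n₃)) (h₁K : Commute (m₁ * n₁) K)
    (h₂K : Commute (m₂ * n₂) K) (h₃K : Commute (m₃ * n₃) K)
    (hmA₁ : m₁ * (m₁ * n₁) = -((m₁ * n₁) * m₁)) (hmA₂ : Commute m₁ (m₂ * n₂))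
    (hmA₃ : Commute m₁ (m₃ * n₃)) (hmK : m₁ * K = -(K * m₁))
    (h : (m₁ * n₁ + m₂ * n₂ + m₃ * n₃ - K) * (m₁ * n₁ + m₂ * n₂ + m₃ * n₃ - K) = -4) :
    (m₂ * n₂) * (m₃ * n₃) = K * (m₁ * n₁) := by
  generalize m₁ * n₁ = A₁ at *
  generalize m₂ * n₂ = A₂ at *
  generalize m₃ * n₃ = A₃ at *
  have key : (2 : ℝ) • (A₁ * A₂ + A₁ * A₃ + A₂ * A₃ - K * (A₁ + A₂ + A₃)) = 0 := by
    have e : (A₁ + A₂ + A₃ - K) * (A₁ + A₂ + A₃ - K) =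
        A₁ * A₁ + A₂ * A₂ + A₃ * A₃ + K * K + (A₁ * A₂ + A₂ * A₁) + (A₁ * A₃ + A₃ * A₁)
          + (A₂ * A₃ + A₃ * A₂) - (A₁ * K + K * A₁) - (A₂ * K + K * A₂) - (A₃ * K + K * A₃) := by
      noncomm_ring
    rw [e, hA₁, hA₂, hA₃, hK, h₁₂.eq, h₁₃.eq, h₂₃.eq, h₁K.eq, h₂K.eq, h₃K.eq] at h
    rw [h₁₂.eq, h₁₃.eq, h₂₃.eq, mul_add, mul_add]
    have h' := congrArg (fun x => x + 4) h
    rw [two_smul]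
    have h4 : (4 : R) = 1 + 1 + 1 + 1 := by norm_num
    simp only [h4] at h'
    calc _ = _ := ?_
      _ = _ := h'
      _ = _ := by abel
    abel
  have key' := (smul_eq_zero.mp key).resolve_left two_ne_zero
  have e2 : m₁ * (A₁ * A₂ + A₁ * A₃ + A₂ * A₃ - K * (A₁ + A₂ + A₃)) +
      (A₁ * A₂ + A₁ * A₃ + A₂ * A₃ - K * (A₁ + A₂ + A₃)) * m₁ =
      (2 : ℝ) • ((A₂ * A₃ - K * A₁) * m₁) := by
    have f₁₂ : m₁ * (A₁ * A₂) = -(A₁ * A₂ * m₁) := by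
      rw [← mul_assoc, hmA₁, neg_mul, mul_assoc, hmA₂.eq, mul_assoc]
    have f₁₃ : m₁ * (A₁ * A₃) = -(A₁ * A₃ * m₁) := by
      rw [← mul_assoc, hmA₁, neg_mul, mul_assoc, hmA₃.eq, mul_assoc]
    have f₂₃ : m₁ * (A₂ * A₃) = (A₂ * A₃ * m₁) := by
      rw [← mul_assoc, hmA₂.eq, mul_assoc, hmA₃.eq, mul_assoc]
    have g₁ : m₁ * (K * A₁) = K * A₁ * m₁ := by
      rw [← mul_assoc, hmK, neg_mul, mul_assoc, hmA₁, mul_neg, neg_neg, mul_assoc]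
    have g₂ : m₁ * (K * A₂) = -(K * A₂ * m₁) := by
      rw [← mul_assoc, hmK, neg_mul, mul_assoc, hmA₂.eq, mul_assoc]
    have g₃ : m₁ * (K * A₃) = -(K * A₃ * m₁) := by
      rw [← mul_assoc, hmK, neg_mul, mul_assoc, hmA₃.eq, mul_assoc]
    rw [two_smul]
    simp only [mul_add, mul_sub, add_mul, sub_mul, f₁₂, f₁₃, f₂₃, g₁, g₂, g₃]
    abel
  rw [key', mul_zero, zero_mul, add_zero] at e2
  have e3 := (smul_eq_zero.mp e2.symm).resolve_left two_ne_zero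
  have e4 := congrArg (fun x => x * m₁) e3
  simp only [mul_assoc, hm, zero_mul, mul_neg, mul_one, neg_eq_zero] at e4
  exact sub_eq_zero.mp e4

end Clifford

section Bimodule

variable {V : Type*} [NormedAddCommGroup V] [NormedSpace ℝ V] [OctBimodule V]

variable (V) in
/-- Left multiplication by a basis element, as an element of the operator ring. -/
def Lop (i : Fin 8) : V →L[ℝ] V := lmo (e i)

lemma Lop_mul_self (i : Fin 8) (hi : i ≠ 0) : Lop V i * Lop V i = -1 := by
  ext x
  show lmo (e i) (lmo (e i) x) = -x
  rw [lmo_lmo_self, e_mul_self i hi, lmo_neg, lmo_one]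

lemma Lop_anticomm (i j : Fin 8) (hi : i ≠ 0) (hj : j ≠ 0) (hij : i ≠ j) :
    Lop V i * Lop V j = -(Lop V j * Lop V i) := by
  ext x
  show lmo (e i) (lmo (e j) x) = -lmo (e j) (lmo (e i) x)
  have h := asc_swap (e i) (e j) x
  simp only [asc, e_anticomm i j hi hj hij, lmo_neg] at h
  linear_combination (norm := module) (-1 : ℝ) • h

/-- The Fano-plane data of the three lines through a point `k`. -/
structure FanoPoint (k r₁ a₁ r₂ a₂ r₃ a₃ : Fin 8) : Prop where
  h₁₂ : e r₁ * e r₂ = e a₃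
  h₂₃ : e r₂ * e r₃ = e a₁
  h₃₁ : e r₃ * e r₁ = e a₂
  k₁ : e r₁ * e a₁ = e k
  k₂ : e r₂ * e a₂ = e k
  k₃ : e r₃ * e a₃ = e k
  nodup : [0, k, r₁, a₁, r₂, a₂, r₃, a₃].Nodup

variable {k r₁ a₁ r₂ a₂ r₃ a₃ : Fin 8}

lemma FanoPoint.two_smul_rmo (h : FanoPoint k r₁ a₁ r₂ a₂ r₃ a₃) (x : V) :
    (2 : ℝ) • rmo (e k) x = lmo (e r₁) (lmo (e a₁) x) + lmo (e r₂) (lmo (e a₂) x) +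
      lmo (e r₃) (lmo (e a₃) x) - lmo (e k) x := by
  have hn := h.nodup
  simp only [List.nodup_cons, List.mem_cons, not_or, List.not_mem_nil, ← ne_eq] at hn
  obtain ⟨⟨-, b2, b3, b4, b5, b6, b7, -⟩, -, ⟨c1, -⟩, -, ⟨d1, -⟩, -, ⟨f1, -⟩, -⟩ := hn
  have key := lmo_associator_sub (e r₁) (e r₂) (e r₃) x
  have t₁ := Lop_anticomm (V := V) r₁ a₁ (Ne.symm b2) (Ne.symm b3) c1
  have t₂ := Lop_anticomm (V := V) r₂ a₂ (Ne.symm b4) (Ne.symm b5) d1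
  have t₃ := Lop_anticomm (V := V) r₃ a₃ (Ne.symm b6) (Ne.symm b7) f1
  have s₁ := DFunLike.congr_fun t₁ x
  have s₂ := DFunLike.congr_fun t₂ x
  have s₃ := DFunLike.congr_fun t₃ x
  have u₁ : e a₁ * e r₁ = -e k := by
    rw [e_anticomm _ _ (Ne.symm b3) (Ne.symm b2) (Ne.symm c1), h.k₁]
  have u₂ : e a₂ * e r₂ = -e k := by
    rw [e_anticomm _ _ (Ne.symm b5) (Ne.symm b4) (Ne.symm d1), h.k₂]
  have u₃ : e a₃ * e r₃ = -e k := by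
    rw [e_anticomm _ _ (Ne.symm b7) (Ne.symm b6) (Ne.symm f1), h.k₃]
  simp only [h.h₁₂, h.h₂₃, h.h₃₁, u₁, u₂, u₃, asc, h.k₁, lmo_sub, rmo_sub, lmo_neg, rmo_neg] at key
  change lmo (e r₁) (lmo (e a₁) x) = -lmo (e a₁) (lmo (e r₁) x) at s₁
  change lmo (e r₂) (lmo (e a₂) x) = -lmo (e a₂) (lmo (e r₂) x) at s₂
  change lmo (e r₃) (lmo (e a₃) x) = -lmo (e a₃) (lmo (e r₃) x) at s₃
  rw [s₁, s₂, s₃]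
  linear_combination (norm := module) (1 : ℝ) • key

lemma FanoPoint.rotate (h : FanoPoint k r₁ a₁ r₂ a₂ r₃ a₃) : FanoPoint k r₂ a₂ r₃ a₃ r₁ a₁ := by
  refine ⟨h.h₂₃, h.h₃₁, h.h₁₂, h.k₂, h.k₃, h.k₁, ?_⟩
  have hp : [0, k, r₂, a₂, r₃, a₃, r₁, a₁].Perm [0, k, r₁, a₁, r₂, a₂, r₃, a₃] :=
    List.Perm.cons _ (List.Perm.cons _ (List.perm_append_comm (l₁ := [r₂, a₂, r₃, a₃])
      (l₂ := [r₁, a₁])))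
  exact hp.nodup_iff.mpr h.nodup

variable (V) in
/-- The involution `x ↦ -(e_r (e_a (e_k x)))` attached to an oriented line `(r, a, k)`. -/
def lineOp (r a k : Fin 8) : V →L[ℝ] V := -(Lop V r * Lop V a * Lop V k)

lemma lineOp_rotate (r a k : Fin 8) (hr : r ≠ 0) (ha : a ≠ 0) (hk : k ≠ 0) (hra : r ≠ a)
    (hrk : r ≠ k) : lineOp V r a k = lineOp V a k r := by
  rw [lineOp, lineOp, Lop_anticomm r a hr ha hra, neg_mul, mul_assoc, Lop_anticomm r k hr hk hrk,
    mul_neg, neg_neg, mul_assoc]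

lemma lineOp_mul_self (r a k : Fin 8) (hr : r ≠ 0) (ha : a ≠ 0) (hk : k ≠ 0) (hra : r ≠ a)
    (hrk : r ≠ k) (hak : a ≠ k) : lineOp V r a k * lineOp V r a k = 1 := by
  have h : Lop V a * Lop V k * Lop V r = Lop V r * (Lop V a * Lop V k) := by
    rw [mul_assoc, Lop_anticomm k r hk hr hrk.symm, mul_neg, ← mul_assoc,
      Lop_anticomm a r ha hr hra.symm, neg_mul, neg_neg, mul_assoc]
  rw [lineOp, neg_mul_neg, mul_assoc (Lop V r), mul_assoc (Lop V r),
    ← mul_assoc (Lop V a * Lop V k), h, mul_assoc (Lop V r), ← mul_assoc (Lop V r) (Lop V r),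
    Lop_mul_self r hr, mul_assoc (Lop V a), ← mul_assoc (Lop V k), Lop_anticomm k a hk ha hak.symm,
    neg_mul]
  simp [mul_assoc, Lop_mul_self k hk, Lop_mul_self a ha]

lemma FanoPoint.two_smul_rmo_op (h : FanoPoint k r₁ a₁ r₂ a₂ r₃ a₃) :
    (2 : ℝ) • (rmo (e k) : V →L[ℝ] V) = Lop V r₁ * Lop V a₁ + Lop V r₂ * Lop V a₂ +
      Lop V r₃ * Lop V a₃ - Lop V k := by
  ext x
  exact h.two_smul_rmo x

lemma commute_of_anticomm {R : Type*} [Ring R] {a b c : R} (hab : a * b = -(b * a))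
    (hac : a * c = -(c * a)) : Commute a (b * c) := by
  rw [commute_iff_eq, ← mul_assoc, hab, neg_mul, mul_assoc, hac, mul_neg, neg_neg, mul_assoc]

lemma FanoPoint.Lop_mul (h : FanoPoint k r₁ a₁ r₂ a₂ r₃ a₃) :
    (Lop V r₂ * Lop V a₂) * (Lop V r₃ * Lop V a₃) = Lop V k * (Lop V r₁ * Lop V a₁) := by
  have hn := h.nodup
  simp only [List.nodup_cons, List.mem_cons, not_or, List.not_mem_nil, ← ne_eq] at hn
  obtain ⟨⟨z1, z2, z3, z4, z5, z6, z7, -⟩, ⟨k2, k3, k4, k5, k6, k7, -⟩,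
    ⟨r3, r4, r5, r6, r7, -⟩, ⟨b4, b5, b6, b7, -⟩, ⟨c5, c6, c7, -⟩, ⟨d6, d7, -⟩, ⟨f7, -⟩, -⟩ := hn
  have ac : ∀ i j, 0 ≠ i → 0 ≠ j → i ≠ j → Lop V i * Lop V j = -(Lop V j * Lop V i) :=
    fun i j hi hj => Lop_anticomm i j hi.symm hj.symm
  have sq : ∀ i j, 0 ≠ i → 0 ≠ j → i ≠ j →
      (Lop V i * Lop V j) * (Lop V i * Lop V j) = -1 := fun i j hi hj hij => by
    rw [mul_assoc, ← mul_assoc (Lop V j), ac j i hj hi hij.symm, neg_mul, mul_assoc,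
      Lop_mul_self j hj.symm]
    simp [Lop_mul_self i hi.symm]
  have cm : ∀ i j l, 0 ≠ i → 0 ≠ j → 0 ≠ l → i ≠ j → i ≠ l → Commute (Lop V i) (Lop V j * Lop V l) :=
    fun i j l hi hj hl hij hil => commute_of_anticomm (ac i j hi hj hij) (ac i l hi hl hil)
  apply clifford_line_relation (sq _ _ z2 z3 r3) (sq _ _ z4 z5 c5) (sq _ _ z6 z7 f7)
    (Lop_mul_self k z1.symm) (Lop_mul_self r₁ z2.symm)
    ((cm _ _ _ z2 z4 z5 r4 r5).mul_left (cm _ _ _ z3 z4 z5 b4 b5))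
    ((cm _ _ _ z2 z6 z7 r6 r7).mul_left (cm _ _ _ z3 z6 z7 b6 b7))
    ((cm _ _ _ z4 z6 z7 c6 c7).mul_left (cm _ _ _ z5 z6 z7 d6 d7))
    (cm _ _ _ z1 z2 z3 k2 k3).symm (cm _ _ _ z1 z4 z5 k4 k5).symm (cm _ _ _ z1 z6 z7 k6 k7).symm
    ?_ (cm _ _ _ z2 z4 z5 r4 r5) (cm _ _ _ z2 z6 z7 r6 r7) (ac _ _ z2 z1 k2.symm)
  · rw [← h.two_smul_rmo_op]
    ext x
    have hx := rmo_rmo_self (e k) x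
    rw [e_mul_self k z1.symm, rmo_neg, rmo_one] at hx
    show (2 : ℝ) • rmo (e k) ((2 : ℝ) • rmo (e k) x) = (-4 : V →L[ℝ] V) x
    rw [map_smul, hx]
    have h4 : (-4 : V →L[ℝ] V) = (-4 : ℝ) • (1 : V →L[ℝ] V) := by
      rw [← Algebra.algebraMap_eq_smul_one, map_neg, map_ofNat]
    rw [h4]
    show _ = (-4 : ℝ) • x
    module
  · rw [mul_assoc, ac a₁ r₁ z3 z2 r3.symm, mul_neg, neg_neg]

lemma FanoPoint.lineOp_mul (h : FanoPoint k r₁ a₁ r₂ a₂ r₃ a₃) :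
    lineOp V r₂ a₂ k * lineOp V r₃ a₃ k = lineOp V r₁ a₁ k := by
  have hn := h.nodup
  simp only [List.nodup_cons, List.mem_cons, not_or, List.not_mem_nil, ← ne_eq] at hn
  obtain ⟨⟨z1, z2, z3, z4, z5, z6, z7, -⟩, ⟨k2, k3, k4, k5, k6, k7, -⟩, -⟩ := hn
  have cm : ∀ i j, 0 ≠ i → 0 ≠ j → k ≠ i → k ≠ j → Commute (Lop V k) (Lop V i * Lop V j) :=
    fun i j hi hj hki hkj => commute_of_anticomm (Lop_anticomm k i z1.symm hi.symm hki)
      (Lop_anticomm k j z1.symm hj.symm hkj)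
  rw [lineOp, lineOp, lineOp, neg_mul_neg, mul_assoc (Lop V r₂ * Lop V a₂), ← mul_assoc (Lop V k),
    (cm _ _ z6 z7 k6 k7).eq, mul_assoc _ (Lop V k) (Lop V k), Lop_mul_self k z1.symm, mul_neg,
    mul_neg, mul_one, h.Lop_mul, (cm _ _ z2 z3 k2 k3).eq]

lemma FanoPoint.lineOp_mul' (h : FanoPoint k r₁ a₁ r₂ a₂ r₃ a₃) :
    lineOp V r₃ a₃ k * lineOp V r₂ a₂ k = lineOp V r₁ a₁ k := by
  have hn := h.nodup
  simp only [List.nodup_cons, List.mem_cons, not_or, List.not_mem_nil, ← ne_eq] at hn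
  obtain ⟨⟨z1, z2, z3, z4, z5, z6, z7, -⟩, ⟨k2, k3, k4, k5, k6, k7, -⟩,
    -, -, ⟨c5, c6, c7, -⟩, ⟨d6, d7, -⟩, -⟩ := hn
  have cm : ∀ i j l, 0 ≠ i → 0 ≠ j → 0 ≠ l → i ≠ j → i ≠ l →
      Commute (Lop V i) (Lop V j * Lop V l) := fun i j l hi hj hl hij hil =>
    commute_of_anticomm (Lop_anticomm i j hi.symm hj.symm hij) (Lop_anticomm i l hi.symm hl.symm hil)
  have : Commute (lineOp V r₃ a₃ k) (lineOp V r₂ a₂ k) := by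
    have h23 := (cm _ _ _ z4 z6 z7 c6 c7).mul_left (cm _ _ _ z5 z6 z7 d6 d7)
    have h2 := cm _ _ _ z1 z4 z5 k4 k5
    have h3 := cm _ _ _ z1 z6 z7 k6 k7
    exact ((h23.symm.mul_right h3.symm).mul_left (h2.mul_right (Commute.refl _))).neg_left.neg_right
  rw [this.eq, h.lineOp_mul]

end Bimodule

lemma fanoPoint_one : FanoPoint 1 2 3 4 5 7 6 := by
  constructor <;> first | decide | (apply ext_coord <;> simp)

lemma fanoPoint_two : FanoPoint 2 3 1 4 6 5 7 := by
  constructor <;> first | decide | (apply ext_coord <;> simp)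

lemma fanoPoint_three : FanoPoint 3 1 2 4 7 6 5 := by
  constructor <;> first | decide | (apply ext_coord <;> simp)

lemma fanoPoint_four : FanoPoint 4 5 1 7 3 6 2 := by
  constructor <;> first | decide | (apply ext_coord <;> simp)

lemma fanoPoint_five : FanoPoint 5 1 4 7 2 3 6 := by
  constructor <;> first | decide | (apply ext_coord <;> simp)

lemma fanoPoint_six : FanoPoint 6 1 7 2 4 5 3 := by
  constructor <;> first | decide | (apply ext_coord <;> simp)

lemma fanoPoint_seven : FanoPoint 7 2 5 3 4 6 1 := by
  constructor <;> first | decide | (apply ext_coord <;> simp)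

section Bimodule

variable {V : Type*} [NormedAddCommGroup V] [NormedSpace ℝ V] [OctBimodule V]

variable (V) in
/-- The sum of the involutions of the seven lines of the Fano plane. -/
def lineSum : V →L[ℝ] V := lineOp V 1 2 3 + lineOp V 1 4 5 + lineOp V 1 7 6 + lineOp V 2 4 6 + lineOp V 2 5 7 + lineOp V 3 4 7 + lineOp V 3 6 5

lemma lineOp_rotate_of_lt (r a k : Fin 8) (h : [0, r, a, k].Nodup) :
    lineOp V r a k = lineOp V a k r := by
  simp only [List.nodup_cons, List.mem_cons, not_or, ← ne_eq] at h
  exact lineOp_rotate r a k h.1.1.symm h.1.2.1.symm h.1.2.2.1.symm h.2.1.1 h.2.1.2.1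

lemma two_smul_rmo_mul_one : (2 : ℝ) • ((rmo (e 1) : V →L[ℝ] V) * Lop V 1) =
    1 - (lineOp V 1 2 3 + lineOp V 1 4 5 + lineOp V 1 7 6) := by
  rw [← smul_mul_assoc, fanoPoint_one.two_smul_rmo_op, sub_mul, Lop_mul_self _ (by decide)]
  rw [lineOp_rotate_of_lt 1 2 3 (by decide)]
  rw [lineOp_rotate_of_lt 1 4 5 (by decide)]
  rw [lineOp_rotate_of_lt 1 7 6 (by decide)]
  simp only [lineOp, add_mul]
  abel

lemma two_smul_rmo_mul_two : (2 : ℝ) • ((rmo (e 2) : V →L[ℝ] V) * Lop V 2) =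
    1 - (lineOp V 1 2 3 + lineOp V 2 4 6 + lineOp V 2 5 7) := by
  rw [← smul_mul_assoc, fanoPoint_two.two_smul_rmo_op, sub_mul, Lop_mul_self _ (by decide)]
  rw [← lineOp_rotate_of_lt 3 1 2 (by decide)]
  rw [lineOp_rotate_of_lt 2 4 6 (by decide)]
  rw [lineOp_rotate_of_lt 2 5 7 (by decide)]
  simp only [lineOp, add_mul]
  abel

lemma two_smul_rmo_mul_three : (2 : ℝ) • ((rmo (e 3) : V →L[ℝ] V) * Lop V 3) =
    1 - (lineOp V 1 2 3 + lineOp V 3 4 7 + lineOp V 3 6 5) := by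
  rw [← smul_mul_assoc, fanoPoint_three.two_smul_rmo_op, sub_mul, Lop_mul_self _ (by decide)]
  rw [lineOp_rotate_of_lt 3 4 7 (by decide)]
  rw [lineOp_rotate_of_lt 3 6 5 (by decide)]
  simp only [lineOp, add_mul]
  abel

lemma two_smul_rmo_mul_four : (2 : ℝ) • ((rmo (e 4) : V →L[ℝ] V) * Lop V 4) =
    1 - (lineOp V 1 4 5 + lineOp V 3 4 7 + lineOp V 2 4 6) := by
  rw [← smul_mul_assoc, fanoPoint_four.two_smul_rmo_op, sub_mul, Lop_mul_self _ (by decide)]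
  rw [← lineOp_rotate_of_lt 5 1 4 (by decide)]
  rw [← lineOp_rotate_of_lt 7 3 4 (by decide)]
  rw [← lineOp_rotate_of_lt 6 2 4 (by decide)]
  simp only [lineOp, add_mul]
  abel

lemma two_smul_rmo_mul_five : (2 : ℝ) • ((rmo (e 5) : V →L[ℝ] V) * Lop V 5) =
    1 - (lineOp V 1 4 5 + lineOp V 2 5 7 + lineOp V 3 6 5) := by
  rw [← smul_mul_assoc, fanoPoint_five.two_smul_rmo_op, sub_mul, Lop_mul_self _ (by decide)]
  rw [← lineOp_rotate_of_lt 7 2 5 (by decide)]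
  simp only [lineOp, add_mul]
  abel

lemma two_smul_rmo_mul_six : (2 : ℝ) • ((rmo (e 6) : V →L[ℝ] V) * Lop V 6) =
    1 - (lineOp V 1 7 6 + lineOp V 2 4 6 + lineOp V 3 6 5) := by
  rw [← smul_mul_assoc, fanoPoint_six.two_smul_rmo_op, sub_mul, Lop_mul_self _ (by decide)]
  rw [← lineOp_rotate_of_lt 5 3 6 (by decide)]
  simp only [lineOp, add_mul]
  abel

lemma two_smul_rmo_mul_seven : (2 : ℝ) • ((rmo (e 7) : V →L[ℝ] V) * Lop V 7) =
    1 - (lineOp V 2 5 7 + lineOp V 3 4 7 + lineOp V 1 7 6) := by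
  rw [← smul_mul_assoc, fanoPoint_seven.two_smul_rmo_op, sub_mul, Lop_mul_self _ (by decide)]
  rw [← lineOp_rotate_of_lt 6 1 7 (by decide)]
  simp only [lineOp, add_mul]
  abel

lemma reO_eq : reO V = (1 / 8 : ℝ) • (1 + lineSum V) := by
  have h : reO V = (5 / 12 : ℝ) • (1 : V →L[ℝ] V) - (1 / 12 : ℝ) •
      (rmo (e 1) * Lop V 1 + rmo (e 2) * Lop V 2 + rmo (e 3) * Lop V 3 + rmo (e 4) * Lop V 4 + rmo (e 5) * Lop V 5 + rmo (e 6) * Lop V 6 + rmo (e 7) * Lop V 7) := by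
    simp only [reO, Fin.sum_univ_seven]
    rfl
  rw [h, lineSum]
  have h1 := two_smul_rmo_mul_one (V := V)
  have h2 := two_smul_rmo_mul_two (V := V)
  have h3 := two_smul_rmo_mul_three (V := V)
  have h4 := two_smul_rmo_mul_four (V := V)
  have h5 := two_smul_rmo_mul_five (V := V)
  have h6 := two_smul_rmo_mul_six (V := V)
  have h7 := two_smul_rmo_mul_seven (V := V)
  linear_combination (norm := module) - (1 / 24 : ℝ) • h1 - (1 / 24 : ℝ) • h2 - (1 / 24 : ℝ) • h3 - (1 / 24 : ℝ) • h4 - (1 / 24 : ℝ) • h5 - (1 / 24 : ℝ) • h6 - (1 / 24 : ℝ) • h7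

lemma lineOp_mul_lineSum_one_two : lineOp V 1 2 3 * (1 + lineSum V) = 1 + lineSum V := by
  have h0 := lineOp_mul_self (V := V) 1 2 3 (by decide) (by decide) (by decide) (by decide)
    (by decide) (by decide)
  have h2 : lineOp V 1 2 3 * lineOp V 1 4 5 = lineOp V 1 7 6 := by
    have h := fanoPoint_one.rotate.rotate.lineOp_mul (V := V)
    rwa [← lineOp_rotate_of_lt 1 2 3 (by decide), ← lineOp_rotate_of_lt 1 4 5 (by decide), ← lineOp_rotate_of_lt 1 7 6 (by decide)] at h
  have h3 : lineOp V 1 2 3 * lineOp V 1 7 6 = lineOp V 1 4 5 := by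
    have h := fanoPoint_one.rotate.lineOp_mul' (V := V)
    rwa [← lineOp_rotate_of_lt 1 2 3 (by decide), ← lineOp_rotate_of_lt 1 7 6 (by decide), ← lineOp_rotate_of_lt 1 4 5 (by decide)] at h
  have h4 : lineOp V 1 2 3 * lineOp V 2 4 6 = lineOp V 2 5 7 := by
    have h := fanoPoint_two.rotate.rotate.lineOp_mul (V := V)
    rwa [lineOp_rotate_of_lt 3 1 2 (by decide), ← lineOp_rotate_of_lt 2 4 6 (by decide), ← lineOp_rotate_of_lt 2 5 7 (by decide)] at h
  have h5 : lineOp V 1 2 3 * lineOp V 2 5 7 = lineOp V 2 4 6 := by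
    have h := fanoPoint_two.rotate.lineOp_mul' (V := V)
    rwa [lineOp_rotate_of_lt 3 1 2 (by decide), ← lineOp_rotate_of_lt 2 5 7 (by decide), ← lineOp_rotate_of_lt 2 4 6 (by decide)] at h
  have h6 : lineOp V 1 2 3 * lineOp V 3 4 7 = lineOp V 3 6 5 := by
    have h := fanoPoint_three.rotate.rotate.lineOp_mul (V := V)
    rwa [← lineOp_rotate_of_lt 3 4 7 (by decide), ← lineOp_rotate_of_lt 3 6 5 (by decide)] at h
  have h7 : lineOp V 1 2 3 * lineOp V 3 6 5 = lineOp V 3 4 7 := by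
    have h := fanoPoint_three.rotate.lineOp_mul' (V := V)
    rwa [← lineOp_rotate_of_lt 3 6 5 (by decide), ← lineOp_rotate_of_lt 3 4 7 (by decide)] at h
  rw [lineSum]
  simp only [mul_add, mul_one, h0, h2, h3, h4, h5, h6, h7]
  abel

lemma lineOp_mul_lineSum_one_four : lineOp V 1 4 5 * (1 + lineSum V) = 1 + lineSum V := by
  have h0 := lineOp_mul_self (V := V) 1 4 5 (by decide) (by decide) (by decide) (by decide)
    (by decide) (by decide)
  have h1 : lineOp V 1 4 5 * lineOp V 1 2 3 = lineOp V 1 7 6 := by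
    have h := fanoPoint_one.rotate.rotate.lineOp_mul' (V := V)
    rwa [← lineOp_rotate_of_lt 1 4 5 (by decide), ← lineOp_rotate_of_lt 1 2 3 (by decide), ← lineOp_rotate_of_lt 1 7 6 (by decide)] at h
  have h3 : lineOp V 1 4 5 * lineOp V 1 7 6 = lineOp V 1 2 3 := by
    have h := fanoPoint_one.lineOp_mul (V := V)
    rwa [← lineOp_rotate_of_lt 1 4 5 (by decide), ← lineOp_rotate_of_lt 1 7 6 (by decide), ← lineOp_rotate_of_lt 1 2 3 (by decide)] at h
  have h4 : lineOp V 1 4 5 * lineOp V 2 4 6 = lineOp V 3 4 7 := by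
    have h := fanoPoint_four.rotate.lineOp_mul' (V := V)
    rwa [lineOp_rotate_of_lt 5 1 4 (by decide), lineOp_rotate_of_lt 6 2 4 (by decide), lineOp_rotate_of_lt 7 3 4 (by decide)] at h
  have h5 : lineOp V 1 4 5 * lineOp V 2 5 7 = lineOp V 3 6 5 := by
    have h := fanoPoint_five.rotate.rotate.lineOp_mul (V := V)
    rwa [lineOp_rotate_of_lt 7 2 5 (by decide)] at h
  have h6 : lineOp V 1 4 5 * lineOp V 3 4 7 = lineOp V 2 4 6 := by
    have h := fanoPoint_four.rotate.rotate.lineOp_mul (V := V)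
    rwa [lineOp_rotate_of_lt 5 1 4 (by decide), lineOp_rotate_of_lt 7 3 4 (by decide), lineOp_rotate_of_lt 6 2 4 (by decide)] at h
  have h7 : lineOp V 1 4 5 * lineOp V 3 6 5 = lineOp V 2 5 7 := by
    have h := fanoPoint_five.rotate.lineOp_mul' (V := V)
    rwa [lineOp_rotate_of_lt 7 2 5 (by decide)] at h
  rw [lineSum]
  simp only [mul_add, mul_one, h0, h1, h3, h4, h5, h6, h7]
  abel

lemma lineOp_mul_lineSum_one_seven : lineOp V 1 7 6 * (1 + lineSum V) = 1 + lineSum V := by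
  have h0 := lineOp_mul_self (V := V) 1 7 6 (by decide) (by decide) (by decide) (by decide)
    (by decide) (by decide)
  have h1 : lineOp V 1 7 6 * lineOp V 1 2 3 = lineOp V 1 4 5 := by
    have h := fanoPoint_one.rotate.lineOp_mul (V := V)
    rwa [← lineOp_rotate_of_lt 1 7 6 (by decide), ← lineOp_rotate_of_lt 1 2 3 (by decide), ← lineOp_rotate_of_lt 1 4 5 (by decide)] at h
  have h2 : lineOp V 1 7 6 * lineOp V 1 4 5 = lineOp V 1 2 3 := by
    have h := fanoPoint_one.lineOp_mul' (V := V)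
    rwa [← lineOp_rotate_of_lt 1 7 6 (by decide), ← lineOp_rotate_of_lt 1 4 5 (by decide), ← lineOp_rotate_of_lt 1 2 3 (by decide)] at h
  have h4 : lineOp V 1 7 6 * lineOp V 2 4 6 = lineOp V 3 6 5 := by
    have h := fanoPoint_six.rotate.rotate.lineOp_mul (V := V)
    rwa [lineOp_rotate_of_lt 5 3 6 (by decide)] at h
  have h5 : lineOp V 1 7 6 * lineOp V 2 5 7 = lineOp V 3 4 7 := by
    have h := fanoPoint_seven.rotate.lineOp_mul (V := V)
    rwa [lineOp_rotate_of_lt 6 1 7 (by decide)] at h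
  have h6 : lineOp V 1 7 6 * lineOp V 3 4 7 = lineOp V 2 5 7 := by
    have h := fanoPoint_seven.lineOp_mul' (V := V)
    rwa [lineOp_rotate_of_lt 6 1 7 (by decide)] at h
  have h7 : lineOp V 1 7 6 * lineOp V 3 6 5 = lineOp V 2 4 6 := by
    have h := fanoPoint_six.rotate.lineOp_mul' (V := V)
    rwa [lineOp_rotate_of_lt 5 3 6 (by decide)] at h
  rw [lineSum]
  simp only [mul_add, mul_one, h0, h1, h2, h4, h5, h6, h7]
  abel

lemma lineOp_mul_lineSum_two_four : lineOp V 2 4 6 * (1 + lineSum V) = 1 + lineSum V := by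
  have h0 := lineOp_mul_self (V := V) 2 4 6 (by decide) (by decide) (by decide) (by decide)
    (by decide) (by decide)
  have h1 : lineOp V 2 4 6 * lineOp V 1 2 3 = lineOp V 2 5 7 := by
    have h := fanoPoint_two.rotate.rotate.lineOp_mul' (V := V)
    rwa [← lineOp_rotate_of_lt 2 4 6 (by decide), lineOp_rotate_of_lt 3 1 2 (by decide), ← lineOp_rotate_of_lt 2 5 7 (by decide)] at h
  have h2 : lineOp V 2 4 6 * lineOp V 1 4 5 = lineOp V 3 4 7 := by
    have h := fanoPoint_four.rotate.lineOp_mul (V := V)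
    rwa [lineOp_rotate_of_lt 6 2 4 (by decide), lineOp_rotate_of_lt 5 1 4 (by decide), lineOp_rotate_of_lt 7 3 4 (by decide)] at h
  have h3 : lineOp V 2 4 6 * lineOp V 1 7 6 = lineOp V 3 6 5 := by
    have h := fanoPoint_six.rotate.rotate.lineOp_mul' (V := V)
    rwa [lineOp_rotate_of_lt 5 3 6 (by decide)] at h
  have h5 : lineOp V 2 4 6 * lineOp V 2 5 7 = lineOp V 1 2 3 := by
    have h := fanoPoint_two.lineOp_mul (V := V)
    rwa [← lineOp_rotate_of_lt 2 4 6 (by decide), ← lineOp_rotate_of_lt 2 5 7 (by decide), lineOp_rotate_of_lt 3 1 2 (by decide)] at h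
  have h6 : lineOp V 2 4 6 * lineOp V 3 4 7 = lineOp V 1 4 5 := by
    have h := fanoPoint_four.lineOp_mul' (V := V)
    rwa [lineOp_rotate_of_lt 6 2 4 (by decide), lineOp_rotate_of_lt 7 3 4 (by decide), lineOp_rotate_of_lt 5 1 4 (by decide)] at h
  have h7 : lineOp V 2 4 6 * lineOp V 3 6 5 = lineOp V 1 7 6 := by
    have h := fanoPoint_six.lineOp_mul (V := V)
    rwa [lineOp_rotate_of_lt 5 3 6 (by decide)] at h
  rw [lineSum]
  simp only [mul_add, mul_one, h0, h1, h2, h3, h5, h6, h7]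
  abel

lemma lineOp_mul_lineSum_two_five : lineOp V 2 5 7 * (1 + lineSum V) = 1 + lineSum V := by
  have h0 := lineOp_mul_self (V := V) 2 5 7 (by decide) (by decide) (by decide) (by decide)
    (by decide) (by decide)
  have h1 : lineOp V 2 5 7 * lineOp V 1 2 3 = lineOp V 2 4 6 := by
    have h := fanoPoint_two.rotate.lineOp_mul (V := V)
    rwa [← lineOp_rotate_of_lt 2 5 7 (by decide), lineOp_rotate_of_lt 3 1 2 (by decide), ← lineOp_rotate_of_lt 2 4 6 (by decide)] at h
  have h2 : lineOp V 2 5 7 * lineOp V 1 4 5 = lineOp V 3 6 5 := by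
    have h := fanoPoint_five.rotate.rotate.lineOp_mul' (V := V)
    rwa [lineOp_rotate_of_lt 7 2 5 (by decide)] at h
  have h3 : lineOp V 2 5 7 * lineOp V 1 7 6 = lineOp V 3 4 7 := by
    have h := fanoPoint_seven.rotate.lineOp_mul' (V := V)
    rwa [lineOp_rotate_of_lt 6 1 7 (by decide)] at h
  have h4 : lineOp V 2 5 7 * lineOp V 2 4 6 = lineOp V 1 2 3 := by
    have h := fanoPoint_two.lineOp_mul' (V := V)
    rwa [← lineOp_rotate_of_lt 2 5 7 (by decide), ← lineOp_rotate_of_lt 2 4 6 (by decide), lineOp_rotate_of_lt 3 1 2 (by decide)] at h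
  have h6 : lineOp V 2 5 7 * lineOp V 3 4 7 = lineOp V 1 7 6 := by
    have h := fanoPoint_seven.rotate.rotate.lineOp_mul (V := V)
    rwa [lineOp_rotate_of_lt 6 1 7 (by decide)] at h
  have h7 : lineOp V 2 5 7 * lineOp V 3 6 5 = lineOp V 1 4 5 := by
    have h := fanoPoint_five.lineOp_mul (V := V)
    rwa [lineOp_rotate_of_lt 7 2 5 (by decide)] at h
  rw [lineSum]
  simp only [mul_add, mul_one, h0, h1, h2, h3, h4, h6, h7]
  abel

lemma lineOp_mul_lineSum_three_four : lineOp V 3 4 7 * (1 + lineSum V) = 1 + lineSum V := by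
  have h0 := lineOp_mul_self (V := V) 3 4 7 (by decide) (by decide) (by decide) (by decide)
    (by decide) (by decide)
  have h1 : lineOp V 3 4 7 * lineOp V 1 2 3 = lineOp V 3 6 5 := by
    have h := fanoPoint_three.rotate.rotate.lineOp_mul' (V := V)
    rwa [← lineOp_rotate_of_lt 3 4 7 (by decide), ← lineOp_rotate_of_lt 3 6 5 (by decide)] at h
  have h2 : lineOp V 3 4 7 * lineOp V 1 4 5 = lineOp V 2 4 6 := by
    have h := fanoPoint_four.rotate.rotate.lineOp_mul' (V := V)
    rwa [lineOp_rotate_of_lt 7 3 4 (by decide), lineOp_rotate_of_lt 5 1 4 (by decide), lineOp_rotate_of_lt 6 2 4 (by decide)] at h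
  have h3 : lineOp V 3 4 7 * lineOp V 1 7 6 = lineOp V 2 5 7 := by
    have h := fanoPoint_seven.lineOp_mul (V := V)
    rwa [lineOp_rotate_of_lt 6 1 7 (by decide)] at h
  have h4 : lineOp V 3 4 7 * lineOp V 2 4 6 = lineOp V 1 4 5 := by
    have h := fanoPoint_four.lineOp_mul (V := V)
    rwa [lineOp_rotate_of_lt 7 3 4 (by decide), lineOp_rotate_of_lt 6 2 4 (by decide), lineOp_rotate_of_lt 5 1 4 (by decide)] at h
  have h5 : lineOp V 3 4 7 * lineOp V 2 5 7 = lineOp V 1 7 6 := by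
    have h := fanoPoint_seven.rotate.rotate.lineOp_mul' (V := V)
    rwa [lineOp_rotate_of_lt 6 1 7 (by decide)] at h
  have h7 : lineOp V 3 4 7 * lineOp V 3 6 5 = lineOp V 1 2 3 := by
    have h := fanoPoint_three.lineOp_mul (V := V)
    rwa [← lineOp_rotate_of_lt 3 4 7 (by decide), ← lineOp_rotate_of_lt 3 6 5 (by decide)] at h
  rw [lineSum]
  simp only [mul_add, mul_one, h0, h1, h2, h3, h4, h5, h7]
  abel

lemma lineOp_mul_lineSum_three_six : lineOp V 3 6 5 * (1 + lineSum V) = 1 + lineSum V := by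
  have h0 := lineOp_mul_self (V := V) 3 6 5 (by decide) (by decide) (by decide) (by decide)
    (by decide) (by decide)
  have h1 : lineOp V 3 6 5 * lineOp V 1 2 3 = lineOp V 3 4 7 := by
    have h := fanoPoint_three.rotate.lineOp_mul (V := V)
    rwa [← lineOp_rotate_of_lt 3 6 5 (by decide), ← lineOp_rotate_of_lt 3 4 7 (by decide)] at h
  have h2 : lineOp V 3 6 5 * lineOp V 1 4 5 = lineOp V 2 5 7 := by
    have h := fanoPoint_five.rotate.lineOp_mul (V := V)
    rwa [lineOp_rotate_of_lt 7 2 5 (by decide)] at h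
  have h3 : lineOp V 3 6 5 * lineOp V 1 7 6 = lineOp V 2 4 6 := by
    have h := fanoPoint_six.rotate.lineOp_mul (V := V)
    rwa [lineOp_rotate_of_lt 5 3 6 (by decide)] at h
  have h4 : lineOp V 3 6 5 * lineOp V 2 4 6 = lineOp V 1 7 6 := by
    have h := fanoPoint_six.lineOp_mul' (V := V)
    rwa [lineOp_rotate_of_lt 5 3 6 (by decide)] at h
  have h5 : lineOp V 3 6 5 * lineOp V 2 5 7 = lineOp V 1 4 5 := by
    have h := fanoPoint_five.lineOp_mul' (V := V)
    rwa [lineOp_rotate_of_lt 7 2 5 (by decide)] at h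
  have h6 : lineOp V 3 6 5 * lineOp V 3 4 7 = lineOp V 1 2 3 := by
    have h := fanoPoint_three.lineOp_mul' (V := V)
    rwa [← lineOp_rotate_of_lt 3 6 5 (by decide), ← lineOp_rotate_of_lt 3 4 7 (by decide)] at h
  rw [lineSum]
  simp only [mul_add, mul_one, h0, h1, h2, h3, h4, h5, h6]
  abel


end Bimodule

section Bimodule

variable {V : Type*} [NormedAddCommGroup V] [NormedSpace ℝ V] [OctBimodule V]

lemma asc_add_left (p p' q : Oct) (x : V) : asc (p + p') q x = asc p q x + asc p' q x := by
  simp only [asc, add_mul', lmo_add]; abel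

lemma asc_smul_left (r : ℝ) (p q : Oct) (x : V) : asc (r • p) q x = r • asc p q x := by
  simp only [asc, smul_mul', lmo_smul, smul_sub]

lemma asc_add_right (p q q' : Oct) (x : V) : asc p (q + q') x = asc p q x + asc p q' x := by
  simp only [asc, mul_add', lmo_add, map_add]; abel

lemma asc_smul_right (r : ℝ) (p q : Oct) (x : V) : asc p (r • q) x = r • asc p q x := by
  simp only [asc, mul_smul', lmo_smul, smul_sub, map_smul]

/-- Bilinear forms in two octonions vanishing on the basis vanish. -/
lemma asc_eq_zero_of_basis (x : V) (h : ∀ i j : Fin 8, asc (e i) (e j) x = 0) (p q : Oct) :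
    asc p q x = 0 := by
  obtain ⟨c, rfl⟩ := exists_coord p
  obtain ⟨d, rfl⟩ := exists_coord q
  simp only [Fin.sum_univ_eight, asc_add_left, asc_add_right, asc_smul_left, asc_smul_right, h,
    smul_zero, add_zero]

lemma asc_line {x : V} {r a k : Fin 8} (h : e r * e a = e k) (hk : k ≠ 0)
    (hl : lineOp V k r a x = x) : asc (e r) (e a) x = 0 := by
  have h1 : -lmo (e k) (lmo (e r) (lmo (e a) x)) = x := hl
  have h2 := lmo_lmo_self (e k) (lmo (e r) (lmo (e a) x))
  rw [e_mul_self k hk, lmo_neg, lmo_one, neg_eq_iff_eq_neg.mp h1, map_neg] at h2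
  rw [asc, h, neg_inj.mp h2, sub_self]

lemma asc_one_left (q : Oct) (x : V) : asc 1 q x = 0 := by
  rw [asc, one_mul', lmo_one, sub_self]

lemma asc_eq_zero_of_lines {x : V}
    (h123 : lineOp V 1 2 3 x = x)
    (h145 : lineOp V 1 4 5 x = x)
    (h176 : lineOp V 1 7 6 x = x)
    (h246 : lineOp V 2 4 6 x = x)
    (h257 : lineOp V 2 5 7 x = x)
    (h347 : lineOp V 3 4 7 x = x)
    (h365 : lineOp V 3 6 5 x = x)
    (i j : Fin 8) : asc (e i) (e j) x = 0 := by
  have a23 : asc (e 2) (e 3) x = 0 := asc_line fanoPoint_one.k₁ (by decide) (by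
    exact h123)
  have a45 : asc (e 4) (e 5) x = 0 := asc_line fanoPoint_one.k₂ (by decide) (by
    exact h145)
  have a76 : asc (e 7) (e 6) x = 0 := asc_line fanoPoint_one.k₃ (by decide) (by
    exact h176)
  have a31 : asc (e 3) (e 1) x = 0 := asc_line fanoPoint_two.k₁ (by decide) (by
    rw [← lineOp_rotate_of_lt 1 2 3 (by decide)]; exact h123)
  have a46 : asc (e 4) (e 6) x = 0 := asc_line fanoPoint_two.k₂ (by decide) (by
    exact h246)
  have a57 : asc (e 5) (e 7) x = 0 := asc_line fanoPoint_two.k₃ (by decide) (by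
    exact h257)
  have a12 : asc (e 1) (e 2) x = 0 := asc_line fanoPoint_three.k₁ (by decide) (by
    rw [lineOp_rotate_of_lt 3 1 2 (by decide)]; exact h123)
  have a47 : asc (e 4) (e 7) x = 0 := asc_line fanoPoint_three.k₂ (by decide) (by
    exact h347)
  have a65 : asc (e 6) (e 5) x = 0 := asc_line fanoPoint_three.k₃ (by decide) (by
    exact h365)
  have a51 : asc (e 5) (e 1) x = 0 := asc_line fanoPoint_four.k₁ (by decide) (by
    rw [← lineOp_rotate_of_lt 1 4 5 (by decide)]; exact h145)
  have a73 : asc (e 7) (e 3) x = 0 := asc_line fanoPoint_four.k₂ (by decide) (by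
    rw [← lineOp_rotate_of_lt 3 4 7 (by decide)]; exact h347)
  have a62 : asc (e 6) (e 2) x = 0 := asc_line fanoPoint_four.k₃ (by decide) (by
    rw [← lineOp_rotate_of_lt 2 4 6 (by decide)]; exact h246)
  have a14 : asc (e 1) (e 4) x = 0 := asc_line fanoPoint_five.k₁ (by decide) (by
    rw [lineOp_rotate_of_lt 5 1 4 (by decide)]; exact h145)
  have a72 : asc (e 7) (e 2) x = 0 := asc_line fanoPoint_five.k₂ (by decide) (by
    rw [← lineOp_rotate_of_lt 2 5 7 (by decide)]; exact h257)
  have a36 : asc (e 3) (e 6) x = 0 := asc_line fanoPoint_five.k₃ (by decide) (by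
    rw [lineOp_rotate_of_lt 5 3 6 (by decide)]; exact h365)
  have a17 : asc (e 1) (e 7) x = 0 := asc_line fanoPoint_six.k₁ (by decide) (by
    rw [lineOp_rotate_of_lt 6 1 7 (by decide)]; exact h176)
  have a24 : asc (e 2) (e 4) x = 0 := asc_line fanoPoint_six.k₂ (by decide) (by
    rw [lineOp_rotate_of_lt 6 2 4 (by decide)]; exact h246)
  have a53 : asc (e 5) (e 3) x = 0 := asc_line fanoPoint_six.k₃ (by decide) (by
    rw [← lineOp_rotate_of_lt 3 6 5 (by decide)]; exact h365)
  have a25 : asc (e 2) (e 5) x = 0 := asc_line fanoPoint_seven.k₁ (by decide) (by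
    rw [lineOp_rotate_of_lt 7 2 5 (by decide)]; exact h257)
  have a34 : asc (e 3) (e 4) x = 0 := asc_line fanoPoint_seven.k₂ (by decide) (by
    rw [lineOp_rotate_of_lt 7 3 4 (by decide)]; exact h347)
  have a61 : asc (e 6) (e 1) x = 0 := asc_line fanoPoint_seven.k₃ (by decide) (by
    rw [← lineOp_rotate_of_lt 1 7 6 (by decide)]; exact h176)
  by_cases hi : i = 0
  · rw [hi]; exact asc_one_left _ _
  by_cases hj : j = 0
  · rw [hj, asc_swap]; exact neg_eq_zero.mpr (asc_one_left _ _)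
  fin_cases i <;> fin_cases j <;>
    simp only [Fin.zero_eta, Fin.mk_one, Fin.reduceFinMk, not_true_eq_false] at hi hj ⊢ <;>
    with_reducible
    first
    | exact asc_self _ _
    | assumption
    | (rw [asc_swap, neg_eq_zero]; assumption)

lemma lineOp_reO {r a k : Fin 8} (h : lineOp V r a k * (1 + lineSum V) = 1 + lineSum V) (x : V) :
    lineOp V r a k (reO V x) = reO V x := by
  have h' := DFunLike.congr_fun h x
  rw [reO_eq]
  show lineOp V r a k ((1 / 8 : ℝ) • (1 + lineSum V) x) = (1 / 8 : ℝ) • (1 + lineSum V) x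
  rw [map_smul]
  exact congrArg _ h'

lemma asc_reO (p q : Oct) (x : V) : asc p q (reO V x) = 0 :=
  asc_eq_zero_of_basis _ (asc_eq_zero_of_lines
    (lineOp_reO lineOp_mul_lineSum_one_two x)
    (lineOp_reO lineOp_mul_lineSum_one_four x)
    (lineOp_reO lineOp_mul_lineSum_one_seven x)
    (lineOp_reO lineOp_mul_lineSum_two_four x)
    (lineOp_reO lineOp_mul_lineSum_two_five x)
    (lineOp_reO lineOp_mul_lineSum_three_four x)
    (lineOp_reO lineOp_mul_lineSum_three_six x)) p q

lemma lmo_mul_of_asc {x : V} (h : ∀ p q, asc p q x = 0) (p q : Oct) :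
    lmo (p * q) x = lmo p (lmo q x) := sub_eq_zero.mp (h p q)

lemma FanoPoint.rmo_of_asc {k r₁ a₁ r₂ a₂ r₃ a₃ : Fin 8} (h : FanoPoint k r₁ a₁ r₂ a₂ r₃ a₃)
    {x : V} (hx : ∀ p q, asc p q x = 0) : lmo (e k) x = rmo (e k) x := by
  have h2 := h.two_smul_rmo x
  rw [← lmo_mul_of_asc hx, ← lmo_mul_of_asc hx, ← lmo_mul_of_asc hx, h.k₁, h.k₂, h.k₃] at h2
  have h3 : (2 : ℝ) • (lmo (e k) x - rmo (e k) x) = 0 := by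
    linear_combination (norm := module) (-1 : ℝ) • h2
  exact sub_eq_zero.mp ((smul_eq_zero.mp h3).resolve_left two_ne_zero)

lemma mem_ReSet_of_asc {x : V} (hx : ∀ p q, asc p q x = 0) : x ∈ ReSet V := by
  refine ⟨lmo_mul_of_asc hx, fun p => ?_⟩
  obtain ⟨c, rfl⟩ := exists_coord p
  have h : ∀ i, lmo (e i) x = rmo (e i) x := by
    intro i
    fin_cases i
    · show lmo 1 x = rmo 1 x
      rw [lmo_one, rmo_one]
    · exact fanoPoint_one.rmo_of_asc hx
    · exact fanoPoint_two.rmo_of_asc hx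
    · exact fanoPoint_three.rmo_of_asc hx
    · exact fanoPoint_four.rmo_of_asc hx
    · exact fanoPoint_five.rmo_of_asc hx
    · exact fanoPoint_six.rmo_of_asc hx
    · exact fanoPoint_seven.rmo_of_asc hx
  simp only [Fin.sum_univ_eight, lmo_add, rmo_add, lmo_smul, rmo_smul, h]

lemma reO_mem (x : V) : reO V x ∈ ReSet V := mem_ReSet_of_asc fun p q => asc_reO p q x

end Bimodule

lemma Oct.sum_e_mul_e (p : Oct) :
    (5 / 12 : ℝ) • p - (1 / 12 : ℝ) • ∑ i : Fin 7, (e i.succ * p) * e i.succ = re p • (1 : Oct) := by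
  simp only [Fin.sum_univ_seven]
  apply ext_coord <;> simp [re] <;> ring

section Bimodule

variable {V : Type*} [NormedAddCommGroup V] [NormedSpace ℝ V] [OctBimodule V]

lemma asc_of_mem_ReSet {m : V} (hm : m ∈ ReSet V) (p q : Oct) : asc p q m = 0 :=
  sub_eq_zero.mpr (hm.1 p q)

lemma rmo_rmo_of_mem {m : V} (hm : m ∈ ReSet V) (p q : Oct) :
    rmo q (rmo p m) = rmo (p * q) m := by
  have h := asc_eq_right p q m
  rw [asc_of_mem_ReSet hm] at h
  exact sub_eq_zero.mp h.symm

lemma lmo_rmo_of_mem {m : V} (hm : m ∈ ReSet V) (p q : Oct) :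
    lmo p (rmo q m) = rmo (p * q) m := by
  rw [← hm.2 q, ← hm.1 p q, hm.2]

lemma reO_rmo {m : V} (hm : m ∈ ReSet V) (p : Oct) : reO V (rmo p m) = re p • m := by
  have h : reO V (rmo p m) = rmo ((5 / 12 : ℝ) • p - (1 / 12 : ℝ) • ∑ i : Fin 7,
      (e i.succ * p) * e i.succ) m := by
    rw [rmo_sub, rmo_smul, rmo_smul, rmo_sum]
    simp only [reO, _root_.sub_apply, _root_.smul_apply,
      _root_.sum_apply, ContinuousLinearMap.comp_apply, ContinuousLinearMap.id_apply,
      lmo_rmo_of_mem hm, rmo_rmo_of_mem hm]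
  rw [h, Oct.sum_e_mul_e, rmo_smul, rmo_one]

lemma reO_of_mem {m : V} (hm : m ∈ ReSet V) : reO V m = m := by
  have h := reO_rmo hm 1
  rwa [rmo_one, re_one, one_smul] at h

lemma Lop_lineOp_of_mem {r a k : Fin 8} (h : [0, r, a, k].Nodup) :
    Lop V r * lineOp V r a k * Lop V r = -lineOp V r a k := by
  have h' := h
  simp only [List.nodup_cons, List.mem_cons, not_or, ← ne_eq] at h'
  have hr := h'.1.1.symm
  have ha := h'.1.2.1.symm
  have hk := h'.1.2.2.1.symm
  have hc : Commute (Lop V r) (Lop V a * Lop V k) := commute_of_anticomm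
    (Lop_anticomm r a hr ha h'.2.1.1) (Lop_anticomm r k hr hk h'.2.1.2.1)
  have hc2 : Commute (Lop V r) (lineOp V r a k) := by
    rw [lineOp, mul_assoc]
    exact ((Commute.refl _).mul_right hc).neg_right
  rw [hc2.eq, mul_assoc, Lop_mul_self r hr, mul_neg, mul_one]

lemma Lop_lineOp_of_not_mem {j r a k : Fin 8} (h : [0, j, r, a, k].Nodup) :
    Lop V j * lineOp V r a k * Lop V j = lineOp V r a k := by
  simp only [List.nodup_cons, List.mem_cons, not_or, ← ne_eq] at h
  have hj := h.1.1.symm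
  have hr := h.1.2.1.symm
  have ha := h.1.2.2.1.symm
  have hk := h.1.2.2.2.1.symm
  have hc : Commute (Lop V j) (Lop V a * Lop V k) := commute_of_anticomm
    (Lop_anticomm j a hj ha h.2.1.2.1) (Lop_anticomm j k hj hk h.2.1.2.2.1)
  have hc2 : Lop V j * lineOp V r a k = -(lineOp V r a k * Lop V j) := by
    rw [lineOp, mul_neg, mul_assoc, ← mul_assoc (Lop V j), Lop_anticomm j r hj hr h.2.1.1, neg_mul,
      mul_assoc (Lop V r) (Lop V j), hc.eq, neg_mul, neg_neg, neg_neg]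
    simp only [mul_assoc]
  rw [hc2, neg_mul, mul_assoc, Lop_mul_self j hj, mul_neg, mul_one, neg_neg]

lemma sum_Lop_lineOp {r a k b c d f : Fin 8} (h : [0, r, a, k, b, c, d, f].Nodup) :
    Lop V r * lineOp V r a k * Lop V r + Lop V a * lineOp V r a k * Lop V a +
      Lop V k * lineOp V r a k * Lop V k + Lop V b * lineOp V r a k * Lop V b +
      Lop V c * lineOp V r a k * Lop V c + Lop V d * lineOp V r a k * Lop V d +
      Lop V f * lineOp V r a k * Lop V f = lineOp V r a k := by
  have h' := h
  simp only [List.nodup_cons, List.mem_cons, not_or, ← ne_eq, List.not_mem_nil, not_false_eq_true,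
    List.nodup_nil, and_true] at h'
  have e1 : Lop V a * lineOp V r a k * Lop V a = -lineOp V r a k := by
    rw [lineOp_rotate_of_lt r a k (by simp; tauto)]
    exact Lop_lineOp_of_mem (by simp; tauto)
  have e2 : Lop V k * lineOp V r a k * Lop V k = -lineOp V r a k := by
    rw [← lineOp_rotate_of_lt k r a (by simp; tauto)]
    exact Lop_lineOp_of_mem (by simp; tauto)
  rw [Lop_lineOp_of_mem (by simp; tauto), e1, e2, Lop_lineOp_of_not_mem (by simp; tauto),
    Lop_lineOp_of_not_mem (by simp; tauto), Lop_lineOp_of_not_mem (by simp; tauto),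
    Lop_lineOp_of_not_mem (by simp; tauto)]
  abel

lemma sum_lmo_reO_lmo (x : V) :
    reO V x - ∑ i : Fin 7, lmo (e i.succ) (reO V (lmo (e i.succ) x)) = x := by
  have h : reO V - (Lop V 1 * reO V * Lop V 1 + Lop V 2 * reO V * Lop V 2 + Lop V 3 * reO V * Lop V 3 + Lop V 4 * reO V * Lop V 4 + Lop V 5 * reO V * Lop V 5 + Lop V 6 * reO V * Lop V 6 + Lop V 7 * reO V * Lop V 7) = 1 := by
    rw [reO_eq, lineSum]
    simp only [mul_smul_comm, smul_mul_assoc, mul_add, add_mul, mul_one]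
    have h0 := sum_Lop_lineOp (V := V) (r := 1) (a := 2) (k := 3) (b := 4) (c := 5) (d := 6) (f := 7) (by decide)
    have h1 := sum_Lop_lineOp (V := V) (r := 1) (a := 4) (k := 5) (b := 2) (c := 3) (d := 6) (f := 7) (by decide)
    have h2 := sum_Lop_lineOp (V := V) (r := 1) (a := 7) (k := 6) (b := 2) (c := 3) (d := 4) (f := 5) (by decide)
    have h3 := sum_Lop_lineOp (V := V) (r := 2) (a := 4) (k := 6) (b := 1) (c := 3) (d := 5) (f := 7) (by decide)
    have h4 := sum_Lop_lineOp (V := V) (r := 2) (a := 5) (k := 7) (b := 1) (c := 3) (d := 4) (f := 6) (by decide)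
    have h5 := sum_Lop_lineOp (V := V) (r := 3) (a := 4) (k := 7) (b := 1) (c := 2) (d := 5) (f := 6) (by decide)
    have h6 := sum_Lop_lineOp (V := V) (r := 3) (a := 6) (k := 5) (b := 1) (c := 2) (d := 4) (f := 7) (by decide)
    have s1 := Lop_mul_self (V := V) 1 (by decide)
    have s2 := Lop_mul_self (V := V) 2 (by decide)
    have s3 := Lop_mul_self (V := V) 3 (by decide)
    have s4 := Lop_mul_self (V := V) 4 (by decide)
    have s5 := Lop_mul_self (V := V) 5 (by decide)
    have s6 := Lop_mul_self (V := V) 6 (by decide)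
    have s7 := Lop_mul_self (V := V) 7 (by decide)
    linear_combination (norm := module) - (1 / 8 : ℝ) • h0 - (1 / 8 : ℝ) • h1 - (1 / 8 : ℝ) • h2 - (1 / 8 : ℝ) • h3 - (1 / 8 : ℝ) • h4 - (1 / 8 : ℝ) • h5 - (1 / 8 : ℝ) • h6 - (1 / 8 : ℝ) • s1 - (1 / 8 : ℝ) • s2 - (1 / 8 : ℝ) • s3 - (1 / 8 : ℝ) • s4 - (1 / 8 : ℝ) • s5 - (1 / 8 : ℝ) • s6 - (1 / 8 : ℝ) • s7
  have h2 := DFunLike.congr_fun h x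
  simp only [Fin.sum_univ_seven]
  exact h2

lemma sum_rmo_reO (x : V) : ∑ i : Fin 8, rmo (e i) (reO V (rmo (conj (e i)) x)) = x := by
  obtain ⟨m, hm, hx⟩ : ∃ m : Fin 8 → V, (∀ i, m i ∈ ReSet V) ∧ x = ∑ i, rmo (e i) (m i) := by
    refine ⟨Fin.cons (reO V x) fun i => -reO V (lmo (e i.succ) x), fun i => ?_, ?_⟩
    · refine Fin.cases ?_ (fun i => ?_) i
      · exact reO_mem x
      · simp only [Fin.cons_succ]
        rw [← map_neg]
        exact reO_mem _
    · rw [Fin.sum_univ_succ]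
      simp only [Fin.cons_zero, Fin.cons_succ, map_neg, ← (reO_mem _).2, Finset.sum_neg_distrib,
        e_zero, lmo_one]
      rw [← sub_eq_add_neg, sum_lmo_reO_lmo]
  have key : ∀ i, reO V (rmo (conj (e i)) x) = m i := by
    intro i
    rw [hx]
    simp only [map_sum, rmo_rmo_of_mem (hm _), reO_rmo (hm _)]
    rw [Finset.sum_eq_single i]
    · have : re (e i * conj (e i)) = 1 := by
        fin_cases i <;> simp [re, conj]
      rw [this, one_smul]
    · intro j _ hji
      have : re (e j * conj (e i)) = 0 := by
        revert hji
        fin_cases i <;> fin_cases j <;> simp [re, conj]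
      rw [this, zero_smul]
    · simp
  simp only [key]
  exact hx.symm

end Bimodule

lemma Oct.re_mul_comm (p q : Oct) : re (p * q) = re (q * p) := by
  simp [re]; ring

lemma Oct.re_mul_assoc (p q r : Oct) : re ((p * q) * r) = re (p * (q * r)) := by
  simp [re]; ring

lemma Oct.sum_re_mul_conj' (p : Oct) : ∑ i : Fin 8, re (p * conj (e i)) • e i = p := by
  simp only [Fin.sum_univ_eight]
  apply ext_coord <;> simp [conj, re]

section Bimodule

variable {V : Type*} [NormedAddCommGroup V] [NormedSpace ℝ V] [OctBimodule V]

/-- Every element is `∑ mᵢ eᵢ` with `mᵢ` in the real part. -/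
lemma exists_eq_sum_rmo (x : V) :
    ∃ m : Fin 8 → V, (∀ i, m i ∈ ReSet V) ∧ x = ∑ i, rmo (e i) (m i) :=
  ⟨fun i => reO V (rmo (conj (e i)) x), fun _ => reO_mem _, (sum_rmo_reO x).symm⟩

lemma reO_lmo_eq (p : Oct) (x : V) : reO V (lmo p x) = reO V (rmo p x) := by
  obtain ⟨m, hm, rfl⟩ := exists_eq_sum_rmo x
  simp only [map_sum, lmo_rmo_of_mem (hm _), rmo_rmo_of_mem (hm _), reO_rmo (hm _),
    Oct.re_mul_comm p]

lemma reO_rmo_rmo (p q : Oct) (x : V) : reO V (rmo q (rmo p x)) = reO V (rmo (p * q) x) := by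
  obtain ⟨m, hm, rfl⟩ := exists_eq_sum_rmo x
  simp only [map_sum, rmo_rmo_of_mem (hm _), reO_rmo (hm _), Oct.re_mul_assoc]

lemma ext_reO {x y : V} (h : ∀ p : Oct, reO V (rmo p x) = reO V (rmo p y)) : x = y := by
  rw [← sum_rmo_reO x, ← sum_rmo_reO y]
  simp only [h]

lemma isRightPara_iff {A : V →L[ℝ] V} :
    IsRightPara A ↔ ∀ p x, reO V (rmo p (A x)) = reO V (A (rmo p x)) := by
  refine forall_congr' fun p => forall_congr' fun x => ?_
  rw [Bop]
  show reO V (rmo p (A x) - A (rmo p x)) = 0 ↔ _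
  rw [map_sub, sub_eq_zero]

lemma IsRightPara.map_rmo {A : V →L[ℝ] V} (hA : IsRightPara A) {m : V} (hm : m ∈ ReSet V)
    (p : Oct) : A (rmo p m) = rmo p (A m) := by
  rw [isRightPara_iff] at hA
  refine ext_reO fun q => ?_
  rw [hA, rmo_rmo_of_mem hm, ← hA, reO_rmo_rmo]

lemma isRightPara_of_map_rmo {A : V →L[ℝ] V}
    (hA : ∀ m ∈ ReSet V, ∀ p, A (rmo p m) = rmo p (A m)) : IsRightPara A := by
  rw [isRightPara_iff]
  intro p x
  obtain ⟨m, hm, rfl⟩ := exists_eq_sum_rmo x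
  simp only [map_sum, rmo_rmo_of_mem (hm _), hA _ (hm _), reO_rmo_rmo]

lemma odotL_apply (p : Oct) (A : V →L[ℝ] V) (x : V) :
    odotL p A x = lmo p (A x) + (rmo p (A x) - A (rmo p x)) := rfl

lemma odotR_apply (p : Oct) (A : V →L[ℝ] V) (x : V) :
    odotR A p x = A (lmo p x) - (rmo p (A x) - A (rmo p x)) := rfl

lemma IsRightPara.odotL_of_mem {A : V →L[ℝ] V} (hA : IsRightPara A) {m : V} (hm : m ∈ ReSet V)
    (p : Oct) : odotL p A m = lmo p (A m) := by
  rw [odotL_apply, hA.map_rmo hm, sub_self, add_zero]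

lemma IsRightPara.odotR_of_mem {A : V →L[ℝ] V} (hA : IsRightPara A) {m : V} (hm : m ∈ ReSet V)
    (p : Oct) : odotR A p m = rmo p (A m) := by
  rw [odotR_apply, hm.2, hA.map_rmo hm, sub_self, sub_zero]

lemma IsRightPara.odotL {A : V →L[ℝ] V} (hA : IsRightPara A) (p : Oct) :
    IsRightPara (odotL p A) := by
  refine isRightPara_of_map_rmo fun m hm q => ?_
  rw [hA.odotL_of_mem hm, odotL_apply, rmo_rmo_of_mem hm, hA.map_rmo hm, hA.map_rmo hm]
  have h := asc_eq_right q p (A m)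
  rw [asc_eq_mid] at h
  linear_combination (norm := module) (-1 : ℝ) • h

lemma IsRightPara.odotR {A : V →L[ℝ] V} (hA : IsRightPara A) (p : Oct) :
    IsRightPara (odotR A p) := by
  refine isRightPara_of_map_rmo fun m hm q => ?_
  rw [hA.odotR_of_mem hm, odotR_apply, rmo_rmo_of_mem hm, lmo_rmo_of_mem hm, hA.map_rmo hm,
    hA.map_rmo hm, hA.map_rmo hm]
  have h := asc_eq_right q p (A m)
  rw [asc_swap p q, asc_eq_right p q] at h
  linear_combination (norm := module) (1 : ℝ) • h

lemma IsRightPara.reO_odotL {A : V →L[ℝ] V} (hA : IsRightPara A) (p : Oct) (u : V) :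
    reO V (_root_.odotL p A u) = reO V (A (rmo p u)) := by
  rw [odotL_apply, map_add, map_sub, reO_lmo_eq, isRightPara_iff.mp hA, sub_self, add_zero]

lemma reO_rmo_lifO (F : V →L[ℝ] V) (p : Oct) (x : V) :
    reO V (rmo p (lifO ((reO V).comp F) x)) = reO V (F (rmo p x)) := by
  have h : lifO ((reO V).comp F) x = ∑ i, rmo (e i) (reO V (F (rmo (conj (e i)) x))) := by
    simp only [lifO, _root_.sum_apply]
    rfl
  simp only [h, map_sum, rmo_rmo_of_mem (reO_mem _), reO_rmo (reO_mem _)]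
  nth_rewrite 2 [← sum_re_mul_conj p]
  rw [rmo_sum]
  simp only [map_sum, rmo_smul, map_smul]

lemma reO_lifO (F : V →L[ℝ] V) (x : V) : reO V (lifO ((reO V).comp F) x) = reO V (F x) := by
  have h := reO_rmo_lifO F 1 x
  rwa [rmo_one, rmo_one] at h

lemma isRightPara_lifO (F : V →L[ℝ] V) : IsRightPara (lifO ((reO V).comp F)) := by
  rw [isRightPara_iff]
  intro p x
  rw [reO_rmo_lifO, reO_lifO]

lemma extO_rmo (G : V →L[ℝ] V) {m : V} (hm : m ∈ ReSet V) (p : Oct) :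
    extO G (rmo p m) = rmo p (G m) := by
  have h : extO G (rmo p m) = ∑ i, rmo (e i) (G (reO V (rmo (conj (e i)) (rmo p m)))) := by
    simp only [extO, _root_.sum_apply]
    rfl
  simp only [h, rmo_rmo_of_mem hm, reO_rmo hm, map_smul]
  nth_rewrite 2 [← Oct.sum_re_mul_conj' p]
  rw [rmo_sum]
  simp only [rmo_smul]

lemma extO_of_mem (G : V →L[ℝ] V) {m : V} (hm : m ∈ ReSet V) : extO G m = G m := by
  have h := extO_rmo G hm 1
  rwa [rmo_one, rmo_one] at h

lemma isRightPara_extO (G : V →L[ℝ] V) : IsRightPara (extO G) :=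
  isRightPara_of_map_rmo fun m hm p => by rw [extO_rmo G hm, extO_of_mem G hm]

lemma IsRightPara.add {A B : V →L[ℝ] V} (hA : IsRightPara A) (hB : IsRightPara B) :
    IsRightPara (A + B) := by
  rw [isRightPara_iff] at *
  intro p x
  simp only [_root_.add_apply, map_add, hA p x, hB p x]

lemma IsRightPara.smul {A : V →L[ℝ] V} (hA : IsRightPara A) (r : ℝ) : IsRightPara (r • A) := by
  rw [isRightPara_iff] at *
  intro p x
  simp only [_root_.smul_apply, map_smul, hA p x]

lemma isRightPara_zero : IsRightPara (0 : V →L[ℝ] V) := by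
  rw [isRightPara_iff]
  intro p x
  simp

lemma isRightPara_sum {ι : Type*} (s : Finset ι) (A : ι → V →L[ℝ] V)
    (hA : ∀ i ∈ s, IsRightPara (A i)) : IsRightPara (∑ i ∈ s, A i) := by
  classical
  induction s using Finset.induction_on with
  | empty => simpa using isRightPara_zero
  | insert a s ha ih =>
    rw [Finset.sum_insert ha]
    exact (hA a (Finset.mem_insert_self a s)).add
      (ih fun i hi => hA i (Finset.mem_insert_of_mem hi))

lemma isRightPara_integral [CompleteSpace V] (A : ℝ → V →L[ℝ] V) (hA : ∀ t, IsRightPara (A t))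
    (a b : ℝ) : IsRightPara (∫ t in a..b, A t) := by
  by_cases h : IntervalIntegrable A MeasureTheory.volume a b
  · rw [isRightPara_iff]
    intro p x
    have h1 := ContinuousLinearMap.intervalIntegral_comp_comm
      ((reO V).comp ((rmo p).comp (ContinuousLinearMap.apply ℝ V x))) h
    have h2 := ContinuousLinearMap.intervalIntegral_comp_comm
      ((reO V).comp (ContinuousLinearMap.apply ℝ V (rmo p x))) h
    simp only [ContinuousLinearMap.comp_apply, ContinuousLinearMap.apply_apply] at h1 h2
    rw [← h1, ← h2]
    exact intervalIntegral.integral_congr fun t _ => isRightPara_iff.mp (hA t) p x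
  · rw [intervalIntegral.integral_undef h]
    exact isRightPara_zero

lemma isRightPara_reOpB {A : V →L[ℝ] V} (hA : IsRightPara A) : IsRightPara (reOpB A) := by
  rw [reOpB, sub_eq_add_neg, ← neg_smul]
  exact (hA.smul _).add ((isRightPara_sum _ _ fun i _ => (hA.odotL _).odotR _).smul _)

lemma reOpB_of_mem {A : V →L[ℝ] V} (hA : IsRightPara A) {m : V} (hm : m ∈ ReSet V) :
    reOpB A m = reO V (A m) := by
  simp only [reOpB, reO, _root_.sub_apply, _root_.smul_apply, _root_.sum_apply,
    (hA.odotL _).odotR_of_mem hm, hA.odotL_of_mem hm]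
  rfl

lemma IsRightPara.ext {A B : V →L[ℝ] V} (hA : IsRightPara A) (hB : IsRightPara B)
    (h : ∀ m ∈ ReSet V, A m = B m) : A = B := by
  ext x
  obtain ⟨m, hm, rfl⟩ := exists_eq_sum_rmo x
  simp only [map_sum, hA.map_rmo (hm _), hB.map_rmo (hm _), h _ (hm _)]

/-- The operator real part of a right para-linear operator is determined by the real parts of
its values on the real part of the module. -/
lemma reOpB_eq_of_reO_eq {A B : V →L[ℝ] V} (hA : IsRightPara A) (hB : IsRightPara B)
    (h : ∀ m ∈ ReSet V, reO V (A m) = reO V (B m)) : reOpB A = reOpB B :=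
  (isRightPara_reOpB hA).ext (isRightPara_reOpB hB) fun m hm => by
    rw [reOpB_of_mem hA hm, reOpB_of_mem hB hm, h m hm]

end Bimodule

/-- Twice the Cauchy–Riemann operator, `φ ↦ ∂φ/∂x + i ∂φ/∂y`. -/
def dbar (φ : ℂ → ℂ) (z : ℂ) : ℂ := fderiv ℝ φ z 1 + Complex.I * fderiv ℝ φ z Complex.I

lemma dbar_polar (φ : ℂ → ℂ) (w : ℂ) (θ : ℝ) :
    (Real.cos θ + Real.sin θ * Complex.I) *
      (fderiv ℝ φ w (Real.cos θ + Real.sin θ * Complex.I) +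
        Complex.I * fderiv ℝ φ w (Complex.I * (Real.cos θ + Real.sin θ * Complex.I))) =
      dbar φ w := by
  have h1 : (Real.cos θ + Real.sin θ * Complex.I : ℂ) =
      Real.cos θ • (1 : ℂ) + Real.sin θ • Complex.I := by simp
  have h2 : (Complex.I * (Real.cos θ + Real.sin θ * Complex.I) : ℂ) =
      (-Real.sin θ) • (1 : ℂ) + Real.cos θ • Complex.I := by
    simp only [Complex.real_smul]; push_cast
    linear_combination (Complex.sin θ : ℂ) * Complex.I_sq
  rw [h2, h1, map_add, map_add, map_smul, map_smul, map_smul, map_smul]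
  simp only [Complex.real_smul, dbar]
  push_cast
  have h3 : (Complex.cos θ) ^ 2 + (Complex.sin θ) ^ 2 = 1 := by
    rw [add_comm]; exact Complex.sin_sq_add_cos_sq _
  generalize fderiv ℝ φ w 1 = A
  generalize fderiv ℝ φ w Complex.I = B
  linear_combination (A + Complex.I * B) * h3 +
    (-A * Complex.sin θ ^ 2 + B * Complex.sin θ * Complex.cos θ) * Complex.I_sq

lemma continuous_dbar {φ : ℂ → ℂ} (h : ContDiff ℝ 1 φ) : Continuous (dbar φ) := by
  have := h.continuous_fderiv one_ne_zero
  unfold dbar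
  fun_prop

lemma HasCompactSupport.dbar {φ : ℂ → ℂ} (h : HasCompactSupport φ) :
    HasCompactSupport (dbar φ) :=
  (h.fderiv ℝ).mono fun z hz => by
    contrapose! hz
    simp only [Function.mem_support, not_not] at hz ⊢
    simp [_root_.dbar, hz]

open MeasureTheory in
/-- The Cauchy–Pompeiu formula for compactly supported functions. -/
theorem integral_dbar_mul_inv {φ : ℂ → ℂ} (h : ContDiff ℝ 1 φ) (hc : HasCompactSupport φ) (z : ℂ) :
    ∫ w, dbar φ w * (z - w)⁻¹ = 2 * Real.pi * φ z := by
  set E : ℝ → ℂ := fun θ => Real.cos θ + Real.sin θ * Complex.I with hE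
  have hEn : ∀ θ, ‖E θ‖ = 1 := fun θ => by
    simp [hE, Complex.norm_cos_add_sin_mul_I]
  have hE0 : ∀ θ, E θ ≠ 0 := fun θ h0 => by simpa [h0] using hEn θ
  have hEc : Continuous E := by fun_prop
  obtain ⟨R, hR⟩ := hc.isCompact.isBounded.subset_closedBall z
  have hfd := h.continuous_fderiv one_ne_zero
  set A : ℝ × ℝ → ℂ := fun p => fderiv ℝ φ (z + p.1 • E p.2) (E p.2) with hA
  set B : ℝ × ℝ → ℂ := fun p => fderiv ℝ φ (z + p.1 • E p.2) (Complex.I * E p.2) with hB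
  have hAc : Continuous A := by fun_prop
  have hBc : Continuous B := by fun_prop
  have hz : ∀ p : ℝ × ℝ, 0 < p.1 → R < p.1 → fderiv ℝ φ (z + p.1 • E p.2) = 0 := by
    intro p hp hpR
    by_contra hne
    have : z + p.1 • E p.2 ∈ tsupport φ := by
      by_contra hn
      exact hne (fderiv_of_notMem_tsupport (𝕜 := ℝ) hn)
    have := hR this
    rw [Metric.mem_closedBall, dist_eq_norm, add_sub_cancel_left, norm_smul, hEn] at this
    simp [abs_of_pos hp] at this
    linarith
  have hInt : ∀ C : ℝ × ℝ → ℂ, Continuous C → (∀ p : ℝ × ℝ, 0 < p.1 → R < p.1 → C p = 0) →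
      IntegrableOn C (Set.Ioi (0 : ℝ) ×ˢ Set.Ioo (-Real.pi) Real.pi) := by
    intro C hC hC0
    have h1 : IntegrableOn C (Set.Icc (0 : ℝ) R ×ˢ Set.Icc (-Real.pi) Real.pi) :=
      hC.continuousOn.integrableOn_compact (isCompact_Icc.prod isCompact_Icc)
    refine (h1.of_forall_sdiff_eq_zero (measurableSet_Ioi.prod measurableSet_Ioo) ?_)
    rintro ⟨r, θ⟩ ⟨⟨hr, hθ⟩, hn⟩
    refine hC0 _ hr ?_
    by_contra hle
    exact hn ⟨⟨le_of_lt hr, not_lt.1 hle⟩, Set.Ioo_subset_Icc_self hθ⟩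
  have hAi := hInt A hAc fun p h1 h2 => by simp only [hA]; rw [hz p h1 h2]; rfl
  have hBi := hInt B hBc fun p h1 h2 => by simp only [hB]; rw [hz p h1 h2]; rfl
  have hAv : ∫ p in Set.Ioi (0 : ℝ) ×ˢ Set.Ioo (-Real.pi) Real.pi, A p =
      -(2 * Real.pi * φ z) := by
    rw [Measure.volume_eq_prod, ← setIntegral_prod_swap, setIntegral_prod]
    swap
    · exact hAi.swap
    have : ∀ θ : ℝ, ∫ r in Set.Ioi (0 : ℝ), A (r, θ) = - φ z := by
      intro θ
      have hd : ∀ r : ℝ, HasDerivAt (fun r : ℝ => φ (z + r • E θ)) (A (r, θ)) r := by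
        intro r
        have h2 : HasDerivAt (fun r : ℝ => z + r • E θ) (E θ) r := by
          simpa using ((hasDerivAt_id r).smul_const (E θ)).const_add z
        exact ((h.differentiable one_ne_zero) _).hasFDerivAt.comp_hasDerivAt r h2
      have hcs : HasCompactSupport fun r : ℝ => φ (z + r • E θ) := by
        refine hc.comp_isClosedEmbedding ?_
        have hi : Isometry fun r : ℝ => z + r • E θ := by
          refine Isometry.of_dist_eq fun x y => ?_
          rw [dist_add_left, dist_eq_norm, ← sub_smul, norm_smul, hEn, mul_one, dist_eq_norm]
        exact hi.isClosedEmbedding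
      have := HasCompactSupport.integral_Ioi_deriv_eq (f := fun r : ℝ => φ (z + r • E θ))
        (h.comp (by fun_prop)) hcs 0
      rw [show deriv (fun r : ℝ => φ (z + r • E θ)) = fun r => A (r, θ) from
        funext fun r => (hd r).deriv] at this
      simpa using this
    simp only [Prod.swap, this]
    rw [setIntegral_const, Real.volume_real_Ioo_of_le (by linarith [Real.pi_pos]),
      Complex.real_smul]
    push_cast; ring
  have hBv : ∫ p in Set.Ioi (0 : ℝ) ×ˢ Set.Ioo (-Real.pi) Real.pi, B p = 0 := by
    rw [Measure.volume_eq_prod, setIntegral_prod _ hBi]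
    refine setIntegral_eq_zero_of_forall_eq_zero fun r hr => ?_
    have hr0 : (r : ℂ) ≠ 0 := by exact_mod_cast (ne_of_gt hr)
    have hd : ∀ θ : ℝ, HasDerivAt (fun θ : ℝ => (r : ℂ)⁻¹ * φ (z + r • E θ)) (B (r, θ)) θ := by
      intro θ
      have h2 : HasDerivAt E (Complex.I * E θ) θ := by
        have := ((Real.hasDerivAt_cos θ).ofReal_comp).add
          (((Real.hasDerivAt_sin θ).ofReal_comp).mul_const Complex.I)
        refine HasDerivAt.congr_deriv this ?_
        simp only [hE]; push_cast; linear_combination (-Complex.sin θ) * Complex.I_sq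
      have h3 : HasDerivAt (fun θ : ℝ => z + r • E θ) (r • (Complex.I * E θ)) θ :=
        (h2.const_smul r).const_add z
      have h4 := (((h.differentiable one_ne_zero) _).hasFDerivAt.comp_hasDerivAt θ h3).const_mul
        (r : ℂ)⁻¹
      refine HasDerivAt.congr_deriv h4 ?_
      rw [map_smul, Complex.real_smul, ← mul_assoc, inv_mul_cancel₀ hr0, one_mul]
    rw [← integral_Ioc_eq_integral_Ioo, ← intervalIntegral.integral_of_le (by
      linarith [Real.pi_pos]), intervalIntegral.integral_eq_sub_of_hasDerivAt (fun θ _ => hd θ)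
      (Continuous.intervalIntegrable (by fun_prop) _ _)]
    simp [hE]
  calc ∫ w, dbar φ w * (z - w)⁻¹ = ∫ u, dbar φ (z + u) * (z - (z + u))⁻¹ :=
        (integral_add_left_eq_self (fun w => dbar φ w * (z - w)⁻¹) z).symm
    _ = ∫ p in Complex.polarCoord.target, p.1 • (dbar φ (z + Complex.polarCoord.symm p) *
          (z - (z + Complex.polarCoord.symm p))⁻¹) :=
        (Complex.integral_comp_polarCoord_symm _).symm
    _ = ∫ p in Set.Ioi (0 : ℝ) ×ˢ Set.Ioo (-Real.pi) Real.pi, -(A p + Complex.I * B p) := by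
        rw [Complex.polarCoord_target]
        refine setIntegral_congr_fun (measurableSet_Ioi.prod measurableSet_Ioo) ?_
        rintro ⟨r, θ⟩ ⟨hr, -⟩
        have hr0 : (r : ℂ) ≠ 0 := by exact_mod_cast (ne_of_gt hr)
        simp only [Complex.polarCoord_symm_apply, hA, hB, Complex.real_smul]
        rw [show ((r : ℂ) * (Real.cos θ + Real.sin θ * Complex.I)) = r * E θ from rfl,
          ← dbar_polar φ _ θ, ← show E θ = Real.cos θ + Real.sin θ * Complex.I from rfl]
        have := hE0 θ
        rw [show z - (z + r * E θ) = -(r * E θ) by ring]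
        field_simp
    _ = 2 * Real.pi * φ z := by
        rw [integral_neg, integral_add hAi (hBi.const_mul _), hAv, integral_const_mul, hBv]
        ring

open MeasureTheory in
theorem integral_dbar {φ : ℂ → ℂ} (h : ContDiff ℝ 1 φ) (hc : HasCompactSupport φ) :
    ∫ w, dbar φ w = 0 := by
  have h1 := integral_dbar_mul_inv (φ := fun w => -w * φ w) (by fun_prop)
    (hc.mul_left (f := fun w => -w)) 0
  rw [mul_eq_zero_of_right _ (by simp)] at h1
  rw [← h1]
  refine integral_congr_ae ?_
  filter_upwards [compl_mem_ae_iff.2 (measure_singleton (0 : ℂ))] with w hw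
  have hw : w ≠ 0 := hw
  have h2 : fderiv ℝ (fun w => -w * φ w) w = (-w) • fderiv ℝ φ w +
      φ w • (-ContinuousLinearMap.id ℝ ℂ) := by
    exact ((hasFDerivAt_id (𝕜 := ℝ) w).neg.mul
      ((h.differentiable one_ne_zero) w).hasFDerivAt).fderiv
  simp only [dbar, h2]
  simp
  field_simp
  linear_combination -φ w * Complex.I_sq

open MeasureTheory in
lemma exists_integral_norm_mul_inv_le {g : ℂ → ℂ} (hg : Continuous g) (hc : HasCompactSupport g)
    (R : ℝ) : ∃ C : ℝ, ∀ z : ℂ, ‖z‖ ≤ R → Integrable (fun w => g w * (z - w)⁻¹) ∧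
      ∫ w, ‖g w * (z - w)⁻¹‖ ≤ C := by
  obtain ⟨M, hM⟩ := hg.bounded_above_of_compact_support hc
  obtain ⟨r, hr⟩ := hc.isCompact.isBounded.subset_closedBall (0 : ℂ)
  have hM0 : 0 ≤ M := (norm_nonneg _).trans (hM 0)
  have hi : IntegrableOn (fun u : ℂ => u⁻¹) (Metric.ball 0 (R + r + 1)) := by
    refine integrableOn_ball_of_norm_le_rpow (C := 1) (α := 1) ?_ ?_ (Filter.Eventually.of_forall
      fun x => ?_) (by fun_prop)
    · simp [Complex.finrank_real_complex]
    · simp [Complex.finrank_real_complex]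
    · rw [norm_inv, Real.rpow_neg_one, one_mul]
  set k : ℂ → ℝ := (Metric.ball (0 : ℂ) (R + r + 1)).indicator fun u => M * ‖u⁻¹‖ with hk
  have hki : Integrable k := (integrable_indicator_iff measurableSet_ball).2 (hi.norm.const_mul M)
  refine ⟨∫ u, k u, fun z hz => ?_⟩
  have hbd : ∀ u, ‖g (z - u) * u⁻¹‖ ≤ k u := by
    intro u
    by_cases hu : u ∈ Metric.ball (0 : ℂ) (R + r + 1)
    · rw [hk, Set.indicator_of_mem hu, norm_mul]
      exact mul_le_mul_of_nonneg_right (hM _) (norm_nonneg _)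
    · rw [hk, Set.indicator_of_notMem hu]
      have : g (z - u) = 0 := by
        by_contra hne
        have h1 := hr (subset_tsupport g hne)
        rw [mem_closedBall_zero_iff] at h1
        rw [mem_ball_zero_iff] at hu
        have : ‖u‖ ≤ ‖z‖ + ‖z - u‖ := by
          have := norm_sub_le z (z - u)
          rwa [sub_sub_cancel] at this
        linarith
      simp [this]
  have hI : Integrable fun u => g (z - u) * u⁻¹ :=
    hki.mono' (by fun_prop) (Filter.Eventually.of_forall hbd)
  have hI' := hI.comp_sub_left z
  simp only [sub_sub_cancel] at hI'
  refine ⟨hI', ?_⟩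
  have h2 := integral_sub_left_eq_self (fun w => ‖g (z - w) * w⁻¹‖) volume z
  simp only [sub_sub_cancel] at h2
  rw [h2]
  exact integral_mono hI.norm hki hbd

/-- A parametrization of the boundary of a plane domain by finitely many curves, positively
oriented in the sense of winding numbers. -/
structure PlaneContour (S : Set ℂ) where
  n : ℕ
  γ : Fin n → ℝ → ℂ
  smooth : ∀ i, ContDiff ℝ 1 (γ i)
  isOpen : IsOpen S
  image_eq : (⋃ i, γ i '' Set.Icc (0 : ℝ) 1) = frontier S
  winding_inside : ∀ z ∈ S,
    (∑ i, ∫ t in (0 : ℝ)..1, deriv (γ i) t / (γ i t - z)) = 2 * (Real.pi : ℂ) * Complex.I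
  winding_outside : ∀ z ∉ closure S,
    (∑ i, ∫ t in (0 : ℝ)..1, deriv (γ i) t / (γ i t - z)) = 0

namespace PlaneContour

variable {S : Set ℂ} (Γ : PlaneContour S)

/-- The integral `∮_Γ φ dz`. -/
def integral (φ : ℂ → ℂ) : ℂ := ∑ i, ∫ t in (0 : ℝ)..1, φ (Γ.γ i t) * deriv (Γ.γ i) t

include Γ

lemma continuous_deriv (i) : Continuous (deriv (Γ.γ i)) := (Γ.smooth i).continuous_deriv le_rfl

lemma continuous_curve (i) : Continuous (Γ.γ i) := (Γ.smooth i).continuous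

lemma mem_frontier (i) {t : ℝ} (ht : t ∈ Set.Icc (0 : ℝ) 1) : Γ.γ i t ∈ frontier S := by
  rw [← Γ.image_eq]; exact Set.mem_iUnion.2 ⟨i, t, ht, rfl⟩

lemma isCompact_frontier : IsCompact (frontier S) := by
  rw [← Γ.image_eq]
  exact isCompact_iUnion fun i => isCompact_Icc.image (Γ.continuous_curve i)

open MeasureTheory in
lemma volume_frontier : volume (frontier S) = 0 := by
  rw [← Γ.image_eq, measure_iUnion_null_iff]
  intro i
  have hd : ∀ z : ℂ, HasFDerivAt (fun z : ℂ => Γ.γ i z.re)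
      ((fderiv ℝ (Γ.γ i) z.re).comp Complex.reCLM) z := fun z =>
    (((Γ.smooth i).differentiable one_ne_zero) z.re).hasFDerivAt.comp z Complex.reCLM.hasFDerivAt
  have := addHaar_image_eq_zero_of_det_fderivWithin_eq_zero (μ := volume)
    (f := fun z : ℂ => Γ.γ i z.re) (s := Set.univ)
    (fun z _ => (hd z).hasFDerivWithinAt) (fun z _ => by
      rw [ContinuousLinearMap.det, LinearMap.det_eq_zero_iff_ker_ne_bot]
      intro h0
      have : Complex.I ∈ LinearMap.ker (((fderiv ℝ (Γ.γ i) z.re).comp Complex.reCLM : ℂ →L[ℝ] ℂ) :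
          ℂ →ₗ[ℝ] ℂ) := by
        rw [LinearMap.mem_ker]; simp
      rw [h0] at this
      exact Complex.I_ne_zero this)
  refine measure_mono_null ?_ this
  rintro _ ⟨t, -, rfl⟩
  exact ⟨(t : ℂ), trivial, by simp⟩

open MeasureTheory in
lemma isBounded : Bornology.IsBounded S := by
  obtain ⟨R, hR⟩ := Γ.isCompact_frontier.isBounded.subset_closedBall (0 : ℂ)
  have hC : ∀ i, ∃ C : ℝ, ∀ t ∈ Set.Icc (0 : ℝ) 1, ‖deriv (Γ.γ i) t‖ ≤ C := fun i =>
    isCompact_Icc.exists_bound_of_continuousOn (Γ.continuous_deriv i).continuousOn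
  choose C hC using hC
  refine (Metric.isBounded_closedBall (x := (0 : ℂ)) (r := R + 1 + ∑ i, C i)).subset fun z hz => ?_
  rw [mem_closedBall_zero_iff]
  by_contra! hlt
  have hC0 : ∀ i, 0 ≤ C i := fun i => (norm_nonneg _).trans (hC i 0 (by simp))
  have hS0 : 0 ≤ ∑ i, C i := Finset.sum_nonneg fun i _ => hC0 i
  have h1 := Γ.winding_inside z hz
  have h2 : ∀ i, ‖∫ t in (0 : ℝ)..1, deriv (Γ.γ i) t / (Γ.γ i t - z)‖ ≤
      C i / (1 + ∑ i, C i) * |1 - 0| := by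
    intro i
    refine intervalIntegral.norm_integral_le_of_norm_le_const fun t ht => ?_
    rw [Set.uIoc_of_le zero_le_one] at ht
    have ht' := Set.Ioc_subset_Icc_self ht
    rw [norm_div]
    have h3 := hR (Γ.mem_frontier i ht')
    rw [mem_closedBall_zero_iff] at h3
    have h4 : 1 + ∑ i, C i ≤ ‖Γ.γ i t - z‖ := by
      have := norm_sub_norm_le z (Γ.γ i t)
      rw [norm_sub_rev] at this
      linarith
    have := hC i t ht'
    have := hC0 i
    gcongr
  have h3 : ‖(2 * (Real.pi : ℂ) * Complex.I)‖ ≤ 1 := by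
    rw [← h1]
    refine (norm_sum_le _ _).trans ((Finset.sum_le_sum fun i _ => h2 i).trans ?_)
    simp only [sub_zero, abs_one, mul_one]
    rw [← Finset.sum_div, div_le_one (by linarith)]
    linarith
  simp [abs_of_pos Real.pi_pos] at h3
  linarith [Real.pi_gt_three]

open MeasureTheory in
/-- Green's theorem for compactly supported functions. -/
theorem integral_eq_dbar {φ : ℂ → ℂ} (h : ContDiff ℝ 1 φ) (hc : HasCompactSupport φ) :
    Γ.integral φ = Complex.I * ∫ w in S, dbar φ w := by
  obtain ⟨R, hR⟩ := Γ.isCompact_frontier.isBounded.subset_closedBall (0 : ℂ)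
  obtain ⟨C, hC⟩ := exists_integral_norm_mul_inv_le (continuous_dbar h) hc.dbar R
  have hφc := continuous_dbar h
  have hpi : (2 * Real.pi : ℂ) ≠ 0 := by
    exact_mod_cast (mul_pos two_pos Real.pi_pos).ne'
  have hInt : ∀ i, Integrable (Function.uncurry fun (t : ℝ) (w : ℂ) =>
      dbar φ w * (Γ.γ i t - w)⁻¹ * deriv (Γ.γ i) t)
      ((volume.restrict (Set.uIoc (0 : ℝ) 1)).prod volume) := by
    intro i
    have hγ := Γ.continuous_curve i
    have hγ' := Γ.continuous_deriv i
    have hm : AEStronglyMeasurable (Function.uncurry fun (t : ℝ) (w : ℂ) =>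
        dbar φ w * (Γ.γ i t - w)⁻¹ * deriv (Γ.γ i) t)
        ((volume.restrict (Set.uIoc (0 : ℝ) 1)).prod volume) := by
      refine Measurable.aestronglyMeasurable ?_
      have := hφc.measurable
      have := hγ.measurable
      have := hγ'.measurable
      unfold Function.uncurry
      fun_prop
    obtain ⟨M, hM⟩ := isCompact_Icc.exists_bound_of_continuousOn
      (hγ'.continuousOn (s := Set.Icc (0 : ℝ) 1))
    have hmem : ∀ t ∈ Set.uIoc (0 : ℝ) 1, t ∈ Set.Icc (0 : ℝ) 1 ∧ ‖Γ.γ i t‖ ≤ R := by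
      intro t ht
      rw [Set.uIoc_of_le zero_le_one] at ht
      have := Set.Ioc_subset_Icc_self ht
      exact ⟨this, by simpa using hR (Γ.mem_frontier i this)⟩
    rw [integrable_prod_iff hm]
    constructor
    · refine (ae_restrict_iff' measurableSet_uIoc).2 (Filter.Eventually.of_forall fun t ht => ?_)
      simp only [Function.uncurry]
      exact (hC _ (hmem t ht).2).1.mul_const _
    · have : IsFiniteMeasure ((volume : Measure ℝ).restrict (Set.uIoc 0 1)) := by
        rw [Set.uIoc_of_le zero_le_one]; infer_instance
      refine Integrable.mono' (g := fun _ => C * M) (integrable_const _)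
        hm.norm.integral_prod_right' ?_
      refine (ae_restrict_iff' measurableSet_uIoc).2 (Filter.Eventually.of_forall fun t ht => ?_)
      simp only [Function.uncurry]
      rw [Real.norm_of_nonneg (integral_nonneg fun _ => norm_nonneg _)]
      simp only [norm_mul _ (deriv (Γ.γ i) t)]
      rw [integral_mul_const]
      have h1 := (hC _ (hmem t ht).2).2
      exact mul_le_mul h1 (hM t (hmem t ht).1) (norm_nonneg _)
        ((integral_nonneg fun _ => norm_nonneg _).trans h1)
  have h1 : ∀ i, ∫ t in (0 : ℝ)..1, φ (Γ.γ i t) * deriv (Γ.γ i) t = (2 * Real.pi : ℂ)⁻¹ *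
      ∫ w, dbar φ w * ∫ t in (0 : ℝ)..1, deriv (Γ.γ i) t / (Γ.γ i t - w) := by
    intro i
    have : ∀ t, φ (Γ.γ i t) * deriv (Γ.γ i) t = (2 * Real.pi : ℂ)⁻¹ *
        ∫ w, dbar φ w * (Γ.γ i t - w)⁻¹ * deriv (Γ.γ i) t := by
      intro t
      rw [integral_mul_const, integral_dbar_mul_inv h hc]
      field_simp
    simp only [this]
    rw [intervalIntegral.integral_const_mul, intervalIntegral_integral_swap (hInt i)]
    congr 2
    ext w
    rw [← intervalIntegral.integral_const_mul]
    congr 1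
    ext t
    rw [div_eq_mul_inv]; ring
  have h2 : ∀ i, Integrable fun w => dbar φ w *
      ∫ t in (0 : ℝ)..1, deriv (Γ.γ i) t / (Γ.γ i t - w) := by
    intro i
    have := (hInt i).integral_prod_right
    refine this.congr (Filter.Eventually.of_forall fun w => ?_)
    simp only [Function.uncurry]
    rw [intervalIntegral.integral_of_le zero_le_one, Set.uIoc_of_le zero_le_one,
      ← integral_const_mul]
    congr 1
    ext t
    rw [div_eq_mul_inv]; ring
  have hSm := Γ.isOpen.measurableSet
  rw [integral]
  simp only [h1]
  rw [← Finset.mul_sum, ← integral_finsetSum _ fun i _ => h2 i]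
  simp only [← Finset.mul_sum]
  have h3 : (fun w => dbar φ w * ∑ i, ∫ t in (0 : ℝ)..1, deriv (Γ.γ i) t / (Γ.γ i t - w)) =ᵐ[volume]
      S.indicator fun w => dbar φ w * (2 * Real.pi * Complex.I) := by
    filter_upwards [compl_mem_ae_iff.2 Γ.volume_frontier] with w hw
    by_cases hwS : w ∈ S
    · rw [Set.indicator_of_mem hwS, Γ.winding_inside w hwS]
    · rw [Set.indicator_of_notMem hwS, Γ.winding_outside w, mul_zero]
      intro hcl
      exact hw ⟨hcl, by rwa [Γ.isOpen.interior_eq]⟩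
  rw [integral_congr_ae h3, integral_indicator hSm, integral_mul_const]
  field_simp

end PlaneContour

lemma dbar_eq_zero {φ : ℂ → ℂ} {z : ℂ} (h : DifferentiableAt ℂ φ z) : dbar φ z = 0 := by
  have h1 : fderiv ℝ φ z = (fderiv ℂ φ z).restrictScalars ℝ :=
    (h.hasFDerivAt.restrictScalars ℝ).fderiv
  have h2 : fderiv ℂ φ z Complex.I = Complex.I * fderiv ℂ φ z 1 := by
    simpa only [smul_eq_mul, mul_one] using (fderiv ℂ φ z).map_smul Complex.I 1
  rw [dbar, h1, ContinuousLinearMap.coe_restrictScalars', h2]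
  linear_combination (fderiv ℂ φ z 1) * Complex.I_sq

lemma dbar_congr {φ ψ : ℂ → ℂ} {z : ℂ} (h : φ =ᶠ[nhds z] ψ) : dbar φ z = dbar ψ z := by
  rw [dbar, dbar, h.fderiv_eq]

lemma dbar_eq_zero_of_const {φ : ℂ → ℂ} {z a : ℂ} (h : ∀ᶠ w in nhds z, φ w = a) :
    dbar φ z = 0 := by
  rw [dbar_congr (ψ := fun _ => a) h]
  exact dbar_eq_zero (differentiableAt_const a)

lemma dbar_mul {φ ψ : ℂ → ℂ} {z : ℂ} (hψ : DifferentiableAt ℝ ψ z) (hφ : DifferentiableAt ℝ φ z) :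
    dbar (fun w => ψ w * φ w) z = dbar ψ z * φ z + ψ z * dbar φ z := by
  have : fderiv ℝ (fun w => ψ w * φ w) z = ψ z • fderiv ℝ φ z + φ z • fderiv ℝ ψ z :=
    (hψ.hasFDerivAt.mul hφ.hasFDerivAt).fderiv
  simp only [dbar, this]
  simp
  ring

lemma dbar_sub {φ ψ : ℂ → ℂ} {z : ℂ} (hψ : DifferentiableAt ℝ ψ z) (hφ : DifferentiableAt ℝ φ z) :
    dbar (fun w => ψ w - φ w) z = dbar ψ z - dbar φ z := by
  have : fderiv ℝ (fun w => ψ w - φ w) z = fderiv ℝ ψ z - fderiv ℝ φ z :=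
    (hψ.hasFDerivAt.sub hφ.hasFDerivAt).fderiv
  simp only [dbar, this]
  simp
  ring

lemma exists_cutoff {K O : Set ℂ} (hK : IsCompact K) (hO : IsOpen O) (h : K ⊆ O) :
    ∃ ψ : ℂ → ℂ, ContDiff ℝ 1 ψ ∧ HasCompactSupport ψ ∧ tsupport ψ ⊆ O ∧
      ∀ z ∈ K, ∀ᶠ w in nhds z, ψ w = 1 := by
  obtain ⟨L, hL, hKL, hLO⟩ := exists_compact_between hK hO h
  obtain ⟨f, h1, h0, -⟩ := exists_contMDiffMap_one_nhds_of_subset_interior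
    (modelWithCornersSelf ℝ ℂ) (n := 1) hK.isClosed hKL
  have hs : tsupport (fun z => (f z : ℂ)) ⊆ L := by
    refine closure_minimal (fun z hz => ?_) hL.isClosed
    by_contra hn
    exact hz (by simp [h0 z hn])
  refine ⟨fun z => (f z : ℂ), ?_, hL.of_isClosed_subset (isClosed_tsupport _) hs, hs.trans hLO, ?_⟩
  · exact Complex.ofRealCLM.contDiff.comp f.contMDiff.contDiff
  · intro z hz
    have := eventually_nhdsSet_iff_forall.1 h1 z hz
    filter_upwards [this] with w hw
    simp [hw]

lemma contDiff_mul_of_tsupport {O : Set ℂ} (hO : IsOpen O) {χ φ : ℂ → ℂ} (hχ : ContDiff ℝ 1 χ)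
    (hφ : ContDiffOn ℝ 1 φ O) (h : tsupport χ ⊆ O) : ContDiff ℝ 1 fun z => χ z * φ z := by
  refine contDiff_iff_contDiffAt.2 fun z => ?_
  by_cases hz : z ∈ tsupport χ
  · exact hχ.contDiffAt.mul (hφ.contDiffAt (hO.mem_nhds (h hz)))
  · refine (contDiffAt_const (c := (0 : ℂ))).congr_of_eventuallyEq ?_
    filter_upwards [notMem_tsupport_iff_eventuallyEq.1 hz] with w hw
    simp [hw]

open MeasureTheory in
/-- A contour integral of a function with singularities inside `S`, as an area integral against
a cutoff function equal to one wherever the function is not holomorphic. -/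
theorem PlaneContour.integral_eq_cutoff {S : Set ℂ} (Γ : PlaneContour S) {D Z : Set ℂ}
    {φ ψ : ℂ → ℂ} (hD : IsOpen D) (hSD : closure S ⊆ D) (hZ : IsCompact Z) (hZS : Z ⊆ S)
    (hφ : ContDiffOn ℝ 1 φ (D \ Z)) (hψ : ContDiff ℝ 1 ψ) (hψc : HasCompactSupport ψ)
    (hψD : tsupport ψ ⊆ D) (hψS : volume (tsupport ψ \ S) = 0)
    (hψ1 : ∀ z ∈ Z, ∀ᶠ w in nhds z, ψ w = 1)
    (hhol : ∀ z ∈ S, z ∉ Z → ψ z ≠ 1 → dbar φ z = 0) :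
    Γ.integral φ = -Complex.I * ∫ w, dbar ψ w * φ w := by
  obtain ⟨θ, hθ, hθc, hθS, hθ1⟩ := exists_cutoff hZ Γ.isOpen hZS
  obtain ⟨η, hη, hηc, hηD, hη1⟩ := exists_cutoff Γ.isBounded.isCompact_closure hD hSD
  have hDZ : IsOpen (D \ Z) := hD.sdiff hZ.isClosed
  have key : ∀ χ : ℂ → ℂ, ContDiff ℝ 1 χ → HasCompactSupport χ → tsupport χ ⊆ D →
      (∀ z ∈ Z, ∀ᶠ w in nhds z, χ w = 1) →
      tsupport (fun w => χ w - θ w) ⊆ D \ Z ∧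
      ContDiff ℝ 1 (fun w => (χ w - θ w) * φ w) ∧
      HasCompactSupport (fun w => (χ w - θ w) * φ w) ∧
      tsupport (fun w => (χ w - θ w) * φ w) ⊆ tsupport χ ∪ tsupport θ := by
    intro χ h1 h2 h3 h4
    have hsub : tsupport (fun w => χ w - θ w) ⊆ tsupport χ ∪ tsupport θ := by
      refine closure_minimal (fun z hz => ?_) ((isClosed_tsupport _).union (isClosed_tsupport _))
      by_contra hn
      rw [Set.mem_union, not_or] at hn
      exact hz (by simp [image_eq_zero_of_notMem_tsupport hn.1,
        image_eq_zero_of_notMem_tsupport hn.2])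
    have ht : tsupport (fun w => χ w - θ w) ⊆ D \ Z := by
      intro z hz
      refine ⟨(hsub hz).elim (fun h => h3 h) fun h => hSD (subset_closure (hθS h)), fun hzZ => ?_⟩
      refine notMem_tsupport_iff_eventuallyEq.2 ?_ hz
      filter_upwards [h4 z hzZ, hθ1 z hzZ] with w hw1 hw2
      simp [hw1, hw2]
    have hs2 : tsupport (fun w => (χ w - θ w) * φ w) ⊆ tsupport χ ∪ tsupport θ :=
      (tsupport_mul_subset_left (f := fun w => χ w - θ w)).trans hsub
    exact ⟨ht, contDiff_mul_of_tsupport hDZ (h1.sub hθ) hφ ht,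
      (h2.isCompact.union hθc.isCompact).of_isClosed_subset (isClosed_tsupport _) hs2, hs2⟩
  obtain ⟨ht1, hs1, hc1, -⟩ := key η hη hηc hηD fun z hz => hη1 z (subset_closure (hZS hz))
  obtain ⟨ht2, hs2, hc2, hsub2⟩ := key ψ hψ hψc hψD hψ1
  have hae : ∀ᵐ z, z ∉ S → z ∉ tsupport ψ ∪ tsupport θ := by
    filter_upwards [compl_mem_ae_iff.2 hψS] with z hz hzS
    rintro (h | h)
    · exact hz ⟨h, hzS⟩
    · exact hzS (hθS h)
  have h2 : ∫ w in S, dbar (fun w => (ψ w - θ w) * φ w) w = 0 := by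
    rw [← integral_dbar hs2 hc2]
    refine setIntegral_eq_integral_of_ae_compl_eq_zero ?_
    filter_upwards [hae] with z hz hzS
    refine dbar_eq_zero_of_const (a := 0) ?_
    exact notMem_tsupport_iff_eventuallyEq.1 fun h => hz hzS (hsub2 h)
  have h3 : ∫ w in S, -(dbar ψ w * φ w) = -∫ w, dbar ψ w * φ w := by
    rw [integral_neg]
    congr 1
    refine setIntegral_eq_integral_of_ae_compl_eq_zero ?_
    filter_upwards [hae] with z hz hzS
    rw [dbar_eq_zero_of_const (a := 0), zero_mul]
    exact notMem_tsupport_iff_eventuallyEq.1 fun h => hz hzS (Or.inl h)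
  have h1 : Γ.integral φ = Γ.integral fun w => (η w - θ w) * φ w := by
    rw [PlaneContour.integral, PlaneContour.integral]
    refine Finset.sum_congr rfl fun i _ => intervalIntegral.integral_congr fun t ht => ?_
    rw [Set.uIcc_of_le zero_le_one] at ht
    have hf := Γ.mem_frontier i ht
    have e1 := (hη1 _ hf.1).self_of_nhds
    have e2 : θ (Γ.γ i t) = 0 := by
      refine image_eq_zero_of_notMem_tsupport fun h => hf.2 ?_
      rw [Γ.isOpen.interior_eq]; exact hθS h
    simp [e1, e2]
  rw [h1, Γ.integral_eq_dbar hs1 hc1, neg_mul, ← mul_neg, ← h3]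
  congr 1
  have hi1 := ((continuous_dbar hs1).integrable_of_hasCompactSupport (μ := volume) hc1.dbar).integrableOn (s := S)
  have hi2 := ((continuous_dbar hs2).integrable_of_hasCompactSupport (μ := volume) hc2.dbar).integrableOn (s := S)
  rw [← sub_zero (∫ w in S, dbar (fun w => (η w - θ w) * φ w) w), ← h2, ← integral_sub hi1 hi2]
  refine setIntegral_congr_fun Γ.isOpen.measurableSet fun z hz => ?_
  have hηz := hη1 z (subset_closure hz)
  by_cases hzZ : z ∈ Z
  · have e : ∀ χ : ℂ → ℂ, tsupport (fun w => χ w - θ w) ⊆ D \ Z →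
        dbar (fun w => (χ w - θ w) * φ w) z = 0 := by
      intro χ hχ
      refine dbar_eq_zero_of_const (a := 0) ?_
      filter_upwards [notMem_tsupport_iff_eventuallyEq.1 fun h => (hχ h).2 hzZ] with w hw
      rw [hw]; simp
    simp only [e η ht1, e ψ ht2, dbar_eq_zero_of_const (hψ1 z hzZ)]
    simp
  · have hφd : DifferentiableAt ℝ φ z := (hφ.contDiffAt (hDZ.mem_nhds
      ⟨hSD (subset_closure hz), hzZ⟩)).differentiableAt one_ne_zero
    have hd : ∀ {χ : ℂ → ℂ}, ContDiff ℝ 1 χ → DifferentiableAt ℝ χ z := fun h =>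
      h.contDiffAt.differentiableAt one_ne_zero
    have e : ∀ χ : ℂ → ℂ, ContDiff ℝ 1 χ → dbar (fun w => (χ w - θ w) * φ w) z =
        (dbar χ z - dbar θ z) * φ z + (χ z - θ z) * dbar φ z := by
      intro χ hχ
      rw [dbar_mul (ψ := fun w => χ w - θ w) ((hd hχ).sub (hd hθ)) hφd, dbar_sub (hd hχ) (hd hθ)]
    simp only [e η hη, e ψ hψ, dbar_eq_zero_of_const hηz, hηz.self_of_nhds]
    by_cases h1 : ψ z = 1
    · rw [h1]; ring
    · rw [hhol z hz hzZ h1]; ring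

/-- The configuration of sets for the cutoff argument: `S` is the domain of integration, `D` the
domain of the functions, `Z` and `C` the sets of non-smooth and non-holomorphic points, and `O`
an open set differing from `S` by a null set. -/
structure CutoffSetting (S D Z C O : Set ℂ) : Prop where
  isOpen_D : IsOpen D
  closure_subset : closure S ⊆ D
  isOpen_O : IsOpen O
  subset_O : S ⊆ O
  O_subset : O ⊆ D
  volume_diff : MeasureTheory.volume (O \ S) = 0
  isCompact_Z : IsCompact Z
  Z_subset : Z ⊆ S
  isCompact_C : IsCompact C
  Z_subset_C : Z ⊆ C
  C_subset : C ⊆ O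

/-- Functions that are `C¹` off `Z` and holomorphic off `C`. -/
structure CutoffAdm (D Z C O : Set ℂ) (φ : ℂ → ℂ) : Prop where
  contDiffOn : ContDiffOn ℝ 1 φ (D \ Z)
  holo : ∀ z ∈ O \ C, DifferentiableAt ℂ φ z

namespace CutoffAdm

variable {D Z C O : Set ℂ} {φ ψ : ℂ → ℂ}

lemma mul (h1 : CutoffAdm D Z C O φ) (h2 : CutoffAdm D Z C O ψ) :
    CutoffAdm D Z C O fun z => φ z * ψ z :=
  ⟨h1.1.mul h2.1, fun z hz => (h1.2 z hz).mul (h2.2 z hz)⟩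

lemma of_differentiableOn (hD : IsOpen D) (hO : O ⊆ D) (h : DifferentiableOn ℂ φ D) :
    CutoffAdm D Z C O φ :=
  ⟨(((h.contDiffOn hD).restrict_scalars ℝ).mono Set.sdiff_subset),
    fun _ hz => h.differentiableAt (hD.mem_nhds (hO hz.1))⟩

end CutoffAdm

namespace CutoffSetting

variable {S D Z C O : Set ℂ} (h : CutoffSetting S D Z C O)

include h

lemma integral_eq (Γ : PlaneContour S) {φ ψ : ℂ → ℂ} (hφ : CutoffAdm D Z C O φ)
    (hψ : ContDiff ℝ 1 ψ) (hψc : HasCompactSupport ψ) (hψO : tsupport ψ ⊆ O)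
    (hψ1 : ∀ z ∈ C, ∀ᶠ w in nhds z, ψ w = 1) :
    Γ.integral φ = -Complex.I * ∫ w, dbar ψ w * φ w := by
  refine Γ.integral_eq_cutoff h.isOpen_D h.closure_subset h.isCompact_Z h.Z_subset hφ.contDiffOn hψ
    hψc (hψO.trans h.O_subset)
    (MeasureTheory.measure_mono_null (Set.sdiff_subset_sdiff_left hψO) h.volume_diff)
    (fun z hz => hψ1 z (h.Z_subset_C hz)) fun z hz _ hz1 => ?_
  exact dbar_eq_zero (hφ.holo z ⟨h.subset_O hz, fun hzC => hz1 (hψ1 z hzC).self_of_nhds⟩)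

omit h in
lemma mem_of_dbar_ne {ψ : ℂ → ℂ} (hψO : tsupport ψ ⊆ O)
    (hψ1 : ∀ z ∈ C, ∀ᶠ w in nhds z, ψ w = 1) {z : ℂ} (hz : z ∈ tsupport (dbar ψ)) : z ∈ O \ C := by
  refine ⟨hψO ?_, fun hC => ?_⟩
  · by_contra hn
    refine notMem_tsupport_iff_eventuallyEq.2 ?_ hz
    filter_upwards [(notMem_tsupport_iff_eventuallyEq.1 hn).eventuallyEq_nhds] with w hw
    exact dbar_eq_zero_of_const (a := 0) hw
  · refine notMem_tsupport_iff_eventuallyEq.2 ?_ hz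
    filter_upwards [(hψ1 z hC).eventually_nhds] with w hw
    exact dbar_eq_zero_of_const hw

lemma integral_congr (Γ Γ' : PlaneContour S) {φ φ' : ℂ → ℂ} (hφ : CutoffAdm D Z C O φ)
    (hφ' : CutoffAdm D Z C O φ') (heq : ∀ z ∈ O \ C, φ z = φ' z) :
    Γ.integral φ = Γ'.integral φ' := by
  obtain ⟨ψ, h1, h2, h3, h4⟩ := exists_cutoff h.isCompact_C h.isOpen_O h.C_subset
  rw [h.integral_eq Γ hφ h1 h2 h3 h4, h.integral_eq Γ' hφ' h1 h2 h3 h4]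
  congr 2
  ext w
  by_cases hw : w ∈ tsupport (dbar ψ)
  · rw [heq w (mem_of_dbar_ne h3 h4 hw)]
  · rw [image_eq_zero_of_notMem_tsupport hw, zero_mul, zero_mul]

omit h in
lemma integrable_dbar_mul {ψ φ : ℂ → ℂ} {W : Set ℂ} (hW : IsOpen W) (hψ : ContDiff ℝ 1 ψ)
    (hψc : HasCompactSupport ψ) (hφ : ContinuousOn φ W) (hs : tsupport (dbar ψ) ⊆ W) :
    MeasureTheory.Integrable fun w => dbar ψ w * φ w := by
  refine Continuous.integrable_of_hasCompactSupport ?_ (hψc.dbar.mul_right)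
  refine continuous_iff_continuousAt.2 fun z => ?_
  by_cases hz : z ∈ tsupport (dbar ψ)
  · exact (continuous_dbar hψ).continuousAt.mul (hφ.continuousAt (hW.mem_nhds (hs hz)))
  · refine (continuousAt_const (y := (0 : ℂ))).congr ?_
    filter_upwards [notMem_tsupport_iff_eventuallyEq.1 hz] with w hw
    simp [hw]

open MeasureTheory in
/-- The product rule of the functional calculus, for scalar functions: a resolvent equation for the
kernel turns a product of contour integrals into a single one. -/
theorem integral_mul_integral (Γa Γb Γc : PlaneContour S) {F G K B : ℂ → ℂ} {E : ℂ → ℂ → ℂ}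
    (hF : DifferentiableOn ℂ F D) (hG : DifferentiableOn ℂ G D)
    (hK : CutoffAdm D Z C O K) (hB : CutoffAdm D Z C O B)
    (hE : ∀ s ∈ O \ C, CutoffAdm D Z C O (E s))
    (hKE : ∀ s ∈ O \ C, K s = -Complex.I / (2 * Real.pi) * Γb.integral fun t => G t * E s t)
    (hres : ∀ s ∈ O \ C, ∀ t ∈ O \ C, (t - s) * E s t = B s - B t) :
    Γa.integral (fun z => F z * K z) = Γc.integral fun z => F z * G z * B z := by
  have hpi : (2 * Real.pi : ℂ) ≠ 0 := by
    exact_mod_cast (mul_pos two_pos Real.pi_pos).ne'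
  obtain ⟨ψ, h1, h2, h3, h4⟩ := exists_cutoff h.isCompact_C h.isOpen_O h.C_subset
  obtain ⟨χ, k1, k2, k3, k4⟩ := exists_cutoff h2.isCompact h.isOpen_O h3
  have hCψ : ∀ z ∈ C, z ∈ tsupport ψ := fun z hz => subset_tsupport ψ (by
    rw [Function.mem_support, (h4 z hz).self_of_nhds]; exact one_ne_zero)
  have k4' : ∀ z ∈ C, ∀ᶠ w in nhds z, χ w = 1 := fun z hz => k4 z (hCψ z hz)
  have hFa := CutoffAdm.of_differentiableOn (Z := Z) (C := C) h.isOpen_D h.O_subset hF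
  have hGa := CutoffAdm.of_differentiableOn (Z := Z) (C := C) h.isOpen_D h.O_subset hG
  have hDZ : IsOpen (D \ Z) := h.isOpen_D.sdiff h.isCompact_Z.isClosed
  have hmemψ : ∀ z ∈ tsupport (dbar ψ), z ∈ O \ C := fun z hz => mem_of_dbar_ne h3 h4 hz
  have hmemχ : ∀ z ∈ tsupport (dbar χ), z ∈ O \ C := fun z hz => mem_of_dbar_ne k3 k4' hz
  have hmemχψ : ∀ z ∈ tsupport (dbar χ), z ∉ tsupport ψ := fun z hz hψ =>
    (mem_of_dbar_ne k3 k4 hz).2 hψ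
  have hsubψ : tsupport (dbar ψ) ⊆ tsupport ψ := fun z hz => by
    by_contra hn
    exact (mem_of_dbar_ne (C := ∅) (subset_refl (tsupport ψ)) (by simp) hz).1 |> hn
  have hOC : O \ C ⊆ D \ Z := fun z hz => ⟨h.O_subset hz.1, fun hZ => hz.2 (h.Z_subset_C hZ)⟩
  have hi : ∀ {ρ φ : ℂ → ℂ}, ContDiff ℝ 1 ρ → HasCompactSupport ρ →
      (∀ z ∈ tsupport (dbar ρ), z ∈ O \ C) → CutoffAdm D Z C O φ →
      Integrable fun w => dbar ρ w * φ w := fun a b c d =>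
    integrable_dbar_mul hDZ a b d.contDiffOn.continuousOn fun z hz => hOC (c z hz)
  have pomp : ∀ {ρ φ : ℂ → ℂ}, ContDiff ℝ 1 ρ → HasCompactSupport ρ → tsupport ρ ⊆ O →
      DifferentiableOn ℂ φ D → ∀ z, ∫ w, dbar ρ w * φ w * (z - w)⁻¹ =
        2 * Real.pi * (ρ z * φ z) := by
    intro ρ φ a b c d z
    have hc1 : ContDiff ℝ 1 fun w => ρ w * φ w := contDiff_mul_of_tsupport h.isOpen_D a
      ((d.contDiffOn h.isOpen_D).restrict_scalars ℝ) (c.trans h.O_subset)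
    rw [← integral_dbar_mul_inv hc1 (b.mul_right)]
    congr 1
    ext w
    congr 1
    by_cases hw : w ∈ tsupport ρ
    · have hd := d.differentiableAt (h.isOpen_D.mem_nhds (h.O_subset (c hw)))
      rw [dbar_mul (a.contDiffAt.differentiableAt one_ne_zero) (hd.restrictScalars ℝ),
        dbar_eq_zero hd]
      ring
    · have hw := notMem_tsupport_iff_eventuallyEq.1 hw
      rw [dbar_eq_zero_of_const (a := 0) hw, zero_mul, eq_comm]
      refine dbar_eq_zero_of_const (a := 0) ?_
      filter_upwards [hw] with x hx
      rw [hx]; simp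
  -- the inner integral
  have hinner : ∀ s ∈ tsupport (dbar ψ), (Γb.integral fun t => G t * E s t) =
      -Complex.I * (-(2 * Real.pi) * (G s * B s) -
        ∫ t, dbar χ t * (G t * B t) * (t - s)⁻¹) := by
    intro s hs
    rw [h.integral_eq Γb (hGa.mul (hE s (hmemψ s hs))) k1 k2 k3 k4']
    congr 1
    have e1 : ∀ t, dbar χ t * (G t * E s t) =
        (-B s) * (dbar χ t * G t * (s - t)⁻¹) - dbar χ t * (G t * B t) * (t - s)⁻¹ := by
      intro t
      by_cases ht : t ∈ tsupport (dbar χ)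
      · have hne : t - s ≠ 0 := by
          intro h0
          rw [sub_eq_zero] at h0
          exact hmemχψ t ht (h0 ▸ hsubψ hs)
        have := hres s (hmemψ s hs) t (hmemχ t ht)
        have h5 : E s t = (B s - B t) / (t - s) := by
          rw [eq_div_iff hne, ← this]; ring
        rw [h5, ← neg_sub t s, inv_neg]
        field_simp
      · rw [image_eq_zero_of_notMem_tsupport ht]; ring
    have hbd : ∀ φ : ℂ → ℂ, CutoffAdm D Z C O φ →
        Integrable fun t => dbar χ t * φ t * (t - s)⁻¹ := by
      intro φ hφ
      have := integrable_dbar_mul (W := (D \ Z) \ {s}) (φ := fun t => φ t * (t - s)⁻¹)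
        (hDZ.sdiff isClosed_singleton) k1 k2 ?_ ?_
      · simpa only [mul_assoc] using this
      · refine (hφ.contDiffOn.continuousOn.mono Set.sdiff_subset).mul (ContinuousOn.inv₀ (by fun_prop)
          fun t ht => sub_ne_zero.2 ht.2)
      · exact fun t ht => ⟨hOC (hmemχ t ht), fun h0 => hmemχψ t ht (by
          rw [Set.mem_singleton_iff.1 h0]; exact hsubψ hs)⟩
    have hi1 : Integrable fun t => dbar χ t * G t * (s - t)⁻¹ := by
      refine (hbd G hGa).neg.congr (Filter.Eventually.of_forall fun t => ?_)
      simp only [Pi.neg_apply]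
      rw [← neg_sub t s, inv_neg]; ring
    simp only [e1]
    rw [integral_sub (hi1.const_mul _) (hbd _ (hGa.mul hB)), integral_const_mul,
      pomp k1 k2 k3 hG, (k4 s (hsubψ hs)).self_of_nhds]
    ring
  -- the mixed term vanishes
  have hmix : ∫ s, ∫ t, dbar ψ s * F s * (dbar χ t * (G t * B t)) * (t - s)⁻¹ = 0 := by
    have hKψ : IsCompact (tsupport (dbar ψ)) := h2.dbar.isCompact
    have hKχ : IsCompact (tsupport (dbar χ)) := k2.dbar.isCompact
    obtain ⟨δ, hδ, hδ'⟩ : ∃ δ > (0 : ℝ), ∀ s ∈ tsupport (dbar ψ), ∀ t ∈ tsupport (dbar χ),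
        δ ≤ ‖t - s‖ := by
      have hdisj : Disjoint (tsupport (dbar ψ)) (tsupport (dbar χ)) :=
        Set.disjoint_left.2 fun z hz hz' => hmemχψ z hz' (hsubψ hz)
      obtain ⟨r, hr, hr'⟩ := Metric.exists_pos_forall_lt_edist hKψ hKχ.isClosed hdisj
      refine ⟨r, by exact_mod_cast hr, fun s hs t ht => ?_⟩
      have := hr' s hs t ht
      rw [edist_comm, edist_nndist] at this
      have h6 : r < nndist t s := by exact_mod_cast this
      rw [← dist_eq_norm]
      exact_mod_cast h6.le
    have hInt : Integrable (Function.uncurry fun s t =>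
        dbar ψ s * F s * (dbar χ t * (G t * B t)) * (t - s)⁻¹) (volume.prod volume) := by
      have hp := (hi h1 h2 hmemψ hFa).mul_prod (hi k1 k2 hmemχ (hGa.mul hB))
      refine (hp.norm.mul_const δ⁻¹).mono' ?_ (Filter.Eventually.of_forall fun ⟨s, t⟩ => ?_)
      · exact hp.aestronglyMeasurable.mul
          (by fun_prop : Measurable fun p : ℂ × ℂ => (p.2 - p.1)⁻¹).aestronglyMeasurable
      · simp only [Function.uncurry]
        rw [norm_mul, norm_inv]
        by_cases hs : s ∈ tsupport (dbar ψ)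
        · by_cases ht : t ∈ tsupport (dbar χ)
          · have := hδ' s hs t ht
            gcongr
          · rw [image_eq_zero_of_notMem_tsupport ht]; simp
        · rw [image_eq_zero_of_notMem_tsupport hs]; simp
    rw [integral_integral_swap hInt]
    refine integral_eq_zero_of_ae (Filter.Eventually.of_forall fun t => ?_)
    have : ∀ s, dbar ψ s * F s * (dbar χ t * (G t * B t)) * (t - s)⁻¹ =
        (dbar χ t * (G t * B t)) * (dbar ψ s * F s * (t - s)⁻¹) := fun s => by ring
    simp only [this]
    rw [integral_const_mul, pomp h1 h2 h3 hF]
    by_cases ht : t ∈ tsupport (dbar χ)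
    · rw [image_eq_zero_of_notMem_tsupport (hmemχψ t ht)]; simp
    · rw [image_eq_zero_of_notMem_tsupport ht]; simp
  rw [h.integral_eq Γa (hFa.mul hK) h1 h2 h3 h4,
    h.integral_eq Γc ((hFa.mul hGa).mul hB) h1 h2 h3 h4]
  congr 1
  set M : ℂ → ℂ := fun s => ∫ t, dbar ψ s * F s * (dbar χ t * (G t * B t)) * (t - s)⁻¹ with hM
  have e2 : ∀ s, dbar ψ s * (F s * K s) =
      dbar ψ s * (F s * G s * B s) + (2 * Real.pi : ℂ)⁻¹ * M s := by
    intro s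
    by_cases hs : s ∈ tsupport (dbar ψ)
    · have : M s = dbar ψ s * F s * ∫ t, dbar χ t * (G t * B t) * (t - s)⁻¹ := by
        rw [hM, ← integral_const_mul]
        simp only [mul_assoc]
      rw [this, hKE s (hmemψ s hs), hinner s hs]
      generalize ∫ t, dbar χ t * (G t * B t) * (t - s)⁻¹ = X
      field_simp
      linear_combination (dbar ψ s * F s * (-(2 * Real.pi * (G s * B s)) - X)) * Complex.I_sq
    · simp [hM, image_eq_zero_of_notMem_tsupport hs]
  have hi3 := hi h1 h2 hmemψ ((hFa.mul hGa).mul hB)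
  have hi4 := hi h1 h2 hmemψ (hFa.mul hK)
  have hMi : Integrable fun s => (2 * Real.pi : ℂ)⁻¹ * M s := by
    refine (hi4.sub hi3).congr (Filter.Eventually.of_forall fun s => ?_)
    simp only [Pi.sub_apply, e2]; ring
  simp only [e2]
  rw [integral_add hi3 hMi, integral_const_mul, hmix, mul_zero, add_zero]

end CutoffSetting

section SliceResolvent

variable {A : Type*} [NormedRing A] [NormedAlgebra ℝ A]

/-- The operator `R_z - T`, where `R_{x+iy} = x + yK`. -/
def slicePencil (K T : A) (z : ℂ) : A := z.re • 1 + z.im • K - T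

/-- The resolvent `(R_z - T)⁻¹`. -/
def sliceRes (K T : A) (z : ℂ) : A := Ring.inverse (slicePencil K T z)

/-- The points at which all powers of the resolvent commute with `K` on `e`. -/
def commSet (K T e : A) : Set ℂ :=
  {z | IsUnit (slicePencil K T z) ∧ ∀ n : ℕ, sliceRes K T z ^ n * K * e = K * sliceRes K T z ^ n * e}

/-- The elements on which all powers of `p` commute with `K`. -/
def powComm (K p : A) : Submodule ℝ A where
  carrier := {w | ∀ n : ℕ, p ^ n * K * w = K * p ^ n * w}
  add_mem' := fun ha hb n => by rw [mul_add, mul_add, ha n, hb n]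
  zero_mem' := fun n => by rw [mul_zero, mul_zero]
  smul_mem' := fun c x hx n => by rw [mul_smul_comm, mul_smul_comm, hx n]

lemma isClosed_powComm (K p : A) : IsClosed (powComm K p : Set A) := by
  have : (powComm K p : Set A) = ⋂ n : ℕ, {w | p ^ n * K * w = K * p ^ n * w} := by
    ext w; simp [powComm]
  rw [this]
  exact isClosed_iInter fun n => isClosed_eq (by fun_prop) (by fun_prop)

lemma mul_mem_powComm {K p w : A} (hw : w ∈ powComm K p) : p * w ∈ powComm K p := by
  intro n
  have h1 := hw 1
  have h2 := hw (n + 1)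
  rw [pow_one] at h1
  calc p ^ n * K * (p * w) = p ^ n * (K * p * w) := by simp only [mul_assoc]
    _ = p ^ (n + 1) * K * w := by rw [← h1, pow_succ]; simp only [mul_assoc]
    _ = K * p ^ n * (p * w) := by rw [h2, pow_succ]; simp only [mul_assoc]

lemma mul_left_mem_powComm {K p w : A} (hK : K * K = -1) (hw : w ∈ powComm K p) :
    K * w ∈ powComm K p := by
  intro n
  calc p ^ n * K * (K * w) = p ^ n * (K * K) * w := by simp only [mul_assoc]
    _ = K * K * p ^ n * w := by rw [hK]; simp
    _ = K * (K * p ^ n * w) := by simp only [mul_assoc]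
    _ = K * (p ^ n * K * w) := by rw [hw n]
    _ = K * p ^ n * (K * w) := by simp only [mul_assoc]

lemma smul_add_mul_mem_powComm {K p w : A} (hK : K * K = -1) (hw : w ∈ powComm K p) (a b : ℝ) :
    (a • 1 + b • K) * w ∈ powComm K p := by
  rw [add_mul, smul_mul_assoc, smul_mul_assoc, one_mul]
  exact add_mem (Submodule.smul_mem _ _ hw)
    (Submodule.smul_mem _ _ (mul_left_mem_powComm hK hw))

lemma slicePencil_add (K T : A) (z h : ℂ) :
    slicePencil K T (z + h) = (h.re • 1 + h.im • K) + slicePencil K T z := by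
  simp only [slicePencil, Complex.add_re, Complex.add_im, add_smul]; abel

lemma slicePencil_mul_sliceRes {K T : A} {z : ℂ} (h : IsUnit (slicePencil K T z)) :
    slicePencil K T z * sliceRes K T z = 1 := Ring.mul_inverse_cancel _ h

lemma sliceRes_mul_slicePencil {K T : A} {z : ℂ} (h : IsUnit (slicePencil K T z)) :
    sliceRes K T z * slicePencil K T z = 1 := Ring.inverse_mul_cancel _ h

lemma continuous_slicePencil (K T : A) : Continuous (slicePencil K T) := by
  unfold slicePencil
  exact (((Complex.continuous_re.smul continuous_const).add
    (Complex.continuous_im.smul continuous_const)).sub continuous_const)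

variable [CompleteSpace A]

lemma inverse_one_sub_mul_mem (M : Submodule ℝ A) (hM : IsClosed (M : Set A)) {x : A}
    (hx : ‖x‖ < 1) (hxM : ∀ w ∈ M, x * w ∈ M) {w : A} (hw : w ∈ M) :
    Ring.inverse (1 - x) * w ∈ M := by
  have hpow : ∀ n : ℕ, x ^ n * w ∈ M := by
    intro n
    induction n with
    | zero => simpa using hw
    | succ n ih => rw [pow_succ', mul_assoc]; exact hxM _ ih
  have hs := (_root_.summable_geometric_of_norm_lt_one hx).hasSum.mul_right w
  have : Ring.inverse (1 - x) = ∑' n : ℕ, x ^ n := by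
    rw [NormedRing.inverse_one_sub x hx]; rfl
  rw [this]
  refine hM.mem_of_tendsto hs (Filter.Eventually.of_forall fun s => ?_)
  exact Submodule.sum_mem _ fun n _ => hpow n

lemma isOpen_isUnit_slicePencil (K T : A) : IsOpen {z | IsUnit (slicePencil K T z)} :=
  Units.isOpen.preimage (continuous_slicePencil K T)

lemma continuousAt_sliceRes {K T : A} {z : ℂ} (h : IsUnit (slicePencil K T z)) :
    ContinuousAt (sliceRes K T) z := by
  obtain ⟨u, hu⟩ := h
  have h1 : ContinuousAt Ring.inverse (slicePencil K T z) := hu ▸ NormedRing.inverse_continuousAt u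
  exact ContinuousAt.comp (f := slicePencil K T) h1 (continuous_slicePencil K T).continuousAt

lemma commSet_add_mem {K T e : A} (hK : K * K = -1) {z h : ℂ} (hz : z ∈ commSet K T e)
    (hh : ‖sliceRes K T z * (h.re • 1 + h.im • K)‖ < 1) : z + h ∈ commSet K T e := by
  obtain ⟨hu, hc⟩ := hz
  set P := sliceRes K T z with hP
  set R : A := h.re • 1 + h.im • K with hR
  have hRK : R * K = K * R := by
    simp only [hR, add_mul, mul_add, smul_mul_assoc, mul_smul_comm, one_mul, mul_one]
  have hunit : IsUnit (1 + P * R) := by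
    have := (Units.oneSub (-(P * R)) (by rwa [norm_neg])).isUnit
    simpa using this
  have hfac : slicePencil K T (z + h) = slicePencil K T z * (1 + P * R) := by
    rw [slicePencil_add, mul_add, mul_one, ← mul_assoc, slicePencil_mul_sliceRes hu, one_mul,
      add_comm]
  have hu' : IsUnit (slicePencil K T (z + h)) := hfac ▸ hu.mul hunit
  have hQ : sliceRes K T (z + h) = Ring.inverse (1 - -(P * R)) * P := by
    obtain ⟨u, hu⟩ := hu
    obtain ⟨v, hv⟩ := hunit
    rw [sub_neg_eq_add, ← hv, hP, sliceRes, sliceRes, hfac, ← hv, ← hu,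
      ← Units.val_mul, Ring.inverse_unit, Ring.inverse_unit, Ring.inverse_unit, mul_inv_rev,
      Units.val_mul]
  set Q := sliceRes K T (z + h) with hQdef
  have hQmem : ∀ w ∈ powComm K P, Q * w ∈ powComm K P := by
    intro w hw
    rw [hQ, mul_assoc]
    refine inverse_one_sub_mul_mem _ (isClosed_powComm K P) (by rwa [norm_neg])
      (fun w hw => ?_) (mul_mem_powComm hw)
    rw [neg_mul, mul_assoc]
    exact neg_mem (mul_mem_powComm (smul_add_mul_mem_powComm hK hw _ _))
  have hQcomm : ∀ w ∈ powComm K P, Q * (K * w) = K * (Q * w) := by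
    intro w hw
    have hy := hQmem w hw
    set y := Q * w with hyd
    have hy1 : slicePencil K T (z + h) * y = w := by
      rw [hyd, ← mul_assoc, slicePencil_mul_sliceRes hu', one_mul]
    have hu1 : w - R * y ∈ powComm K P := sub_mem hw (smul_add_mul_mem_powComm hK hy _ _)
    have hy2 : slicePencil K T z * y = w - R * y := by
      rw [eq_sub_iff_add_eq, ← hy1, slicePencil_add, ← hR, add_mul R, add_comm]
    have hy3 : P * (w - R * y) = y := by
      rw [← hy2, ← mul_assoc, sliceRes_mul_slicePencil hu, one_mul]
    have hy4 := hu1 1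
    rw [pow_one, mul_assoc, mul_assoc, hy3] at hy4
    have hy5 : slicePencil K T (z + h) * (K * y) = K * w := by
      rw [slicePencil_add, add_mul, ← hy4, ← mul_assoc (slicePencil K T z),
        slicePencil_mul_sliceRes hu, one_mul, hy4, ← mul_assoc, hRK, mul_sub, ← mul_assoc K R y]
      abel
    rw [← hy5, ← mul_assoc, sliceRes_mul_slicePencil hu', one_mul]
  refine ⟨hu', ?_⟩
  have key : ∀ n : ℕ, Q ^ n * e ∈ powComm K P ∧ Q ^ n * K * e = K * Q ^ n * e := by
    intro n
    induction n with
    | zero => exact ⟨by simpa using! hc, by simp⟩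
    | succ n ih =>
      refine ⟨by rw [pow_succ', mul_assoc]; exact hQmem _ ih.1, ?_⟩
      rw [pow_succ', mul_assoc, mul_assoc, ← mul_assoc (Q ^ n), ih.2, mul_assoc K,
        hQcomm _ ih.1]
      simp only [mul_assoc]
  exact fun n => (key n).2

lemma isOpen_commSet {K T e : A} (hK : K * K = -1) : IsOpen (commSet K T e) := by
  rw [isOpen_iff_mem_nhds]
  intro z hz
  have hc : Continuous fun w : ℂ => ‖sliceRes K T z * ((w - z).re • 1 + (w - z).im • K)‖ := by
    have h1 : Continuous fun w : ℂ => (w - z).re := by fun_prop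
    have h2 : Continuous fun w : ℂ => (w - z).im := by fun_prop
    fun_prop
  have : ∀ᶠ w in nhds z, ‖sliceRes K T z * ((w - z).re • 1 + (w - z).im • K)‖ < 1 := by
    refine hc.continuousAt.eventually_lt continuousAt_const ?_
    simp
  filter_upwards [this] with w hw
  simpa using commSet_add_mem hK hz hw

lemma mem_commSet_of_mem_closure {K T e : A} {z : ℂ} (hz : z ∈ closure (commSet K T e))
    (hu : IsUnit (slicePencil K T z)) : z ∈ commSet K T e := by
  refine ⟨hu, fun n => ?_⟩
  have hP := continuousAt_sliceRes hu
  have h1 : ContinuousAt (fun w => sliceRes K T w ^ n * K * e) z := by fun_prop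
  have h2 : ContinuousAt (fun w => K * sliceRes K T w ^ n * e) z := by fun_prop
  have hne : (nhdsWithin z (commSet K T e)).NeBot := mem_closure_iff_nhdsWithin_neBot.1 hz
  refine tendsto_nhds_unique (l := nhdsWithin z (commSet K T e)) (h1.tendsto.mono_left nhdsWithin_le_nhds)
    ((h2.tendsto.mono_left nhdsWithin_le_nhds).congr' ?_)
  filter_upwards [self_mem_nhdsWithin] with w hw
  exact (hw.2 n).symm

lemma hasFDerivAt_sliceRes {K T : A} {z : ℂ} (h : IsUnit (slicePencil K T z)) :
    HasFDerivAt (sliceRes K T)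
      (-((ContinuousLinearMap.mulLeftRight ℝ A (sliceRes K T z) (sliceRes K T z)).comp
        (Complex.reCLM.smulRight (1 : A) + Complex.imCLM.smulRight K))) z := by
  have h1 : HasFDerivAt (slicePencil K T)
      (Complex.reCLM.smulRight (1 : A) + Complex.imCLM.smulRight K) z :=
    ((Complex.reCLM.smulRight (1 : A) + Complex.imCLM.smulRight K).hasFDerivAt).sub_const T
  obtain ⟨u, hu⟩ := h
  have h2 := hasFDerivAt_ringInverse (𝕜 := ℝ) u
  have h3 : (sliceRes K T z) = ↑u⁻¹ := by rw [sliceRes, ← hu, Ring.inverse_unit]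
  rw [h3, ← ContinuousLinearMap.neg_comp]
  rw [hu] at h2
  exact h2.comp z h1

lemma contDiffAt_sliceRes {K T : A} {z : ℂ} (h : IsUnit (slicePencil K T z)) :
    ContDiffAt ℝ 1 (sliceRes K T) z := by
  obtain ⟨u, hu⟩ := h
  have h1 : ContDiff ℝ 1 (slicePencil K T) :=
    (Complex.reCLM.smulRight (1 : A) + Complex.imCLM.smulRight K).contDiff.sub contDiff_const
  have h2 : ContDiffAt ℝ 1 Ring.inverse (slicePencil K T z) := hu ▸ contDiffAt_ringInverse ℝ u
  exact h2.comp z h1.contDiffAt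

/-- If `Θ` intertwines `K` with `i`, then `z ↦ Θ ((R_z - T)⁻¹ e)` is holomorphic where the
resolvent commutes with `K` on `e`. -/
lemma differentiableAt_sliceRes {K T e : A} {z : ℂ} (hz : z ∈ commSet K T e)
    (Θ : A →L[ℝ] ℂ) (hΘ : ∀ x, Θ (K * x) = Complex.I * Θ x) :
    DifferentiableAt ℂ (fun w => Θ (sliceRes K T w * e)) z := by
  set P := sliceRes K T z with hP
  have h1 : HasFDerivAt (fun w => Θ (sliceRes K T w * e)) _ z :=
    (Θ.comp ((ContinuousLinearMap.mul ℝ A).flip e)).hasFDerivAt.comp z (hasFDerivAt_sliceRes hz.1)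
  have hc := hz.2 1
  rw [pow_one, ← hP] at hc
  have h2 : HasFDerivAt (𝕜 := ℂ) (fun w => Θ (sliceRes K T w * e))
      ((-Θ (P * P * e)) • (1 : ℂ →L[ℂ] ℂ)) z := by
    refine hasFDerivAt_of_restrictScalars ℝ h1 ?_
    ext1 h
    have e1 : P * K * P * e = K * P * P * e := by
      have h2 := hz.2 2
      rw [← hP, pow_two, mul_assoc P P K, mul_assoc P, hc, ← mul_assoc K P P] at h2
      simpa only [mul_assoc] using h2
    have e2 : P * (h.re • 1 + h.im • K) * P * e = h.re • (P * P * e) + h.im • (K * (P * P * e)) := by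
      simp only [mul_add, add_mul, mul_smul_comm, smul_mul_assoc, mul_one, e1]
      simp only [mul_assoc]
    show (-Θ (P * P * e)) * h = Θ (-(P * (h.re • 1 + h.im • K) * P) * e)
    rw [neg_mul (P * _ * P), e2, map_neg, map_add, map_smul, map_smul, hΘ, Complex.real_smul,
      Complex.real_smul]
    conv_lhs => rw [← Complex.re_add_im h]
    ring
  exact h2.differentiableAt

section Opposite

open MulOpposite

omit [CompleteSpace A] in
lemma slicePencil_op (K T : A) (z : ℂ) :
    slicePencil (op K) (op T) z = op (slicePencil K T z) := rfl

omit [CompleteSpace A] in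
lemma sliceRes_op (K T : A) (z : ℂ) : sliceRes (op K) (op T) z = op (sliceRes K T z) := by
  rw [sliceRes, sliceRes, slicePencil_op]
  by_cases h : IsUnit (slicePencil K T z)
  · obtain ⟨u, hu⟩ := h
    have h1 : op (slicePencil K T z) = ((Units.opEquiv.symm (op u) : (Aᵐᵒᵖ)ˣ) : Aᵐᵒᵖ) := by
      rw [Units.coe_opEquiv_symm, ← hu]; rfl
    rw [h1, Ring.inverse_unit, ← hu, Ring.inverse_unit]
    rfl
  · rw [Ring.inverse_non_unit _ h, Ring.inverse_non_unit, op_zero]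
    simpa using h

/-- The points at which all powers of the resolvent commute with `K` after `e`. -/
def commSetOp (K T e : A) : Set ℂ :=
  {z | IsUnit (slicePencil K T z) ∧ ∀ n : ℕ, e * sliceRes K T z ^ n * K = e * K * sliceRes K T z ^ n}

omit [CompleteSpace A] in
lemma commSetOp_eq (K T e : A) : commSetOp K T e = commSet (op K) (op T) (op e) := by
  ext z
  simp only [commSetOp, commSet, Set.mem_ofPred_eq, slicePencil_op, sliceRes_op, isUnit_op,
    ← op_pow, ← op_mul, op_inj, mul_assoc]
  exact and_congr_right fun _ => forall_congr' fun n => eq_comm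

lemma isOpen_commSetOp {K T e : A} (hK : K * K = -1) : IsOpen (commSetOp K T e) := by
  rw [commSetOp_eq]
  exact isOpen_commSet (by rw [← op_mul, hK, op_neg, op_one])

lemma mem_commSetOp_of_mem_closure {K T e : A} {z : ℂ} (hz : z ∈ closure (commSetOp K T e))
    (hu : IsUnit (slicePencil K T z)) : z ∈ commSetOp K T e := by
  rw [commSetOp_eq] at *
  exact mem_commSet_of_mem_closure hz (by rwa [slicePencil_op, isUnit_op])

lemma differentiableAt_sliceRes_op {K T e : A} {z : ℂ} (hz : z ∈ commSetOp K T e)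
    (Θ : A →L[ℝ] ℂ) (hΘ : ∀ x, Θ (x * K) = Complex.I * Θ x) :
    DifferentiableAt ℂ (fun w => Θ (e * sliceRes K T w)) z := by
  rw [commSetOp_eq] at hz
  have h := differentiableAt_sliceRes hz
    (Θ.comp (opContinuousLinearEquiv ℝ : A ≃L[ℝ] Aᵐᵒᵖ).symm.toContinuousLinearMap)
    (fun x => hΘ (unop x))
  simpa only [sliceRes_op] using! h

end Opposite

end SliceResolvent

section SliceGeometry

namespace Oct

lemma continuous_re : Continuous re := by
  let f : Oct →ₗ[ℝ] ℝ := ⟨⟨re, re_add⟩, re_smul⟩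
  exact f.continuous_of_finiteDimensional

lemma continuous_toSlice (J : Oct) : Continuous (toSlice J) := by
  unfold toSlice; fun_prop

lemma re_toSlice {J : Oct} (hJ : J ∈ unitSphere) (z : ℂ) : re (toSlice J z) = z.re := by
  simp [toSlice, re_add, re_smul, re_one, re_of_mem_unitSphere hJ]

/-- The coordinate of an octonion in the closed upper half plane. -/
def upper (w : Oct) : ℂ := ⟨re w, ‖w - re w • (1 : Oct)‖⟩

lemma continuous_upper : Continuous upper := by
  have h1 := continuous_re
  have h2 : Continuous fun w : Oct => ‖w - re w • (1 : Oct)‖ := by fun_prop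
  exact Complex.equivRealProdCLM.symm.continuous.comp (h1.prodMk h2)

lemma upper_toSlice {J : Oct} (hJ : J ∈ unitSphere) (z : ℂ) :
    upper (toSlice J z) = ⟨z.re, |z.im|⟩ := by
  rw [upper, re_toSlice hJ, toSlice, add_sub_cancel_left, norm_smul, norm_of_mem_unitSphere hJ,
    mul_one, Real.norm_eq_abs]

lemma exists_toSlice_upper {J : Oct} (hJ : J ∈ unitSphere) (w : Oct) :
    ∃ I ∈ unitSphere, toSlice I (upper w) = w := by
  set v := w - re w • (1 : Oct) with hv
  have hre : re v = 0 := by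
    rw [hv, sub_eq_add_neg, ← neg_smul, re_add, re_smul, re_one]; ring
  by_cases h : ‖v‖ = 0
  · refine ⟨J, hJ, ?_⟩
    rw [norm_eq_zero] at h
    rw [toSlice, upper, ← hv, h, norm_zero, zero_smul, add_zero]
    exact (sub_eq_zero.1 h).symm
  · refine ⟨‖v‖⁻¹ • v, mem_unitSphere_of (by rw [re_smul, hre, mul_zero]) ?_, ?_⟩
    · rw [norm_smul, norm_inv, norm_norm, inv_mul_cancel₀ h]
    · rw [toSlice, upper, ← hv, smul_smul, mul_inv_cancel₀ h, one_smul, hv]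
      abel

lemma toSlice_conj (J : Oct) (z : ℂ) :
    toSlice J ((starRingEnd ℂ) z) = toSlice (-J) z := by
  simp [toSlice]

lemma neg_mem_unitSphere {J : Oct} (hJ : J ∈ unitSphere) : -J ∈ unitSphere :=
  mem_unitSphere_of (by rw [re_neg, re_of_mem_unitSphere hJ, neg_zero])
    (by rw [norm_neg, norm_of_mem_unitSphere hJ])

lemma eq_or_conj_of_toSlice_eq {I J : Oct} (hI : I ∈ unitSphere) (hJ : J ∈ unitSphere) {w z : ℂ}
    (h : toSlice I w = toSlice J z) : z = w ∨ z = (starRingEnd ℂ) w := by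
  have h1 := congrArg upper h
  rw [upper_toSlice hI, upper_toSlice hJ, Complex.mk.injEq] at h1
  rcases abs_eq_abs.1 h1.2 with h2 | h2
  · exact Or.inl (Complex.ext h1.1.symm h2.symm)
  · refine Or.inr (Complex.ext h1.1.symm ?_)
    rw [Complex.conj_im, h2, neg_neg]

end Oct

lemma IsAdmissibleDomain.mem_closure {U : Set Oct} (hU : IsAdmissibleDomain U) {J : Oct}
    (hJ : J ∈ unitSphere) {z : ℂ} (hz : toSlice J z ∈ closure U) :
    z ∈ closure (toSlice J ⁻¹' U) := by
  have h1 : ∀ w ∈ U, upper w ∈ toSlice J ⁻¹' U := fun w hw => by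
    obtain ⟨I, hI, hIw⟩ := exists_toSlice_upper hJ w
    exact hU.axially _ I hI J hJ (hIw.symm ▸ hw)
  have h2 : ∀ w ∈ U, (starRingEnd ℂ) (upper w) ∈ toSlice J ⁻¹' U := fun w hw => by
    show toSlice J _ ∈ U
    rw [toSlice_conj]
    exact hU.axially _ J hJ _ (neg_mem_unitSphere hJ) (h1 w hw)
  have h3 := map_mem_closure continuous_upper hz h1
  have h4 := map_mem_closure (Complex.continuous_conj.comp continuous_upper) hz h2
  rw [upper_toSlice hJ] at h3
  rw [Function.comp_apply, upper_toSlice hJ] at h4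
  rcases abs_choice z.im with h | h
  · rwa [h] at h3
  · rw [h] at h4
    convert h4
    apply Complex.ext <;> simp

/-- A slice contour as a contour in the plane. -/
def SliceContour.toPlane {J : Oct} {U : Set Oct} (Γ : SliceContour J U)
    (hU : IsAdmissibleDomain U) (hJ : J ∈ unitSphere) : PlaneContour (toSlice J ⁻¹' U) where
  n := Γ.n
  γ := Γ.γ
  smooth := Γ.smooth
  isOpen := hU.isOpen.preimage (continuous_toSlice J)
  image_eq := Γ.image_eq
  winding_inside := fun z hz => Γ.winding_inside z hz
  winding_outside := fun z hz => Γ.winding_outside z fun h => hz (hU.mem_closure hJ h)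

lemma closure_preimage_toSlice_subset {U : Set Oct} {D : Set ℂ} (hD : ∀ z ∈ D, (starRingEnd ℂ) z ∈ D)
    (hUD : closure U ⊆ OmegaD D) {J : Oct} (hJ : J ∈ unitSphere) :
    closure (toSlice J ⁻¹' U) ⊆ D := by
  intro z hz
  have h1 : toSlice J z ∈ closure U :=
    map_mem_closure (continuous_toSlice J) hz fun _ h => h
  obtain ⟨_, ⟨I, rfl⟩, h2⟩ := hUD h1
  simp only [Set.mem_iUnion] at h2
  obtain ⟨hI, w, hw, hwz⟩ := h2
  rcases eq_or_conj_of_toSlice_eq hI hJ hwz with rfl | rfl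
  exacts [hw, hD _ hw]

/-- The points outside the closure of the nonreal part of the complement of `S`. -/
def fillReal (S : Set ℂ) : Set ℂ := (closure {z | z ∉ S ∧ z.im ≠ 0})ᶜ

lemma subset_fillReal {S : Set ℂ} (hS : IsOpen S) : S ⊆ fillReal S := by
  have h : {z : ℂ | z ∉ S ∧ z.im ≠ 0} ⊆ Sᶜ := fun z hz => hz.1
  exact fun z hz hn => hS.isClosed_compl.closure_subset_iff.2 h hn hz

lemma fillReal_subset_closure (S : Set ℂ) : fillReal S ⊆ closure S := by
  intro z hz
  rw [mem_closure_iff]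
  intro o ho hzo
  have h1 : IsOpen (o ∩ fillReal S) := ho.inter isClosed_closure.isOpen_compl
  have h2 : Continuous fun ε : ℝ => z + ε * Complex.I := by fun_prop
  have h3 : ∀ᶠ ε : ℝ in nhds 0, z + ε * Complex.I ∈ o ∩ fillReal S :=
    by
    refine h2.continuousAt.eventually_mem (h1.mem_nhds ?_)
    simpa using ⟨hzo, hz⟩
  have h4 : ∃ ε : ℝ, z + ε * Complex.I ∈ o ∩ fillReal S ∧ (z + ε * Complex.I).im ≠ 0 := by
    have h5 : ∀ᶠ ε : ℝ in nhdsWithin 0 {0}ᶜ, z + ε * Complex.I ∈ o ∩ fillReal S :=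
      h3.filter_mono nhdsWithin_le_nhds
    have h6 : ∀ᶠ ε : ℝ in nhdsWithin 0 {0}ᶜ, (z + ε * Complex.I).im ≠ 0 := by
      by_cases hz0 : z.im = 0
      · filter_upwards [self_mem_nhdsWithin] with ε hε
        simpa [hz0] using hε
      · have : Continuous fun ε : ℝ => (z + ε * Complex.I).im := by fun_prop
        refine Filter.Eventually.filter_mono nhdsWithin_le_nhds
          (this.continuousAt.eventually_ne (?_ : _ ≠ (0 : ℝ)))
        simpa using hz0
    exact (h5.and h6).exists
  obtain ⟨ε, hε, hε0⟩ := h4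
  refine ⟨_, hε.1, ?_⟩
  by_contra hn
  exact hε.2 (subset_closure ⟨hn, hε0⟩)

lemma volume_fillReal_sdiff (S : Set ℂ) : MeasureTheory.volume (fillReal S \ S) = 0 := by
  refine MeasureTheory.measure_mono_null (t := {z : ℂ | z.im = 0}) (fun z hz => ?_) ?_
  · by_contra hn
    exact hz.1 (subset_closure ⟨hz.2, hn⟩)
  · have h := MeasureTheory.Measure.addHaar_submodule (MeasureTheory.volume : MeasureTheory.Measure ℂ)
      (LinearMap.ker Complex.imLm) ?_
    · exact h
    · intro h
      have : Complex.I ∈ LinearMap.ker Complex.imLm := h ▸ Submodule.mem_top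
      simp at this

end SliceGeometry

section Resolvent

variable {V : Type*} [NormedAddCommGroup V] [NormedSpace ℝ V] [OctBimodule V]

lemma rmo_toSlice (J : Oct) (z : ℂ) (x : V) :
    rmo (toSlice J z) x = z.re • x + z.im • rmo J x := by
  rw [toSlice, rmo_add, rmo_smul, rmo_smul, rmo_one]

lemma rmo_toSlice_sub (J : Oct) (T : V →L[ℝ] V) (z : ℂ) :
    (rmo (toSlice J z) : V →L[ℝ] V) - T = slicePencil (rmo J) T z := by
  ext x
  rw [slicePencil, _root_.sub_apply, rmo_toSlice]
  rfl

lemma rmo_mul_self {J : Oct} (hJ : J ∈ unitSphere) :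
    (rmo J : V →L[ℝ] V) * rmo J = -1 := by
  ext x
  show rmo J (rmo J x) = -x
  have hJ' : J * J = -1 := hJ
  rw [rmo_rmo_self, hJ', rmo_neg, rmo_one]

lemma exists_of_notMem_pbSpec {T : V →L[ℝ] V} {s : Oct} (h : s ∉ pbSpec T) :
    ∃ I, s ∈ pbResSlice T I := by
  simp only [pbSpec, Set.mem_sdiff, Set.mem_univ, true_and, not_not, pbRes, Set.mem_iUnion] at h
  exact ⟨h.choose, h.choose_spec.2⟩

lemma exists_of_notMem_pfSpec {T : V →L[ℝ] V} {s : Oct} (h : s ∉ pfSpec T) :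
    ∃ I, s ∈ pfResSlice T I := by
  simp only [pfSpec, Set.mem_sdiff, Set.mem_univ, true_and, not_not, pfRes, Set.mem_iUnion] at h
  exact ⟨h.choose, h.choose_spec.2⟩

lemma isUnit_slicePencil_of_notMem {T : V →L[ℝ] V} {J : Oct} {z : ℂ}
    (h : toSlice J z ∉ pbSpec T) : IsUnit (slicePencil (rmo J : V →L[ℝ] V) T z) := by
  obtain ⟨I, hI⟩ := exists_of_notMem_pbSpec h
  rw [← rmo_toSlice_sub]
  exact hI.2.1

lemma mem_sliceC_of_toSlice_mem {I J : Oct} {z : ℂ} (hz : z.im ≠ 0)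
    (h : toSlice J z ∈ sliceC I) : J ∈ sliceC I := by
  obtain ⟨x, y, hxy⟩ := h
  refine ⟨z.im⁻¹ * (x - z.re), z.im⁻¹ * y, ?_⟩
  have : z.im • J = (x - z.re) • (1 : Oct) + y • I := by
    rw [toSlice] at hxy
    rw [sub_smul, sub_add_eq_add_sub, ← hxy]
    abel
  rw [mul_smul, mul_smul, ← smul_add, ← this, smul_smul, inv_mul_cancel₀ hz, one_smul]

lemma mem_commSet_of_notMem_pbSpec {T : V →L[ℝ] V} {J : Oct} {z : ℂ} (hz : z.im ≠ 0)
    (h : toSlice J z ∉ pbSpec T) : z ∈ commSet (rmo J : V →L[ℝ] V) T (reO V) := by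
  refine ⟨isUnit_slicePencil_of_notMem h, fun n => ?_⟩
  obtain ⟨I, h1, h2, h3⟩ := exists_of_notMem_pbSpec h
  rcases Nat.eq_zero_or_pos n with rfl | hn
  · simp
  · rw [rmo_toSlice_sub] at h3
    ext x
    exact h3 n hn _ (reO_mem x) J (mem_sliceC_of_toSlice_mem hz h1)

lemma mem_commSetOp_of_notMem_pfSpec {T : V →L[ℝ] V} {J : Oct} {z : ℂ} (hz : z.im ≠ 0)
    (h : toSlice J z ∉ pfSpec T) : z ∈ commSetOp (rmo J : V →L[ℝ] V) T (reO V) := by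
  obtain ⟨I, h1, h2, h3⟩ := exists_of_notMem_pfSpec h
  rw [rmo_toSlice_sub] at h2 h3
  refine ⟨h2, fun n => ?_⟩
  rcases Nat.eq_zero_or_pos n with rfl | hn
  · simp
  · ext x
    exact h3 n hn x J (mem_sliceC_of_toSlice_mem hz h1)

/-- The parameters of the slice at which the operator pencil is singular. -/
def singSet (T : V →L[ℝ] V) (J : Oct) : Set ℂ :=
  {z | ¬ IsUnit (slicePencil (rmo J : V →L[ℝ] V) T z)}

/-- The parameters of the slice at which the resolvent fails to be compatible with the slice. -/
def specSet (T : V →L[ℝ] V) (J : Oct) : Set ℂ :=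
  (commSet (rmo J : V →L[ℝ] V) T (reO V) ∩ commSetOp (rmo J : V →L[ℝ] V) T (reO V))ᶜ

lemma cutoffSetting [CompleteSpace V] {T : V →L[ℝ] V} {J : Oct} (hJ : J ∈ unitSphere)
    {U : Set Oct} (hU : IsAdmissibleDomain U) (hUl : pbSpec T ⊆ U) (hUr : pfSpec T ⊆ U)
    (Γ : SliceContour J U) {D : Set ℂ} (hD : IsOpen D) (hDc : ∀ z ∈ D, (starRingEnd ℂ) z ∈ D)
    (hUD : closure U ⊆ OmegaD D) :
    CutoffSetting (toSlice J ⁻¹' U) D (singSet T J) (specSet T J) (fillReal (toSlice J ⁻¹' U)) := by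
  set S := toSlice J ⁻¹' U with hS
  have hSo : IsOpen S := (Γ.toPlane hU hJ).isOpen
  have hSb : Bornology.IsBounded S := (Γ.toPlane hU hJ).isBounded
  have hcl : closure S ⊆ D := closure_preimage_toSlice_subset hDc hUD hJ
  have hK := rmo_mul_self (V := V) hJ
  have hunit : ∀ z ∉ S, IsUnit (slicePencil (rmo J : V →L[ℝ] V) T z) := fun z hz =>
    isUnit_slicePencil_of_notMem fun h => hz (hUl h)
  have hZS : singSet T J ⊆ S := fun z hz => by
    by_contra hn
    exact hz (hunit z hn)
  have hCO : specSet T J ⊆ fillReal S := by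
    intro z hz hzc
    refine hz ?_
    have hzS : z ∉ S := fun h => subset_fillReal hSo h hzc
    exact ⟨mem_commSet_of_mem_closure (closure_mono (fun w hw =>
        mem_commSet_of_notMem_pbSpec hw.2 fun h => hw.1 (hUl h)) hzc) (hunit z hzS),
      mem_commSetOp_of_mem_closure (closure_mono (fun w hw =>
        mem_commSetOp_of_notMem_pfSpec hw.2 fun h => hw.1 (hUr h)) hzc) (hunit z hzS)⟩
  refine ⟨hD, hcl, isClosed_closure.isOpen_compl, subset_fillReal hSo,
    (fillReal_subset_closure S).trans hcl, volume_fillReal_sdiff S, ?_, hZS, ?_,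
    fun z hz h => hz h.1.1, hCO⟩
  · exact Metric.isCompact_of_isClosed_isBounded (isOpen_isUnit_slicePencil _ _).isClosed_compl
      (hSb.subset hZS)
  · exact Metric.isCompact_of_isClosed_isBounded
      ((isOpen_commSet hK).inter (isOpen_commSetOp hK)).isClosed_compl
      (hSb.closure.subset (hCO.trans (fillReal_subset_closure S)))

end Resolvent

section Complexify

variable {V : Type*} [NormedAddCommGroup V] [NormedSpace ℝ V] [OctBimodule V]

namespace Oct

lemma toSlice_mul {J : Oct} (hJ : J ∈ unitSphere) (a b : ℂ) :
    toSlice J a * toSlice J b = toSlice J (a * b) := by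
  have hJ' : J * J = -1 := hJ
  simp only [toSlice, mul_add', add_mul', smul_mul', mul_smul', mul_one', one_mul', hJ',
    Complex.mul_re, Complex.mul_im]
  module

lemma neg_toSlice_mul {J : Oct} (hJ : J ∈ unitSphere) (a : ℂ) :
    -(toSlice J a) * J = toSlice J (-Complex.I * a) := by
  have h : -(toSlice J a) = toSlice J (-a) := by simp [toSlice]; abel
  have h' : J = toSlice J Complex.I := by simp [toSlice]
  conv_lhs => rw [h, h', ← h']
  conv_lhs => enter [2]; rw [h']
  rw [toSlice_mul hJ]
  congr 1; ring

end Oct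

/-- The complex functional `x ↦ φ x - i φ (x J)`. -/
def cplx (J : Oct) (φ : V →L[ℝ] ℝ) : V →L[ℝ] ℂ :=
  Complex.ofRealCLM.comp φ - Complex.I • Complex.ofRealCLM.comp (φ.comp (rmo J))

lemma cplx_apply (J : Oct) (φ : V →L[ℝ] ℝ) (x : V) :
    cplx J φ x = (φ x : ℂ) - Complex.I * (φ (rmo J x) : ℂ) := rfl

lemma re_cplx (J : Oct) (φ : V →L[ℝ] ℝ) (x : V) : (cplx J φ x).re = φ x := by
  simp [cplx_apply]

lemma cplx_rmo {J : Oct} (hJ : J ∈ unitSphere) (φ : V →L[ℝ] ℝ) (x : V) :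
    cplx J φ (rmo J x) = Complex.I * cplx J φ x := by
  have hJ' : J * J = -1 := hJ
  rw [cplx_apply, cplx_apply, rmo_rmo_self, hJ', rmo_neg, rmo_one, map_neg, mul_sub, ← mul_assoc,
    Complex.I_mul_I]
  push_cast
  ring

lemma cplx_rmo_toSlice {J : Oct} (hJ : J ∈ unitSphere) (φ : V →L[ℝ] ℝ) (z : ℂ) (x : V) :
    cplx J φ (rmo (toSlice J z) x) = z * cplx J φ x := by
  rw [rmo_toSlice, map_add, map_smul, map_smul, cplx_rmo hJ, Complex.real_smul, Complex.real_smul]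
  conv_rhs => rw [← Complex.re_add_im z]
  ring

variable [CompleteSpace V] {T : V →L[ℝ] V} {J : Oct} {D O : Set ℂ}

/-- The resolvent of `T` at the point of `ℂ_J` with coordinate `z`. -/
abbrev resJ (T : V →L[ℝ] V) (J : Oct) (z : ℂ) : V →L[ℝ] V :=
  sliceRes (rmo J : V →L[ℝ] V) T z

lemma cutoffAdm_cplx (hJ : J ∈ unitSphere) (φ : V →L[ℝ] ℝ) {v : V} (hv : v ∈ ReSet V) :
    CutoffAdm D (singSet T J) (specSet T J) O fun z => cplx J φ (resJ T J z v) := by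
  constructor
  · intro z hz
    have h : ContDiffAt ℝ 1 (resJ T J) z := contDiffAt_sliceRes (not_not.1 hz.2)
    exact ((((cplx J φ).comp (ContinuousLinearMap.apply ℝ V v)).contDiff.contDiffAt).comp z
      h).contDiffWithinAt
  · intro z hz
    have h := differentiableAt_sliceRes (not_not.1 hz.2).1
      ((cplx J φ).comp (ContinuousLinearMap.apply ℝ V v)) fun x => cplx_rmo hJ φ (x v)
    refine h.congr_of_eventuallyEq (Filter.Eventually.of_forall fun w => ?_)
    show cplx J φ (resJ T J w v) = cplx J φ (resJ T J w (reO V v))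
    rw [reO_of_mem hv]

lemma cutoffAdm_cplx_resolvent (hJ : J ∈ unitSphere) (φ : V →L[ℝ] ℝ) (u : V) :
    CutoffAdm D (singSet T J) (specSet T J) O
      fun z => cplx J (φ.comp ((reO V).comp (resJ T J z))) u := by
  let Θ : (V →L[ℝ] V) →L[ℝ] ℂ :=
    Complex.ofRealCLM.comp (φ.comp (ContinuousLinearMap.apply ℝ V u)) -
      Complex.I • Complex.ofRealCLM.comp (φ.comp (ContinuousLinearMap.apply ℝ V (rmo J u)))
  have hΘ : ∀ x : V →L[ℝ] V, Θ x = (φ (x u) : ℂ) - Complex.I * (φ (x (rmo J u)) : ℂ) :=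
    fun x => rfl
  constructor
  · intro z hz
    have h : ContDiffAt ℝ 1 (resJ T J) z := contDiffAt_sliceRes (not_not.1 hz.2)
    exact (((Θ.comp (ContinuousLinearMap.mul ℝ (V →L[ℝ] V) (reO V))).contDiff.contDiffAt).comp z
      h).contDiffWithinAt
  · intro z hz
    refine differentiableAt_sliceRes_op (not_not.1 hz.2).2 Θ fun x => ?_
    have hJ' : J * J = -1 := hJ
    rw [hΘ, hΘ]
    show (φ (x (rmo J u)) : ℂ) - Complex.I * (φ (x (rmo J (rmo J u))) : ℂ) = _
    rw [rmo_rmo_self, hJ', rmo_neg, rmo_one, map_neg, map_neg, mul_sub, ← mul_assoc,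
      Complex.I_mul_I]
    push_cast
    ring

omit [CompleteSpace V] in
lemma cplx_resolvent_eq {z : ℂ} (hz : z ∉ specSet T J) (φ : V →L[ℝ] ℝ) {v : V}
    (hv : v ∈ ReSet V) :
    cplx J (φ.comp ((reO V).comp (resJ T J z))) v = cplx J (φ.comp (reO V)) (resJ T J z v) := by
  have h := DFunLike.congr_fun ((not_not.1 hz).1.2 1) v
  rw [pow_one] at h
  have h' : resJ T J z (rmo J (reO V v)) = rmo J (resJ T J z (reO V v)) := h
  rw [reO_of_mem hv] at h'
  rw [cplx_apply, cplx_apply]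
  show (φ (reO V (resJ T J z v)) : ℂ) - Complex.I * (φ (reO V (resJ T J z (rmo J v))) : ℂ) = _
  rw [h']
  rfl

omit [CompleteSpace V] in
lemma cplx_resolvent_rmo {z : ℂ} (hz : z ∉ specSet T J) (φ : V →L[ℝ] ℝ) (x : V) :
    cplx J (φ.comp ((reO V).comp (resJ T J z))) x = cplx J (φ.comp (reO V)) (resJ T J z x) := by
  have h := DFunLike.congr_fun ((not_not.1 hz).2.2 1) x
  rw [pow_one] at h
  have h' : reO V (resJ T J z (rmo J x)) = reO V (rmo J (resJ T J z x)) := h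
  rw [cplx_apply, cplx_apply]
  show (φ (reO V (resJ T J z x)) : ℂ) - Complex.I * (φ (reO V (resJ T J z (rmo J x))) : ℂ) = _
  rw [h']
  rfl

omit [CompleteSpace V] in
/-- The resolvent identity. -/
lemma cplx_resolvent_identity (hJ : J ∈ unitSphere) {s t : ℂ} (hs : s ∉ specSet T J)
    (ht : t ∉ specSet T J) (φ : V →L[ℝ] ℝ) (v : V) :
    (t - s) * cplx J (φ.comp ((reO V).comp (resJ T J s))) (resJ T J t v) =
      cplx J (φ.comp (reO V)) (resJ T J s v) - cplx J (φ.comp (reO V)) (resJ T J t v) := by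
  rw [← cplx_rmo_toSlice hJ, cplx_resolvent_rmo hs, ← map_sub]
  congr 1
  have hs' := (not_not.1 hs).1.1
  have ht' := (not_not.1 ht).1.1
  have h1 : slicePencil (rmo J : V →L[ℝ] V) T t =
      rmo (toSlice J (t - s)) + slicePencil (rmo J : V →L[ℝ] V) T s := by
    rw [← rmo_toSlice_sub, ← rmo_toSlice_sub]
    ext x
    simp only [_root_.sub_apply, _root_.add_apply, rmo_toSlice, Complex.sub_re, Complex.sub_im]
    module
  have h2 : resJ T J s * rmo (toSlice J (t - s)) * resJ T J t = resJ T J s - resJ T J t := by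
    rw [eq_sub_of_add_eq h1.symm, mul_sub, sub_mul, mul_assoc, slicePencil_mul_sliceRes ht',
      sliceRes_mul_slicePencil hs', mul_one, one_mul]
  exact DFunLike.congr_fun h2 v

end Complexify

section OperatorIntegrals

lemma PlaneContour.mul_integral_add {S : Set ℂ} (Γ : PlaneContour S) {φ ψ : ℂ → ℂ} (a : ℂ)
    (hφ : ContinuousOn φ (frontier S)) (hψ : ContinuousOn ψ (frontier S)) :
    Γ.integral (fun z => φ z + a * ψ z) = Γ.integral φ + a * Γ.integral ψ := by
  have h : ∀ {χ : ℂ → ℂ}, ContinuousOn χ (frontier S) → ∀ i, IntervalIntegrable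
      (fun t => χ (Γ.γ i t) * deriv (Γ.γ i) t) MeasureTheory.volume 0 1 := fun hχ i => by
    refine ContinuousOn.intervalIntegrable_of_Icc zero_le_one ?_
    exact (hχ.comp (Γ.continuous_curve i).continuousOn fun t ht => Γ.mem_frontier i ht).mul
      (Γ.continuous_deriv i).continuousOn
  simp only [PlaneContour.integral, Finset.mul_sum, ← Finset.sum_add_distrib]
  refine Finset.sum_congr rfl fun i _ => ?_
  rw [← intervalIntegral.integral_const_mul,
    ← intervalIntegral.integral_add (h hφ i) ((h hψ i).const_mul a)]
  simp only [add_mul, mul_assoc]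

lemma apply_contourSum {J : Oct} {U : Set Oct} (Γ : SliceContour J U)
    (hU : IsAdmissibleDomain U) (hJ : J ∈ unitSphere) {E : Type*} [NormedAddCommGroup E]
    [NormedSpace ℝ E] [CompleteSpace E] (L : E →L[ℝ] ℂ) (Φ : ℂ → ℂ → E) (k : ℂ → ℂ)
    (hΦ : ContinuousOn (fun p : ℂ × ℂ => Φ p.1 p.2) (frontier (toSlice J ⁻¹' U) ×ˢ Set.univ))
    (hL : ∀ z dz, L (Φ z dz) = (-Complex.I * dz) * k z) :
    L ((2 * Real.pi)⁻¹ • contourSum Γ Φ) =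
      -Complex.I / (2 * Real.pi) * (Γ.toPlane hU hJ).integral k := by
  have hi : ∀ i, IntervalIntegrable (fun t => Φ (Γ.γ i t) (deriv (Γ.γ i) t))
      MeasureTheory.volume 0 1 := fun i => by
    refine ContinuousOn.intervalIntegrable_of_Icc zero_le_one ?_
    exact hΦ.comp (((Γ.toPlane hU hJ).continuous_curve i).prodMk
      ((Γ.toPlane hU hJ).continuous_deriv i)).continuousOn
      fun t ht => ⟨(Γ.toPlane hU hJ).mem_frontier i ht, trivial⟩
  rw [map_smul, contourSum, map_sum, Complex.real_smul, PlaneContour.integral, Finset.mul_sum,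
    Finset.mul_sum]
  refine Finset.sum_congr rfl fun i _ => ?_
  rw [← L.intervalIntegral_comp_comm (hi i)]
  simp only [hL]
  have : ∀ t, -Complex.I * deriv (Γ.γ i) t * k (Γ.γ i t) =
      -Complex.I * (k (Γ.γ i t) * deriv (Γ.γ i) t) := fun t => by ring
  simp only [this]
  rw [intervalIntegral.integral_const_mul, ← mul_assoc]
  congr 1
  push_cast
  ring

variable {V : Type*} [NormedAddCommGroup V] [NormedSpace ℝ V] [OctBimodule V]

lemma odotR_toSlice (J : Oct) (A : V →L[ℝ] V) (w : ℂ) :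
    odotR A (toSlice J w) = w.re • A + w.im • odotR A J := by
  ext x
  have h : lmo (toSlice J w) x = w.re • x + w.im • lmo J x := by
    rw [toSlice, lmo_add, lmo_smul, lmo_smul, lmo_one]
  simp only [_root_.add_apply, _root_.smul_apply, odotR_apply, rmo_toSlice, h, map_add, map_smul]
  module

lemma odotL_toSlice (J : Oct) (A : V →L[ℝ] V) (w : ℂ) :
    odotL (toSlice J w) A = w.re • A + w.im • odotL J A := by
  ext x
  have h : ∀ x : V, lmo (toSlice J w) x = w.re • x + w.im • lmo J x := fun x => by
    rw [toSlice, lmo_add, lmo_smul, lmo_smul, lmo_one]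
  simp only [_root_.add_apply, _root_.smul_apply, odotL_apply, rmo_toSlice, h, map_add, map_smul]
  module

lemma continuous_odotR (p : Oct) : Continuous fun A : V →L[ℝ] V => odotR A p := by
  unfold odotR Bop; fun_prop

lemma continuous_odotL (p : Oct) : Continuous fun A : V →L[ℝ] V => odotL p A := by
  unfold odotL Bop; fun_prop

lemma continuous_extO : Continuous fun A : V →L[ℝ] V => extO A := by
  unfold extO; fun_prop

lemma continuous_lifO : Continuous fun A : V →L[ℝ] V => lifO ((reO V).comp A) := by
  unfold lifO; fun_prop

variable {T : V →L[ℝ] V} {J : Oct} {U : Set Oct}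

lemma leftFC_eq (hJ : J ∈ unitSphere) (Γ : SliceContour J U) (F : ℂ → ℂ) :
    leftFC T J Γ F = (2 * Real.pi)⁻¹ • contourSum Γ fun z dz =>
      odotR (extO (resJ T J z)) (toSlice J (-Complex.I * dz * F z)) := by
  simp only [leftFC, rinvR, rmo_toSlice_sub, neg_toSlice_mul hJ, toSlice_mul hJ]
  rfl

lemma rightFC_eq (hJ : J ∈ unitSphere) (Γ : SliceContour J U) (F : ℂ → ℂ) :
    rightFC T J Γ F = (2 * Real.pi)⁻¹ • contourSum Γ fun z dz =>
      odotL (toSlice J (-Complex.I * dz * F z)) (lifO ((reO V).comp (resJ T J z))) := by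
  simp only [rightFC, rinvL, rmo_toSlice_sub, neg_toSlice_mul hJ, toSlice_mul hJ,
    mul_comm (F _)]
  rfl

lemma toSlice_real_mul (J : Oct) (r : ℝ) (z : ℂ) : toSlice J (r * z) = r • toSlice J z := by
  simp [toSlice, smul_smul]

lemma odotR_smul (A : V →L[ℝ] V) (r : ℝ) (p : Oct) : odotR A (r • p) = r • odotR A p := by
  ext x
  simp only [_root_.smul_apply, odotR_apply, lmo_smul, rmo_smul, map_smul, smul_sub]

lemma odotL_smul (A : V →L[ℝ] V) (r : ℝ) (p : Oct) : odotL (r • p) A = r • odotL p A := by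
  ext x
  simp only [_root_.smul_apply, odotL_apply, lmo_smul, rmo_smul, map_smul, smul_sub, smul_add]

lemma contourSum_smul (Γ : SliceContour J U) {E : Type*} [NormedAddCommGroup E] [NormedSpace ℝ E]
    (r : ℝ) (Φ : ℂ → ℂ → E) :
    contourSum Γ (fun z dz => r • Φ z dz) = r • contourSum Γ Φ := by
  simp only [contourSum, intervalIntegral.integral_smul, Finset.smul_sum]

lemma leftFC_real_mul (hJ : J ∈ unitSphere) (Γ : SliceContour J U) (r : ℝ) (F : ℂ → ℂ) :
    leftFC T J Γ (fun z => r * F z) = r • leftFC T J Γ F := by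
  simp only [leftFC_eq hJ, mul_left_comm _ (r : ℂ), toSlice_real_mul, odotR_smul, contourSum_smul]
  rw [smul_comm]

lemma rightFC_real_mul (hJ : J ∈ unitSphere) (Γ : SliceContour J U) (r : ℝ) (F : ℂ → ℂ) :
    rightFC T J Γ (fun z => r * F z) = r • rightFC T J Γ F := by
  simp only [rightFC_eq hJ, mul_left_comm _ (r : ℂ), toSlice_real_mul, odotL_smul, contourSum_smul]
  rw [smul_comm]

variable [CompleteSpace V]

lemma isRightPara_contourSum (Γ : SliceContour J U) (Φ : ℂ → ℂ → V →L[ℝ] V)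
    (h : ∀ z dz, IsRightPara (Φ z dz)) : IsRightPara (contourSum Γ Φ) :=
  isRightPara_sum _ _ fun _ _ => isRightPara_integral _ (fun _ => h _ _) _ _

lemma isRightPara_leftFC (Γ : SliceContour J U) (F : ℂ → ℂ) : IsRightPara (leftFC T J Γ F) :=
  (isRightPara_contourSum Γ _ fun _ _ => (isRightPara_extO _).odotR _).smul _

lemma isRightPara_rightFC (Γ : SliceContour J U) (F : ℂ → ℂ) : IsRightPara (rightFC T J Γ F) :=
  (isRightPara_contourSum Γ _ fun _ _ => (isRightPara_lifO _).odotL _).smul _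

lemma continuousOn_resJ {s : Set ℂ} (h : ∀ z ∈ s, z ∉ singSet T J) :
    ContinuousOn (resJ T J) s := fun z hz =>
  (continuousAt_sliceRes (not_not.1 (h z hz))).continuousWithinAt

lemma cplx_leftFC (hU : IsAdmissibleDomain U) (hJ : J ∈ unitSphere) (Γ : SliceContour J U)
    (hs : ∀ z ∈ frontier (toSlice J ⁻¹' U), z ∉ singSet T J) {F : ℂ → ℂ}
    (hF : ContinuousOn F (frontier (toSlice J ⁻¹' U))) (φ : V →L[ℝ] ℝ) {v : V}
    (hv : v ∈ ReSet V) :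
    cplx J φ (leftFC T J Γ F v) = -Complex.I / (2 * Real.pi) *
      (Γ.toPlane hU hJ).integral (fun z => F z * cplx J φ (resJ T J z v)) := by
  rw [leftFC_eq hJ]
  refine apply_contourSum Γ hU hJ ((cplx J φ).comp (ContinuousLinearMap.apply ℝ V v)) _ _ ?_ ?_
  · simp only [odotR_toSlice]
    have h1 : ContinuousOn (fun p : ℂ × ℂ => extO (resJ T J p.1))
        (frontier (toSlice J ⁻¹' U) ×ˢ Set.univ) :=
      continuous_extO.comp_continuousOn ((continuousOn_resJ hs).comp continuousOn_fst
        fun p hp => hp.1)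
    have h2 : ContinuousOn (fun p : ℂ × ℂ => -Complex.I * p.2 * F p.1)
        (frontier (toSlice J ⁻¹' U) ×ˢ Set.univ) :=
      ContinuousOn.mul (by fun_prop) (hF.comp continuousOn_fst fun p hp => hp.1)
    exact ((Complex.continuous_re.comp_continuousOn h2).smul h1).add
      ((Complex.continuous_im.comp_continuousOn h2).smul
        ((continuous_odotR J).comp_continuousOn h1))
  · intro z dz
    show cplx J φ (odotR (extO (resJ T J z)) (toSlice J (-Complex.I * dz * F z)) v) = _
    rw [(isRightPara_extO _).odotR_of_mem hv, extO_of_mem _ hv, cplx_rmo_toSlice hJ, mul_assoc]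

/-- The complex functional `A ↦ φ (Re A u) - i φ (Re A (u J))` on operators. -/
def cplxOp (J : Oct) (φ : V →L[ℝ] ℝ) (u : V) : (V →L[ℝ] V) →L[ℝ] ℂ :=
  Complex.ofRealCLM.comp ((φ.comp (reO V)).comp (ContinuousLinearMap.apply ℝ V u)) -
    Complex.I • Complex.ofRealCLM.comp
      ((φ.comp (reO V)).comp (ContinuousLinearMap.apply ℝ V (rmo J u)))

omit [CompleteSpace V] in
lemma cplxOp_apply (J : Oct) (φ : V →L[ℝ] ℝ) (u : V) (A : V →L[ℝ] V) :
    cplxOp J φ u A = (φ (reO V (A u)) : ℂ) - Complex.I * (φ (reO V (A (rmo J u))) : ℂ) := rfl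

omit [CompleteSpace V] in
lemma cplxOp_odotL (hJ : J ∈ unitSphere) (φ : V →L[ℝ] ℝ) (u : V) {A : V →L[ℝ] V}
    (hA : IsRightPara A) (w : ℂ) : cplxOp J φ u (odotL (toSlice J w) A) = w * cplxOp J φ u A := by
  have h : ∀ B : V →L[ℝ] V, cplxOp J φ u B = cplx J (φ.comp ((reO V).comp B)) u := fun B => rfl
  rw [h A, ← cplx_rmo_toSlice hJ, cplxOp_apply, cplx_apply, hA.reO_odotL, hA.reO_odotL]
  have h1 : rmo (toSlice J w) (rmo J u) = rmo J (rmo (toSlice J w) u) := by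
    simp only [rmo_toSlice, map_add, map_smul]
  rw [h1]
  rfl

lemma cplxOp_rightFC (hU : IsAdmissibleDomain U) (hJ : J ∈ unitSphere) (Γ : SliceContour J U)
    (hs : ∀ z ∈ frontier (toSlice J ⁻¹' U), z ∉ singSet T J) {F : ℂ → ℂ}
    (hF : ContinuousOn F (frontier (toSlice J ⁻¹' U))) (φ : V →L[ℝ] ℝ) (u : V) :
    cplxOp J φ u (rightFC T J Γ F) = -Complex.I / (2 * Real.pi) *
      (Γ.toPlane hU hJ).integral
        (fun z => F z * cplx J (φ.comp ((reO V).comp (resJ T J z))) u) := by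
  rw [rightFC_eq hJ]
  refine apply_contourSum Γ hU hJ (cplxOp J φ u) _ _ ?_ ?_
  · simp only [odotL_toSlice]
    have h1 : ContinuousOn (fun p : ℂ × ℂ => lifO ((reO V).comp (resJ T J p.1)))
        (frontier (toSlice J ⁻¹' U) ×ˢ Set.univ) :=
      continuous_lifO.comp_continuousOn ((continuousOn_resJ hs).comp continuousOn_fst
        fun p hp => hp.1)
    have h2 : ContinuousOn (fun p : ℂ × ℂ => -Complex.I * p.2 * F p.1)
        (frontier (toSlice J ⁻¹' U) ×ˢ Set.univ) :=
      ContinuousOn.mul (by fun_prop) (hF.comp continuousOn_fst fun p hp => hp.1)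
    exact ((Complex.continuous_re.comp_continuousOn h2).smul h1).add
      ((Complex.continuous_im.comp_continuousOn h2).smul
        ((continuous_odotL J).comp_continuousOn h1))
  · intro z dz
    rw [cplxOp_odotL hJ φ u (isRightPara_lifO _), mul_assoc, cplxOp_apply, reO_lifO, reO_lifO]
    rw [mul_assoc, mul_assoc]
    rfl

end OperatorIntegrals

section StemFamilies

variable {V : Type*} [NormedAddCommGroup V] [NormedSpace ℝ V] [OctBimodule V]
variable {T : V →L[ℝ] V} {J : Oct} {U : Set Oct} {c : Fin 8 → ℝ}

lemma stemFamily_zero (c : Fin 8 → ℝ) (F₀ F₁ : ℂ → ℂ) : stemFamily c F₀ F₁ 0 = F₀ := by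
  ext z; simp [stemFamily]

lemma stemFamily_succ (c : Fin 8 → ℝ) (F₀ F₁ : ℂ → ℂ) (i : Fin 7) :
    stemFamily c F₀ F₁ i.succ = fun z => (c i.succ : ℂ) * F₁ z := by
  ext z; simp [stemFamily, Fin.succ_ne_zero]

lemma rmo_eq_sum (hJc : J = ∑ i : Fin 8, c i • e i) (hc0 : c 0 = 0) (x : V) :
    rmo J x = ∑ i : Fin 7, c i.succ • rmo (e i.succ) x := by
  rw [hJc, rmo_sum, Fin.sum_univ_succ, hc0, zero_smul]
  simp only [rmo_smul]
  rw [show rmo (0 : Oct) x = 0 by simp [rmo], zero_add]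

variable [CompleteSpace V]

lemma isRightPara_sum_odotR_leftFC (Γ : SliceContour J U) (F : Fin 8 → ℂ → ℂ) :
    IsRightPara (∑ i : Fin 8, odotR (leftFC T J Γ (F i)) (e i)) :=
  isRightPara_sum _ _ fun _ _ => (isRightPara_leftFC _ _).odotR _

lemma isRightPara_sum_odotL_rightFC (Γ : SliceContour J U) (F : Fin 8 → ℂ → ℂ) :
    IsRightPara (∑ i : Fin 8, odotL (e i) (rightFC T J Γ (F i))) :=
  isRightPara_sum _ _ fun _ _ => (isRightPara_rightFC _ _).odotL _

lemma sum_odotR_leftFC_apply (hJ : J ∈ unitSphere) (hJc : J = ∑ i : Fin 8, c i • e i)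
    (hc0 : c 0 = 0) (Γ : SliceContour J U) (F₀ F₁ : ℂ → ℂ) {v : V} (hv : v ∈ ReSet V) :
    (∑ i : Fin 8, odotR (leftFC T J Γ (stemFamily c F₀ F₁ i)) (e i)) v =
      leftFC T J Γ F₀ v + rmo J (leftFC T J Γ F₁ v) := by
  simp only [_root_.sum_apply, (isRightPara_leftFC Γ _).odotR_of_mem hv]
  rw [Fin.sum_univ_succ, stemFamily_zero, e_zero, rmo_one, rmo_eq_sum hJc hc0]
  simp only [stemFamily_succ, leftFC_real_mul hJ, _root_.smul_apply, map_smul]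

lemma reO_sum_odotL_rightFC_apply (hJ : J ∈ unitSphere) (hJc : J = ∑ i : Fin 8, c i • e i)
    (hc0 : c 0 = 0) (Γ : SliceContour J U) (F₀ F₁ : ℂ → ℂ) (u : V) :
    reO V ((∑ i : Fin 8, odotL (e i) (rightFC T J Γ (stemFamily c F₀ F₁ i))) u) =
      reO V (rightFC T J Γ F₀ u) + reO V (rightFC T J Γ F₁ (rmo J u)) := by
  simp only [_root_.sum_apply, map_sum, (isRightPara_rightFC Γ _).reO_odotL]
  rw [Fin.sum_univ_succ, stemFamily_zero, e_zero, rmo_one, rmo_eq_sum hJc hc0]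
  simp only [stemFamily_succ, rightFC_real_mul hJ, _root_.smul_apply, map_smul, map_sum]

variable {D : Set ℂ} {F₀ F₁ : ℂ → ℂ}

lemma cplx_sum_odotR_leftFC (hU : IsAdmissibleDomain U) (hJ : J ∈ unitSphere)
    (hJc : J = ∑ i : Fin 8, c i • e i) (hc0 : c 0 = 0) (Γ : SliceContour J U)
    (hs : ∀ z ∈ frontier (toSlice J ⁻¹' U), z ∉ singSet T J)
    (hF₀ : ContinuousOn F₀ (frontier (toSlice J ⁻¹' U)))
    (hF₁ : ContinuousOn F₁ (frontier (toSlice J ⁻¹' U))) (φ : V →L[ℝ] ℝ) {v : V}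
    (hv : v ∈ ReSet V) :
    cplx J φ ((∑ i : Fin 8, odotR (leftFC T J Γ (stemFamily c F₀ F₁ i)) (e i)) v) =
      -Complex.I / (2 * Real.pi) * (Γ.toPlane hU hJ).integral
        (fun z => (F₀ z + Complex.I * F₁ z) * cplx J φ (resJ T J z v)) := by
  have hk : ContinuousOn (fun z => cplx J φ (resJ T J z v)) (frontier (toSlice J ⁻¹' U)) :=
    ((cplx J φ).comp (ContinuousLinearMap.apply ℝ V v)).continuous.comp_continuousOn
      (continuousOn_resJ hs)
  rw [sum_odotR_leftFC_apply hJ hJc hc0 Γ F₀ F₁ hv, map_add, cplx_rmo hJ,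
    cplx_leftFC hU hJ Γ hs hF₀ φ hv, cplx_leftFC hU hJ Γ hs hF₁ φ hv]
  simp only [add_mul, mul_assoc Complex.I]
  rw [(Γ.toPlane hU hJ).mul_integral_add (φ := fun z => F₀ z * cplx J φ (resJ T J z v))
    (ψ := fun z => F₁ z * cplx J φ (resJ T J z v)) Complex.I
    (hF₀.mul hk) (hF₁.mul hk)]
  ring

lemma apply_sum_odotL_rightFC (hU : IsAdmissibleDomain U) (hJ : J ∈ unitSphere)
    (hJc : J = ∑ i : Fin 8, c i • e i) (hc0 : c 0 = 0) (Γ : SliceContour J U)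
    (hs : ∀ z ∈ frontier (toSlice J ⁻¹' U), z ∉ singSet T J)
    (hF₀ : ContinuousOn F₀ (frontier (toSlice J ⁻¹' U)))
    (hF₁ : ContinuousOn F₁ (frontier (toSlice J ⁻¹' U))) (φ : V →L[ℝ] ℝ) (u : V) :
    φ (reO V ((∑ i : Fin 8, odotL (e i) (rightFC T J Γ (stemFamily c F₀ F₁ i))) u)) =
      (-Complex.I / (2 * Real.pi) * (Γ.toPlane hU hJ).integral
        (fun z => (F₀ z + Complex.I * F₁ z) *
          cplx J (φ.comp ((reO V).comp (resJ T J z))) u)).re := by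
  have hk : ContinuousOn (fun z => cplx J (φ.comp ((reO V).comp (resJ T J z))) u)
      (frontier (toSlice J ⁻¹' U)) :=
    (cplxOp J φ u).continuous.comp_continuousOn (continuousOn_resJ hs)
  have h1 : φ (reO V (rightFC T J Γ F₀ u)) = (cplxOp J φ u (rightFC T J Γ F₀)).re := by
    simp [cplxOp_apply]
  have h2 : φ (reO V (rightFC T J Γ F₁ (rmo J u))) =
      (Complex.I * cplxOp J φ u (rightFC T J Γ F₁)).re := by
    simp [cplxOp_apply]
  rw [reO_sum_odotL_rightFC_apply hJ hJc hc0, map_add, h1, h2, ← Complex.add_re,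
    cplxOp_rightFC hU hJ Γ hs hF₀, cplxOp_rightFC hU hJ Γ hs hF₁]
  simp only [add_mul, mul_assoc Complex.I]
  rw [(Γ.toPlane hU hJ).mul_integral_add (φ := fun z => F₀ z * cplx J (φ.comp ((reO V).comp (resJ T J z))) u)
    (ψ := fun z => F₁ z * cplx J (φ.comp ((reO V).comp (resJ T J z))) u) Complex.I
    (hF₀.mul hk) (hF₁.mul hk)]
  congr 1
  ring

end StemFamilies

/-- Let `T` be power-associative bounded right para-linear on a Banach
`𝕆`-bimodule `V`, `σ(T) = σ*(T) ∪ σ_*(T)`, `J ∈ 𝕊`, and let `f = f₀ + J •^R f₁` (right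
slice regular) and `g = g₀ + J •^L g₁` (left slice regular) with `f₀, f₁, g₀, g₁` slice
preserving regular (stems `F₀, F₁, G₀, G₁`) on a set containing the closure of a
`T`-admissible domain `U`.  With `f̃ = f₀ + J •^L f₁`, `g̃ = g₀ + J •^R g₁`, one has
`Re(f_*(T)_J ⊚ g*(T)_J) = Re((f •^R g̃)_*(T)_J) = Re((f̃ •^L g)*(T)_J)`, where `Re` is the
real-part projection of `𝓑_RO(V)`, and `f •^R g̃` and `f̃ •^L g` have slice preserving
components with stems `F₀G₀ − F₁G₁` and `F₀G₁ + F₁G₀`. -/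
theorem statement_17 {V : Type*} [NormedAddCommGroup V] [NormedSpace ℝ V] [CompleteSpace V]
    [OctBimodule V] (T : V →L[ℝ] V) (hT : IsRightPara T) (hpa : IsPowerAssoc T)
    (D : Set ℂ) (F₀ F₁ G₀ G₁ : ℂ → ℂ)
    (hF₀ : IsStem D F₀) (hF₁ : IsStem D F₁) (hG₀ : IsStem D G₀) (hG₁ : IsStem D G₁)
    (J : Oct) (hJ : J ∈ unitSphere) (c : Fin 8 → ℝ)
    (hJc : J = ∑ i : Fin 8, c i • e i) (hc0 : c 0 = 0)
    (U : Set Oct) (hUad : IsAdmissibleDomain U)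
    (hUl : pbSpec T ⊆ U) (hUr : pfSpec T ⊆ U) (hUD : closure U ⊆ OmegaD D)
    (Γa Γb Γc Γd : SliceContour J U) :
    reOpB (rcomp
        (∑ i : Fin 8, odotL (e i) (rightFC T J Γa (stemFamily c F₀ F₁ i)))
        (∑ i : Fin 8, odotR (leftFC T J Γb (stemFamily c G₀ G₁ i)) (e i))) =
      reOpB (∑ i : Fin 8, odotL (e i)
        (rightFC T J Γc (stemFamily c (fun z => F₀ z * G₀ z - F₁ z * G₁ z)
          (fun z => F₀ z * G₁ z + F₁ z * G₀ z) i))) ∧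
    reOpB (∑ i : Fin 8, odotL (e i)
        (rightFC T J Γc (stemFamily c (fun z => F₀ z * G₀ z - F₁ z * G₁ z)
          (fun z => F₀ z * G₁ z + F₁ z * G₀ z) i))) =
      reOpB (∑ i : Fin 8, odotR
        (leftFC T J Γd (stemFamily c (fun z => F₀ z * G₀ z - F₁ z * G₁ z)
          (fun z => F₀ z * G₁ z + F₁ z * G₀ z) i)) (e i)) := by
  have hD := hF₀.isOpen
  have hcut := cutoffSetting hJ hUad hUl hUr Γa hD hF₀.conj_mem hUD
  have hfr : frontier (toSlice J ⁻¹' U) ⊆ D := frontier_subset_closure.trans hcut.closure_subset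
  have hs : ∀ z ∈ frontier (toSlice J ⁻¹' U), z ∉ singSet T J := fun z hz h =>
    ((hUad.isOpen.preimage (continuous_toSlice J)).frontier_eq ▸ hz).2 (hcut.Z_subset h)
  have hc : ∀ {F : ℂ → ℂ}, DifferentiableOn ℂ F D →
      ContinuousOn F (frontier (toSlice J ⁻¹' U)) := fun h => h.continuousOn.mono hfr
  have h₀ : DifferentiableOn ℂ (fun z => F₀ z * G₀ z - F₁ z * G₁ z) D :=
    (hF₀.holo.mul hG₀.holo).sub (hF₁.holo.mul hG₁.holo)
  have h₁ : DifferentiableOn ℂ (fun z => F₀ z * G₁ z + F₁ z * G₀ z) D :=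
    (hF₀.holo.mul hG₁.holo).add (hF₁.holo.mul hG₀.holo)
  have hF : DifferentiableOn ℂ (fun z => F₀ z + Complex.I * F₁ z) D :=
    hF₀.holo.add (hF₁.holo.const_mul _)
  have hG : DifferentiableOn ℂ (fun z => G₀ z + Complex.I * G₁ z) D :=
    hG₀.holo.add (hG₁.holo.const_mul _)
  have hprod : ∀ z, F₀ z * G₀ z - F₁ z * G₁ z + Complex.I * (F₀ z * G₁ z + F₁ z * G₀ z) =
      (F₀ z + Complex.I * F₁ z) * (G₀ z + Complex.I * G₁ z) := fun z => by
    linear_combination (-F₁ z * G₁ z) * Complex.I_sq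
  have hadm := CutoffAdm.of_differentiableOn (Z := singSet T J) (C := specSet T J) hD
    hcut.O_subset (hF.mul hG)
  have hleft : ∀ (φ : V →L[ℝ] ℝ) {v : V}, v ∈ ReSet V →
      φ (reO V ((∑ i : Fin 8, odotR
        (leftFC T J Γd (stemFamily c (fun z => F₀ z * G₀ z - F₁ z * G₁ z)
          (fun z => F₀ z * G₁ z + F₁ z * G₀ z) i)) (e i)) v)) =
      (-Complex.I / (2 * Real.pi) * (Γd.toPlane hUad hJ).integral
        (fun z => (F₀ z + Complex.I * F₁ z) * (G₀ z + Complex.I * G₁ z) *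
          cplx J (φ.comp (reO V)) (resJ T J z v))).re := fun φ v hv => by
    have h := congrArg Complex.re
      (cplx_sum_odotR_leftFC hUad hJ hJc hc0 Γd hs (hc h₀) (hc h₁) (φ.comp (reO V)) hv)
    rw [re_cplx] at h
    simpa only [hprod] using! h
  have hsplit : reOpB (∑ i : Fin 8, odotL (e i)
        (rightFC T J Γc (stemFamily c (fun z => F₀ z * G₀ z - F₁ z * G₁ z)
          (fun z => F₀ z * G₁ z + F₁ z * G₀ z) i))) =
      reOpB (∑ i : Fin 8, odotR
        (leftFC T J Γd (stemFamily c (fun z => F₀ z * G₀ z - F₁ z * G₁ z)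
          (fun z => F₀ z * G₁ z + F₁ z * G₀ z) i)) (e i)) := by
    refine reOpB_eq_of_reO_eq (isRightPara_sum_odotL_rightFC _ _)
      (isRightPara_sum_odotR_leftFC _ _) fun v hv => ?_
    refine (SeparatingDual.eq_iff_forall_dual_eq (R := ℝ)).2 fun φ => ?_
    rw [hleft φ hv, apply_sum_odotL_rightFC hUad hJ hJc hc0 Γc hs (hc h₀) (hc h₁) φ v]
    simp only [hprod]
    have hswap := hcut.integral_congr (Γc.toPlane hUad hJ) (Γd.toPlane hUad hJ)
      (hadm.mul (cutoffAdm_cplx_resolvent hJ φ v)) (hadm.mul (cutoffAdm_cplx hJ (φ.comp (reO V)) hv))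
      fun z hz => by rw [cplx_resolvent_eq hz.2 φ hv]
    simp only [Pi.mul_apply] at hswap
    rw [hswap]
  refine ⟨?_, hsplit⟩
  rw [hsplit]
  refine reOpB_eq_of_reO_eq (isRightPara_lifO _) (isRightPara_sum_odotR_leftFC _ _) fun v hv => ?_
  refine (SeparatingDual.eq_iff_forall_dual_eq (R := ℝ)).2 fun φ => ?_
  rw [hleft φ hv, rcomp, reO_lifO, ContinuousLinearMap.comp_apply,
    apply_sum_odotL_rightFC hUad hJ hJc hc0 Γa hs (hc hF₀.holo) (hc hF₁.holo) φ]
  rw [hcut.integral_mul_integral (Γa.toPlane hUad hJ) (Γb.toPlane hUad hJ) (Γd.toPlane hUad hJ)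
    hF hG (cutoffAdm_cplx_resolvent hJ φ _) (cutoffAdm_cplx hJ (φ.comp (reO V)) hv)
    (E := fun s t => cplx J (φ.comp ((reO V).comp (resJ T J s))) (resJ T J t v))
    (fun s _ => cutoffAdm_cplx hJ _ hv) (fun s _ => ?_)
    (fun s hs t ht => cplx_resolvent_identity hJ hs.2 ht.2 φ v)]
  exact cplx_sum_odotR_leftFC hUad hJ hJc hc0 Γb hs (hc hG₀.holo) (hc hG₁.holo) _ hv
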